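/- Suppose that 1 < c < 82/79 and set γ = 1/c. For a positive integer N put P = 10⁻⁹ N^γ, D = log N, and for j = 0 or j = 1 put Σ_j = Σ_{d ≤ D} μ(d) Σ_{P < p ≤ 2P} ψ(−(1/d²)(N + j − [p^c])^γ) log p, where p runs over primes. Then for j = 0, 1 there exists a constant C > 0 such that |Σ_j| ≤ C · N^{2γ−1} / log N for all sufficiently large N. -/

import Mathlib

/-- `ψ(t) = {t} - 1/2`. -/
noncomputable def psi (t : ℝ) : ℝ := Int.fract t - 1 / 2

/-- `P = 10⁻⁹ N^γ` where `γ = 1/c`. -/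
noncomputable def PP (c : ℝ) (N : ℕ) : ℝ := ((10 : ℝ) ^ 9)⁻¹ * (N : ℝ) ^ (1 / c)

/-- The primes `P < p ≤ 2P`.  (Any such prime satisfies `p ≤ N`, so the
range `Finset.range (N+1)` captures all of them.) -/
noncomputable def primesIn (c : ℝ) (N : ℕ) : Finset ℕ :=
  (Finset.range (N + 1)).filter
    (fun p => p.Prime ∧ PP c N < (p : ℝ) ∧ (p : ℝ) ≤ 2 * PP c N)

/-- `Σ_j = Σ_{d ≤ D} μ(d) Σ_{P < p ≤ 2P} ψ(-(1/d²)(N + j - [p^c])^γ) log p`,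
with `D = log N` and `γ = 1/c`. -/
noncomputable def SigmaJ (c : ℝ) (j N : ℕ) : ℝ :=
  ∑ d ∈ Finset.Icc 1 ⌊Real.log N⌋₊,
    ((ArithmeticFunction.moebius d : ℤ) : ℝ) *
      ∑ p ∈ primesIn c N,
        psi (-(1 / (d : ℝ) ^ 2) * ((N : ℝ) + (j : ℝ) - (⌊(p : ℝ) ^ c⌋ : ℝ)) ^ (1 / c))
          * Real.log p

open Finset

/-- `e(x) = exp(2πix)`. -/
noncomputable def expi (x : ℝ) : ℂ := Complex.exp ((2 * Real.pi * x : ℝ) * Complex.I)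

theorem norm_expi (x : ℝ) : ‖expi x‖ = 1 := Complex.norm_exp_ofReal_mul_I _

theorem expi_add (x y : ℝ) : expi (x + y) = expi x * expi y := by
  unfold expi
  rw [← Complex.exp_add]
  congr 1
  push_cast
  ring

theorem expi_int (k : ℤ) : expi k = 1 := by
  unfold expi
  rw [Complex.exp_eq_one_iff]
  exact ⟨k, by push_cast; ring⟩

theorem expi_neg (x : ℝ) : expi (-x) = (starRingEnd ℂ) (expi x) := by
  unfold expi
  rw [← Complex.exp_conj]
  congr 1
  rw [map_mul, Complex.conj_ofReal, Complex.conj_I]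
  push_cast
  ring

theorem expi_zero : expi 0 = 1 := by simp [expi]

theorem expi_eq (x : ℝ) :
    expi x = (Real.cos (2 * Real.pi * x) : ℂ) + Real.sin (2 * Real.pi * x) * Complex.I := by
  unfold expi
  rw [Complex.exp_mul_I, Complex.ofReal_cos, Complex.ofReal_sin]

/-- `(e(y) - 1)⁻¹` in terms of the cotangent. -/
noncomputable def cotWeight (y : ℝ) : ℂ :=
  -1 / 2 - (Real.cos (Real.pi * y) / Real.sin (Real.pi * y) : ℝ) * Complex.I / 2

theorem expi_sub_one_mul_cotWeight {y : ℝ} (hy : Real.sin (Real.pi * y) ≠ 0) :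
    (expi y - 1) * cotWeight y = 1 := by
  have h1 : Real.cos (2 * Real.pi * y) = 1 - 2 * (Real.sin (Real.pi * y) * Real.sin (Real.pi * y)) := by
    rw [show 2 * Real.pi * y = 2 * (Real.pi * y) by ring, Real.cos_two_mul]
    nlinarith [Real.sin_sq_add_cos_sq (Real.pi * y)]
  have h2 : Real.sin (2 * Real.pi * y) = 2 * Real.sin (Real.pi * y) * Real.cos (Real.pi * y) := by
    rw [show 2 * Real.pi * y = 2 * (Real.pi * y) by ring, Real.sin_two_mul]
  have h3 := Real.sin_sq_add_cos_sq (Real.pi * y)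
  rw [expi_eq, h1, h2, cotWeight]
  generalize Real.sin (Real.pi * y) = s at *
  generalize Real.cos (Real.pi * y) = t at *
  apply Complex.ext
  · simp [-Complex.ofReal_div]
    field_simp
    linear_combination h3
  · simp [-Complex.ofReal_div]
    field_simp
    ring

theorem two_mul_le_sin_pi_mul {y l : ℝ} (hl : 0 < l) (h1 : l ≤ y) (h2 : y ≤ 1 - l) :
    2 * l ≤ Real.sin (Real.pi * y) := by
  have hpi := Real.pi_pos
  rcases le_total y (1 / 2) with h | h
  · have := Real.mul_le_sin (x := Real.pi * y) (by nlinarith) (by nlinarith)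
    calc 2 * l ≤ 2 * y := by linarith
      _ = 2 / Real.pi * (Real.pi * y) := by field_simp
      _ ≤ _ := this
  · have := Real.mul_le_sin (x := Real.pi * (1 - y)) (by nlinarith) (by nlinarith)
    calc 2 * l ≤ 2 * (1 - y) := by linarith
      _ = 2 / Real.pi * (Real.pi * (1 - y)) := by field_simp
      _ ≤ _ := this
      _ = Real.sin (Real.pi * y) := by
        rw [← Real.sin_pi_sub]; congr 1; ring

theorem abs_cot_le {y l : ℝ} (hl : 0 < l) (h1 : l ≤ y) (h2 : y ≤ 1 - l) :
    |Real.cos (Real.pi * y) / Real.sin (Real.pi * y)| ≤ 1 / (2 * l) := by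
  have h := two_mul_le_sin_pi_mul hl h1 h2
  rw [abs_div, abs_of_pos (by linarith : 0 < Real.sin (Real.pi * y))]
  exact div_le_div₀ zero_le_one (Real.abs_cos_le_one _) (by positivity) h

theorem cot_antitone {y z l : ℝ} (hl : 0 < l) (h1 : l ≤ y) (hyz : y ≤ z) (h2 : z ≤ 1 - l) :
    Real.cos (Real.pi * z) / Real.sin (Real.pi * z) ≤
      Real.cos (Real.pi * y) / Real.sin (Real.pi * y) := by
  have hy := two_mul_le_sin_pi_mul hl h1 (hyz.trans h2)
  have hz := two_mul_le_sin_pi_mul hl (h1.trans hyz) h2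
  rw [div_le_div_iff₀ (by linarith) (by linarith)]
  have : 0 ≤ Real.sin (Real.pi * z - Real.pi * y) := by
    apply Real.sin_nonneg_of_nonneg_of_le_pi <;> nlinarith [Real.pi_pos]
  rw [Real.sin_sub] at this
  linarith

theorem norm_cotWeight_le {y l : ℝ} (hl : 0 < l) (hl' : l ≤ 1 / 2) (h1 : l ≤ y) (h2 : y ≤ 1 - l) :
    ‖cotWeight y‖ ≤ 1 / (2 * l) := by
  have h := abs_cot_le hl h1 h2
  unfold cotWeight
  have h3 : (1 : ℝ) ≤ 1 / (2 * l) := by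
    rw [le_div_iff₀ (by positivity)]; linarith
  calc _ ≤ ‖(-1 / 2 : ℂ)‖ + ‖((Real.cos (Real.pi * y) / Real.sin (Real.pi * y) : ℝ) : ℂ) * Complex.I / 2‖ :=
        norm_sub_le _ _
    _ = 1 / 2 + |Real.cos (Real.pi * y) / Real.sin (Real.pi * y)| / 2 := by
        rw [norm_div, norm_div, norm_mul, Complex.norm_real, Real.norm_eq_abs]; simp
    _ ≤ _ := by linarith

theorem kusmin_landau_aux (x : ℕ → ℝ) (a b : ℕ) (k : ℤ) {l : ℝ} (hl : 0 < l)
    (hΔ : ∀ n, a ≤ n → n ≤ b → k + l ≤ x (n + 1) - x n ∧ x (n + 1) - x n ≤ k + 1 - l)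
    (hmono : ∀ n, a ≤ n → n < b → x (n + 1) - x n ≤ x (n + 2) - x (n + 1)) (hab : a ≤ b) :
    ‖∑ n ∈ Icc a b, expi (x n) - expi (x (b + 1)) * cotWeight (x (b + 1) - x b - k)‖ ≤
      ‖cotWeight (x (a + 1) - x a - k)‖ +
        (Real.cos (Real.pi * (x (a + 1) - x a - k)) / Real.sin (Real.pi * (x (a + 1) - x a - k)) -
        Real.cos (Real.pi * (x (b + 1) - x b - k)) / Real.sin (Real.pi * (x (b + 1) - x b - k))) / 2 := by
  have key : ∀ n, a ≤ n → n ≤ b →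
      expi (x n) = (expi (x (n + 1)) - expi (x n)) * cotWeight (x (n + 1) - x n - k) := by
    intro n h1 h2
    have hs : Real.sin (Real.pi * (x (n + 1) - x n - k)) ≠ 0 := by
      have := two_mul_le_sin_pi_mul (y := x (n + 1) - x n - k) hl
        (by linarith [(hΔ n h1 h2).1]) (by linarith [(hΔ n h1 h2).2])
      linarith
    have h3 := expi_sub_one_mul_cotWeight hs
    have h4 : expi (x (n + 1)) = expi (x n) * expi (x (n + 1) - x n - k) := by
      conv_lhs => rw [show x (n + 1) = x n + ((x (n + 1) - x n - k) + k) by ring]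
      rw [expi_add, expi_add, expi_int, mul_one]
    rw [h4]
    linear_combination (-expi (x n)) * h3
  induction b, hab using Nat.le_induction with
  | base =>
    have := key a le_rfl le_rfl
    rw [Icc_self, sum_singleton]
    have e1 : expi (x a) - expi (x (a + 1)) * cotWeight (x (a + 1) - x a - k) =
        - (expi (x a) * cotWeight (x (a + 1) - x a - k)) := by linear_combination this
    rw [e1, norm_neg, norm_mul, norm_expi]
    simp
  | succ b hab ih =>
    have ih' := ih (fun n h1 h2 => hΔ n h1 (by omega)) (fun n h1 h2 => hmono n h1 (by omega))
      (fun n h1 h2 => key n h1 (by omega))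
    have hk := key (b + 1) (by omega) le_rfl
    rw [← Finset.insert_Icc_right_eq_Icc_add_one (by omega : a ≤ b + 1), sum_insert (by simp)]
    set y := x (b + 1) - x b - k with hy
    set z := x (b + 1 + 1) - x (b + 1) - k with hz
    have e1 : expi (x (b + 1)) + ∑ n ∈ Icc a b, expi (x n) - expi (x (b + 1 + 1)) * cotWeight z =
      (∑ n ∈ Icc a b, expi (x n) - expi (x (b + 1)) * cotWeight y) +
        expi (x (b + 1)) * (cotWeight y - cotWeight z) := by
      linear_combination hk
    rw [e1]
    have hyz : y ≤ z := by
      have := hmono b hab (by omega)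
      rw [hy, hz]; linarith
    have hc := cot_antitone hl (by rw [hy]; linarith [(hΔ b hab (by omega)).1]) hyz
      (by rw [hz]; linarith [(hΔ (b + 1) (by omega) le_rfl).2])
    have e2 : ‖expi (x (b + 1)) * (cotWeight y - cotWeight z)‖ =
        (Real.cos (Real.pi * y) / Real.sin (Real.pi * y) -
          Real.cos (Real.pi * z) / Real.sin (Real.pi * z)) / 2 := by
      rw [norm_mul, norm_expi, one_mul]
      have : cotWeight y - cotWeight z =
        ((-((Real.cos (Real.pi * y) / Real.sin (Real.pi * y) -
          Real.cos (Real.pi * z) / Real.sin (Real.pi * z)) / 2) : ℝ) : ℂ) * Complex.I := by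
        unfold cotWeight; push_cast; ring
      rw [this, norm_mul, Complex.norm_real, Complex.norm_I, mul_one, Real.norm_eq_abs, abs_neg,
        abs_of_nonneg (by linarith)]
    calc _ ≤ _ := norm_add_le _ _
      _ ≤ _ := by rw [e2]; linarith

/-- The Kusmin–Landau inequality. -/
theorem kusmin_landau (x : ℕ → ℝ) (a b : ℕ) (k : ℤ) {l : ℝ} (hl : 0 < l) (hl' : l ≤ 1 / 2)
    (hΔ : ∀ n, a ≤ n → n < b → k + l ≤ x (n + 1) - x n ∧ x (n + 1) - x n ≤ k + 1 - l)
    (hmono : ∀ n, a ≤ n → n + 1 < b → x (n + 1) - x n ≤ x (n + 2) - x (n + 1)) :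
    ‖∑ n ∈ Icc a b, expi (x n)‖ ≤ 2 / l := by
  have h2l : (1 : ℝ) ≤ 1 / (2 * l) := by
    rw [le_div_iff₀ (by positivity)]; linarith
  have h4 : 2 / l = 4 * (1 / (2 * l)) := by field_simp; norm_num
  rcases lt_trichotomy a b with hab | hab | hab
  · obtain ⟨b, rfl⟩ : ∃ b', b = b' + 1 := ⟨b - 1, by omega⟩
    have h := kusmin_landau_aux x a b k hl (fun n h1 h2 => hΔ n h1 (by omega))
      (fun n h1 h2 => hmono n h1 (by omega)) (by omega)
    rw [← Finset.insert_Icc_right_eq_Icc_add_one (by omega : a ≤ b + 1), sum_insert (by simp)]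
    have ha := hΔ a le_rfl (by omega)
    have hb := hΔ b (by omega) (by omega)
    have c1 := norm_cotWeight_le (y := x (a + 1) - x a - k) hl hl' (by linarith) (by linarith)
    have c2 := norm_cotWeight_le (y := x (b + 1) - x b - k) hl hl' (by linarith) (by linarith)
    have c3 := abs_cot_le (y := x (a + 1) - x a - k) hl (by linarith) (by linarith)
    have c4 := abs_cot_le (y := x (b + 1) - x b - k) hl (by linarith) (by linarith)
    rw [abs_le] at c3 c4
    set z := expi (x (b + 1)) * cotWeight (x (b + 1) - x b - k) with hz
    have hz' : ‖z‖ ≤ 1 / (2 * l) := by rw [hz, norm_mul, norm_expi, one_mul]; exact c2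
    have h5 : ‖expi (x (b + 1)) + ∑ n ∈ Icc a b, expi (x n)‖ ≤
        ‖expi (x (b + 1))‖ + (‖∑ n ∈ Icc a b, expi (x n) - z‖ + ‖z‖) := by
      calc _ = ‖expi (x (b + 1)) + ((∑ n ∈ Icc a b, expi (x n) - z) + z)‖ := by congr 1; ring
        _ ≤ _ := (norm_add_le _ _).trans (by gcongr; exact norm_add_le _ _)
    rw [norm_expi] at h5
    linarith [c3.1, c3.2, c4.1, c4.2]
  · subst hab
    rw [Icc_self, sum_singleton, norm_expi]; linarith
  · rw [Icc_eq_empty (by omega)]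
    simp; positivity

theorem exists_eq_Icc_of_ordConnected (S : Finset ℕ) (hS : (S : Set ℕ).OrdConnected) :
    ∃ p q, S = Icc p q := by
  rcases S.eq_empty_or_nonempty with rfl | hne
  · exact ⟨1, 0, by simp⟩
  · refine ⟨S.min' hne, S.max' hne, ?_⟩
    ext n
    rw [mem_Icc]
    constructor
    · exact fun h => ⟨S.min'_le n h, S.le_max' n h⟩
    · intro h
      exact_mod_cast hS.out (x := S.min' hne) (by exact_mod_cast S.min'_mem hne)
        (y := S.max' hne) (by exact_mod_cast S.max'_mem hne) h

theorem diff_bounds (D : ℕ → ℝ) (a b : ℕ) {l L : ℝ}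
    (h : ∀ n, a ≤ n → n < b → l ≤ D (n + 1) - D n ∧ D (n + 1) - D n ≤ L) {p q : ℕ} (hp : a ≤ p)
    (hpq : p ≤ q) (hq : q ≤ b) :
    ((q : ℝ) - p) * l ≤ D q - D p ∧ D q - D p ≤ ((q : ℝ) - p) * L := by
  induction q, hpq using Nat.le_induction with
  | base => simp
  | succ q hpq ih =>
    have h1 := ih (by omega)
    have h2 := h q (by omega) (by omega)
    push_cast
    constructor <;> nlinarith

theorem norm_sum_expi_le_card (S : Finset ℕ) (x : ℕ → ℝ) : ‖∑ n ∈ S, expi (x n)‖ ≤ #S := by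
  calc _ ≤ ∑ n ∈ S, ‖expi (x n)‖ := norm_sum_le _ _
    _ = _ := by simp [norm_expi]

/-- One unit cell in the proof of the second derivative test. -/
theorem second_diff_cell (x : ℕ → ℝ) (a b : ℕ) {l L : ℝ} (hl : 0 < l) (hl4 : l ≤ 1 / 4)
    (h : ∀ n, a ≤ n → n < b → l ≤ (x (n + 2) - x (n + 1)) - (x (n + 1) - x n) ∧
      (x (n + 2) - x (n + 1)) - (x (n + 1) - x n) ≤ L) (k : ℤ) :
    ‖∑ n ∈ Icc a b with ⌊x (n + 1) - x n + √l⌋ = k, expi (x n)‖ ≤ 4 / √l + 1 := by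
  set D : ℕ → ℝ := fun n => x (n + 1) - x n with hD
  have hk0 : 0 < √l := Real.sqrt_pos.2 hl
  have hk1 : √l ≤ 1 / 2 := by
    rw [Real.sqrt_le_left (by norm_num)]; linarith
  have hkl : √l * √l = l := Real.mul_self_sqrt hl.le
  have hd := fun p q => diff_bounds D a b (l := l) (L := L) h (p := p) (q := q)
  have hmono : ∀ p q, a ≤ p → p ≤ q → q ≤ b → D p ≤ D q := by
    intro p q h1 h2 h3
    have h4 := (hd p q h1 h2 h3).1
    have h5 : (p : ℝ) ≤ q := by exact_mod_cast h2
    nlinarith [mul_nonneg (sub_nonneg.2 h5) hl.le]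
  have hfl : ∀ n, ⌊x (n + 1) - x n + √l⌋ = k ↔ k ≤ D n + √l ∧ D n + √l < k + 1 := fun n => Int.floor_eq_iff
  obtain ⟨p, q, hpq⟩ := exists_eq_Icc_of_ordConnected
    ({n ∈ Icc a b | ⌊x (n + 1) - x n + √l⌋ = k ∧ D n < k + √l}) (by
      refine ⟨fun m hm n hn i hi => ?_⟩
      simp only [coe_filter, mem_Icc, Set.mem_ofPred_eq, hfl] at hm hn hi ⊢
      have h1 := hmono m i hm.1.1 hi.1 (by have := hi.2; omega)
      have h2 := hmono i n (by have := hi.1; omega) hi.2 hn.1.2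
      have h3 := hi.1
      have h4 := hi.2
      refine ⟨by omega, ⟨by linarith, by linarith⟩, by linarith⟩)
  obtain ⟨r, s, hrs⟩ := exists_eq_Icc_of_ordConnected
    ({n ∈ Icc a b | ⌊x (n + 1) - x n + √l⌋ = k ∧ ¬ D n < k + √l}) (by
      refine ⟨fun m hm n hn i hi => ?_⟩
      simp only [coe_filter, mem_Icc, Set.mem_ofPred_eq, hfl, not_lt] at hm hn hi ⊢
      have h1 := hmono m i hm.1.1 hi.1 (by have := hi.2; omega)
      have h2 := hmono i n (by have := hi.1; omega) hi.2 hn.1.2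
      have h3 := hi.1
      have h4 := hi.2
      refine ⟨by omega, ⟨by linarith, by linarith⟩, by linarith⟩)
  have hmem1 : ∀ n, n ∈ Icc p q → (a ≤ n ∧ n ≤ b) ∧ (k ≤ D n + √l ∧ D n + √l < k + 1) ∧ D n < k + √l := by
    intro n hn
    rw [← hpq] at hn
    simpa only [mem_filter, mem_Icc, hfl] using hn
  have hmem2 : ∀ n, n ∈ Icc r s → (a ≤ n ∧ n ≤ b) ∧ (k ≤ D n + √l ∧ D n + √l < k + 1) ∧ k + √l ≤ D n := by
    intro n hn
    rw [← hrs] at hn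
    simpa only [mem_filter, mem_Icc, hfl, not_lt] using hn
  rw [← sum_filter_add_sum_filter_not _ (fun n => D n < k + √l), filter_filter, filter_filter,
    hpq, hrs]
  have near : ‖∑ n ∈ Icc p q, expi (x n)‖ ≤ 2 / √l + 1 := by
    refine (norm_sum_expi_le_card _ _).trans ?_
    rcases lt_or_ge q p with hlt | hle
    · rw [Icc_eq_empty (by omega)]; simp; positivity
    · have hp := hmem1 p (by simp [hle])
      have hq := hmem1 q (by simp [hle])
      have h1 := (hd p q hp.1.1 hle hq.1.2).1
      rw [Nat.card_Icc, Nat.cast_sub (by omega)]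
      have h2 : ((q : ℝ) - p) * √l ≤ 2 := by
        have : ((q : ℝ) - p) * √l * √l ≤ 2 * √l := by rw [mul_assoc, hkl]; linarith [hp.2.1.1, hq.2.2]
        exact le_of_mul_le_mul_right this hk0
      have h3 : (q : ℝ) - p ≤ 2 / √l := by rwa [le_div_iff₀ hk0]
      push_cast
      linarith
  have far : ‖∑ n ∈ Icc r s, expi (x n)‖ ≤ 2 / √l := by
    apply kusmin_landau x r s k hk0 hk1
    · intro n h1 h2
      have := hmem2 n (by simp; omega)
      exact ⟨this.2.2, by linarith [this.2.1.2]⟩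
    · intro n h1 h2
      have h3 := hmem2 n (by simp; omega)
      have h4 := hmem2 (n + 1) (by simp; omega)
      exact hmono n (n + 1) h3.1.1 (by omega) h4.1.2
  calc _ ≤ _ := norm_add_le _ _
    _ ≤ _ := add_le_add near far
    _ = _ := by ring

/-- Discrete form of van der Corput's second derivative test. -/
theorem second_diff_test (x : ℕ → ℝ) (a b : ℕ) {l L : ℝ} (hl : 0 < l) (hlL : l ≤ L) (hab : a ≤ b)
    (h : ∀ n, a ≤ n → n + 2 ≤ b → l ≤ x (n + 2) - 2 * x (n + 1) + x n ∧
      x (n + 2) - 2 * x (n + 1) + x n ≤ L) :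
    ‖∑ n ∈ Icc a b, expi (x n)‖ ≤ 12 * (((b : ℝ) - a) * L + 1) * (1 / √l + 1) := by
  have hk0 : 0 < √l := Real.sqrt_pos.2 hl
  have hab' : (a : ℝ) ≤ b := by exact_mod_cast hab
  have hX : 0 ≤ ((b : ℝ) - a) * L := mul_nonneg (by linarith) (by linarith)
  have h1k : 0 < 1 / √l := by positivity
  rcases lt_or_ge (1 / 4) l with hl4 | hl4
  · refine (norm_sum_expi_le_card _ _).trans ?_
    rw [Nat.card_Icc, Nat.cast_sub (by omega)]
    push_cast
    nlinarith
  rcases eq_or_lt_of_le hab with rfl | hlt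
  · refine (norm_sum_expi_le_card _ _).trans ?_
    simp
    have : 0 < (√l)⁻¹ := by positivity
    linarith
  obtain ⟨b, rfl⟩ : ∃ b', b = b' + 1 := ⟨b - 1, by omega⟩
  have hab2 : a ≤ b := by omega
  have hab3 : (a : ℝ) ≤ b := by exact_mod_cast hab2
  set φ : ℕ → ℤ := fun n => ⌊x (n + 1) - x n + √l⌋ with hφ
  have hdb := fun p q => diff_bounds (fun n => x (n + 1) - x n) a b (l := l) (L := L) (fun n h1 h2 => by
      have := h n h1 (by omega)
      constructor <;> simp only [add_assoc] <;> norm_num <;> linarith) (p := p) (q := q)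
  have hmono : ∀ p q, a ≤ p → p ≤ q → q ≤ b → x (p + 1) - x p ≤ x (q + 1) - x q := by
    intro p q h1 h2 h3
    have h4 := (hdb p q h1 h2 h3).1
    have h5 : (p : ℝ) ≤ q := by exact_mod_cast h2
    nlinarith [mul_nonneg (sub_nonneg.2 h5) hl.le]
  have hmaps : ∀ n ∈ Icc a b, φ n ∈ Icc (φ a) (φ b) := by
    intro n hn
    rw [mem_Icc] at hn ⊢
    constructor
    · exact Int.floor_le_floor (by linarith [hmono a n le_rfl hn.1 hn.2])
    · exact Int.floor_le_floor (by linarith [hmono n b hn.1 hn.2 le_rfl])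
  have hcell := second_diff_cell x a b hl hl4 (L := L) (fun n h1 h2 => by
      have := h n h1 (by omega)
      constructor <;> linarith)
  have hsum : ‖∑ n ∈ Icc a b, expi (x n)‖ ≤ #(Icc (φ a) (φ b)) * (4 / √l + 1) := by
    rw [← sum_fiberwise_of_maps_to hmaps]
    refine (norm_sum_le _ _).trans ?_
    rw [← nsmul_eq_mul]
    exact sum_le_card_nsmul _ _ _ (fun k _ => hcell k)
  have hcard : (#(Icc (φ a) (φ b)) : ℝ) ≤ ((b : ℝ) - a) * L + 2 := by
    have h1 : φ a ≤ φ b := Int.floor_le_floor (by linarith [hmono a b le_rfl hab2 le_rfl])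
    rw [Int.card_Icc]
    have h2 : ((φ b + 1 - φ a).toNat : ℝ) = φ b + 1 - φ a := by
      have : ((φ b + 1 - φ a).toNat : ℤ) = φ b + 1 - φ a := Int.toNat_of_nonneg (by omega)
      exact_mod_cast this
    rw [h2]
    have h3 := Int.floor_le (x (b + 1) - x b + √l)
    have h4 := Int.lt_floor_add_one (x (a + 1) - x a + √l)
    have h5 := (hdb a b le_rfl hab2 le_rfl).2
    simp only [hφ]
    linarith
  rw [← Finset.insert_Icc_right_eq_Icc_add_one (by omega : a ≤ b + 1), sum_insert (by simp)]
  have hL0 : 0 < L := by linarith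
  have hY : 0 ≤ ((b : ℝ) - a) * L := mul_nonneg (by linarith) (by linarith)
  calc _ ≤ _ := norm_add_le _ _
    _ ≤ 1 + (((b : ℝ) - a) * L + 2) * (4 / √l + 1) := by
      rw [norm_expi]
      gcongr
      exact hsum.trans (by gcongr)
    _ ≤ _ := by
      push_cast
      rw [show 4 / √l = 4 * (1 / √l) by ring]
      have : 0 ≤ L * (1 / √l + 1) := by positivity
      nlinarith [mul_nonneg hY h1k.le]

theorem norm_sum_expi_neg (S : Finset ℕ) (x : ℕ → ℝ) :
    ‖∑ n ∈ S, expi (-x n)‖ = ‖∑ n ∈ S, expi (x n)‖ := by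
  simp only [expi_neg]
  rw [← map_sum, RCLike.norm_conj]

/-- The second derivative test on an order-connected finite set, for either sign of the
second difference. -/
theorem second_diff_test_ordConnected (x : ℕ → ℝ) (S : Finset ℕ) (hS : (S : Set ℕ).OrdConnected)
    {l L : ℝ} (hl : 0 < l) (hlL : l ≤ L)
    (h : (∀ n, n ∈ S → n + 2 ∈ S → l ≤ x (n + 2) - 2 * x (n + 1) + x n ∧
      x (n + 2) - 2 * x (n + 1) + x n ≤ L) ∨
      (∀ n, n ∈ S → n + 2 ∈ S → l ≤ -(x (n + 2) - 2 * x (n + 1) + x n) ∧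
      -(x (n + 2) - 2 * x (n + 1) + x n) ≤ L)) :
    ‖∑ n ∈ S, expi (x n)‖ ≤ 12 * (#S * L + 1) * (1 / √l + 1) := by
  have hk0 : 0 < √l := Real.sqrt_pos.2 hl
  have hL0 : 0 < L := by linarith
  obtain ⟨p, q, rfl⟩ := exists_eq_Icc_of_ordConnected S hS
  rcases lt_or_ge q p with hlt | hle
  · rw [Icc_eq_empty (by omega)]
    simp only [sum_empty, norm_zero]
    positivity
  have hc : ((q : ℝ) - p) ≤ #(Icc p q) := by
    rw [Nat.card_Icc, Nat.cast_sub (by omega)]; push_cast; linarith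
  rcases h with h | h
  · refine (second_diff_test x p q hl hlL hle (fun n h1 h2 =>
      h n (by simp; omega) (by simp; omega))).trans ?_
    gcongr
  · rw [← norm_sum_expi_neg]
    refine (second_diff_test (fun n => -x n) p q hl hlL hle (fun n h1 h2 => by
      have := h n (by simp; omega) (by simp; omega)
      constructor <;> linarith)).trans ?_
    gcongr

theorem exists_second_diff_eq (g g1 g2 : ℝ → ℝ) (a : ℝ)
    (h1 : ∀ x ∈ Set.Icc a (a + 2), HasDerivAt g (g1 x) x)
    (h2 : ∀ x ∈ Set.Icc a (a + 2), HasDerivAt g1 (g2 x) x) :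
    ∃ ξ ∈ Set.Icc a (a + 2), g (a + 2) - 2 * g (a + 1) + g a = g2 ξ := by
  have hd : ∀ t ∈ Set.Icc a (a + 1),
      HasDerivAt (fun t => g (t + 1) - g t) (g1 (t + 1) - g1 t) t := by
    intro t ht
    have e1 := (h1 (t + 1) ⟨by linarith [ht.1], by linarith [ht.2]⟩).comp_add_const t 1
    exact e1.sub (h1 t ⟨ht.1, by linarith [ht.2]⟩)
  obtain ⟨η, hη, e⟩ := exists_hasDerivAt_eq_slope (fun t => g (t + 1) - g t)
    (fun t => g1 (t + 1) - g1 t) (by linarith : a < a + 1)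
    (fun t ht => (hd t ht).continuousAt.continuousWithinAt)
    (fun t ht => hd t ⟨ht.1.le, ht.2.le⟩)
  obtain ⟨ξ, hξ, e'⟩ := exists_hasDerivAt_eq_slope g1 g2 (by linarith : η < η + 1)
    (fun t ht => (h2 t ⟨by linarith [ht.1, hη.1], by linarith [ht.2, hη.2]⟩).continuousAt.continuousWithinAt)
    (fun t ht => h2 t ⟨by linarith [ht.1, hη.1], by linarith [ht.2, hη.2]⟩)
  refine ⟨ξ, ⟨by linarith [hξ.1, hη.1], by linarith [hξ.2, hη.2]⟩, ?_⟩
  have e2 : a + 1 + 1 = a + 2 := by ring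
  simp only [add_sub_cancel_left, div_one, e2] at e e'
  rw [e', e]
  ring

/-- `f` is a phase on `J ⊆ [X, 2X]` for which `x² f''(x)` and its derivative have constant sign and
sizes between `l` and `L` (up to the natural scaling). -/
structure PhaseOn (J : Set ℝ) (f f1 f2 g1 : ℝ → ℝ) (X l L : ℝ) : Prop where
  ordConnected : J.OrdConnected
  subset : J ⊆ Set.Icc X (2 * X)
  deriv1 : ∀ x ∈ J, HasDerivAt f (f1 x) x
  deriv2 : ∀ x ∈ J, HasDerivAt f1 (f2 x) x
  deriv3 : ∀ x ∈ J, HasDerivAt (fun x => x ^ 2 * f2 x) (g1 x) x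
  bound2 : (∀ x ∈ J, l * X ≤ x ^ 2 * f2 x ∧ x ^ 2 * f2 x ≤ L * X) ∨
    (∀ x ∈ J, l * X ≤ -(x ^ 2 * f2 x) ∧ -(x ^ 2 * f2 x) ≤ L * X)
  bound3 : (∀ x ∈ J, l ≤ g1 x ∧ g1 x ≤ L) ∨ (∀ x ∈ J, l ≤ -g1 x ∧ -g1 x ≤ L)

open Classical in
/-- `e(f(n))` restricted to `n ∈ J`. -/
noncomputable def cutExp (J : Set ℝ) (f : ℝ → ℝ) (n : ℕ) : ℂ :=
  if (n : ℝ) ∈ J then expi (f n) else 0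

theorem norm_cutExp_le (J : Set ℝ) (f : ℝ → ℝ) (n : ℕ) : ‖cutExp J f n‖ ≤ 1 := by
  unfold cutExp
  split_ifs <;> simp [norm_expi]

theorem cutExp_eq_zero {J : Set ℝ} {f : ℝ → ℝ} {n : ℕ} (h : (n : ℝ) ∉ J) : cutExp J f n = 0 := by
  simp [cutExp, h]

theorem card_le_of_Icc_bound (S : Finset ℕ) {A B : ℝ} (hAB : A ≤ B)
    (h : ∀ n ∈ S, A ≤ n ∧ (n : ℝ) ≤ B) : (#S : ℝ) ≤ B - A + 1 := by
  rcases S.eq_empty_or_nonempty with rfl | hne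
  · simp; linarith
  have h1 : S ⊆ Icc (S.min' hne) (S.max' hne) := fun n hn => by
    rw [mem_Icc]; exact ⟨S.min'_le n hn, S.le_max' n hn⟩
  have h2 := card_le_card h1
  rw [Nat.card_Icc] at h2
  have h3 : S.min' hne ≤ S.max' hne := S.min'_le _ (S.max'_mem hne)
  have h4 := (h _ (S.min'_mem hne)).1
  have h5 := (h _ (S.max'_mem hne)).2
  have h6 : (#S : ℝ) ≤ ((S.max' hne + 1 - S.min' hne : ℕ) : ℝ) := by exact_mod_cast h2
  rw [Nat.cast_sub (by omega)] at h6
  push_cast at h6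
  linarith

section
variable {J : Set ℝ} {f f1 f2 g1 : ℝ → ℝ} {X l L : ℝ}

theorem PhaseOn.typeI_inner (h : PhaseOn J f f1 f2 g1 X l L) (hX : 1 ≤ X) (hl : 0 < l)
    (hl1 : l ≤ 1) (hL : 1 ≤ L) {k : ℕ} (hk : 1 ≤ k) (hkX : (k : ℝ) ^ 2 ≤ X) (i : ℕ) :
    ‖∑ n ∈ Icc 1 i, cutExp J f (k * n)‖ ≤ 108 * L * √(X / l) := by
  classical
  have hk' : (1 : ℝ) ≤ k := by exact_mod_cast hk
  have hk0 : (0 : ℝ) < k := by linarith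
  have hX0 : 0 < X := by linarith
  set S : Finset ℕ := {n ∈ Icc 1 i | ((k * n : ℕ) : ℝ) ∈ J} with hS
  have e1 : ∑ n ∈ Icc 1 i, cutExp J f (k * n) = ∑ n ∈ S, expi (f ((k * n : ℕ) : ℝ)) := by
    rw [hS, sum_filter]; rfl
  have hmem : ∀ n, n ∈ S → (k : ℝ) * n ∈ J := by
    intro n hn
    have := (mem_filter.1 hn).2
    exact_mod_cast this
  have hOC : (S : Set ℕ).OrdConnected := by
    refine ⟨fun a ha b hb c hc => ?_⟩
    have ha' := hmem a ha
    have hb' := hmem b hb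
    rw [mem_coe, hS, mem_filter, mem_Icc] at ha hb ⊢
    have := hc.1
    have := hc.2
    refine ⟨by omega, ?_⟩
    push_cast
    exact h.ordConnected.out ha' hb' ⟨by gcongr, by gcongr⟩
  have hcard : (#S : ℝ) ≤ X / k + 1 := by
    refine (card_le_of_Icc_bound S (A := X / k) (B := 2 * X / k) ?_ ?_).trans ?_
    · gcongr; linarith
    · intro n hn
      have := h.subset (hmem n hn)
      rw [div_le_iff₀ hk0, le_div_iff₀ hk0]
      exact ⟨by linarith [this.1], by linarith [this.2]⟩
    · apply le_of_eq; ring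
  have hdiff : ∀ n, n ∈ S → n + 2 ∈ S → ∃ y ∈ J, f ((k * (n + 2) : ℕ) : ℝ) -
      2 * f ((k * (n + 1) : ℕ) : ℝ) + f ((k * n : ℕ) : ℝ) = (k : ℝ) ^ 2 * f2 y := by
    intro n hn hn2
    have hJ : ∀ x ∈ Set.Icc (n : ℝ) (n + 2), (k : ℝ) * x ∈ J := fun x hx =>
      h.ordConnected.out (hmem n hn) (hmem _ hn2)
        ⟨by gcongr; exact hx.1, by push_cast; gcongr; exact hx.2⟩
    obtain ⟨ξ, hξ, e⟩ := exists_second_diff_eq (fun x => f (k * x)) (fun x => k * f1 (k * x))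
      (fun x => k ^ 2 * f2 (k * x)) n
      (fun x hx => by
        have := (h.deriv1 _ (hJ x hx)).comp x ((hasDerivAt_id x).const_mul (k : ℝ))
        exact this.congr_deriv (by ring))
      (fun x hx => by
        have := ((h.deriv2 _ (hJ x hx)).comp x ((hasDerivAt_id x).const_mul (k : ℝ))).const_mul (k : ℝ)
        exact this.congr_deriv (by ring))
    refine ⟨k * ξ, hJ ξ hξ, ?_⟩
    push_cast
    exact e
  have hb : ∀ y ∈ J, ∀ v, l * X ≤ y ^ 2 * v → y ^ 2 * v ≤ L * X →
      (k : ℝ) ^ 2 * l / (4 * X) ≤ k ^ 2 * v ∧ (k : ℝ) ^ 2 * v ≤ k ^ 2 * L / X := by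
    intro y hy v h1 h2
    have hy' := h.subset hy
    have hy0 : 0 < y := by linarith [hy'.1]
    have hv : 0 < v := by
      have : 0 < y ^ 2 * v := lt_of_lt_of_le (by positivity) h1
      exact (pos_iff_pos_of_mul_pos this).1 (by positivity)
    have h3 : y ^ 2 ≤ 4 * X ^ 2 := by nlinarith [hy'.1, hy'.2]
    have h4 : X ^ 2 ≤ y ^ 2 := by nlinarith [hy'.1, hy'.2]
    constructor
    · rw [div_le_iff₀ (by positivity), mul_assoc]
      gcongr
      have : l * X ≤ 4 * X ^ 2 * v := h1.trans (by gcongr)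
      have : l * X ≤ (v * (4 * X)) * X := by linarith
      exact le_of_mul_le_mul_right this hX0
    · rw [le_div_iff₀ hX0, mul_assoc]
      gcongr
      have : X ^ 2 * v ≤ L * X := le_trans (by gcongr) h2
      have : (v * X) * X ≤ L * X := by linarith
      exact le_of_mul_le_mul_right this hX0
  have main := second_diff_test_ordConnected (fun n => f ((k * n : ℕ) : ℝ)) S hOC
    (l := (k : ℝ) ^ 2 * l / (4 * X)) (L := k ^ 2 * L / X) (by positivity) (by
      rw [div_le_div_iff₀ (by positivity) hX0]
      have : l * X ≤ L * (4 * X) := by nlinarith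
      calc (k : ℝ) ^ 2 * l * X = k ^ 2 * (l * X) := by ring
        _ ≤ k ^ 2 * (L * (4 * X)) := by gcongr
        _ = _ := by ring) (by
      rcases h.bound2 with hb2 | hb2
      · left
        intro n hn hn2
        obtain ⟨y, hy, e⟩ := hdiff n hn hn2
        rw [e]
        exact hb y hy _ (hb2 y hy).1 (hb2 y hy).2
      · right
        intro n hn hn2
        obtain ⟨y, hy, e⟩ := hdiff n hn hn2
        rw [e, ← mul_neg]
        exact hb y hy _ (by linarith [(hb2 y hy).1]) (by linarith [(hb2 y hy).2]))
  rw [e1]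
  refine main.trans ?_
  have hs : √((k : ℝ) ^ 2 * l / (4 * X)) = k / 2 / √(X / l) := by
    rw [show (k : ℝ) ^ 2 * l / (4 * X) = (k / 2) ^ 2 / (X / l) by field_simp; ring,
      Real.sqrt_div (by positivity), Real.sqrt_sq (by positivity)]
  have hr : (k : ℝ) ≤ √(X / l) := by
    apply Real.le_sqrt_of_sq_le
    refine hkX.trans ?_
    rw [le_div_iff₀ hl]
    nlinarith
  rw [hs]
  have hr0 : 0 < √(X / l) := by linarith
  set R := √(X / l)
  have b1 : (#S : ℝ) * (k ^ 2 * L / X) + 1 ≤ 3 * k * L := by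
    have : (#S : ℝ) * (k ^ 2 * L / X) ≤ (X / k + 1) * (k ^ 2 * L / X) := by gcongr
    have e : (X / k + 1) * (k ^ 2 * L / X) = k * L + (k ^ 2 / X) * L := by field_simp
    have : (k : ℝ) ^ 2 / X ≤ 1 := by rw [div_le_one hX0]; exact hkX
    nlinarith
  have b2 : 1 / ((k : ℝ) / 2 / R) + 1 ≤ 3 * R / k := by
    have : 1 / ((k : ℝ) / 2 / R) + 1 = (2 * R + k) / k := by field_simp
    rw [this]
    gcongr
    linarith
  calc _ ≤ 12 * (3 * k * L) * (3 * R / k) := by gcongr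
    _ = 108 * L * R := by field_simp; norm_num

/-- Correlation of two rows `n₁, n₂` of a bilinear sum. -/
theorem PhaseOn.typeII_inner (h : PhaseOn J f f1 f2 g1 X l L) (hX : 0 < X) (hl : 0 < l)
    (hl1 : l ≤ 1) (hL : 1 ≤ L) {K : ℕ} (hK : 1 ≤ K) {M : ℝ} (hM : 1 ≤ M) {n1 n2 : ℕ}
    (hn : n1 < n2) (hnK : n2 ≤ n1 + K) (h1M : 2 * X ≤ M * n1) (h2M : M * n2 ≤ 4 * X) (q : ℕ) :
    ‖∑ m ∈ Icc 1 q, cutExp J f (m * n2) * (starRingEnd ℂ) (cutExp J f (m * n1))‖ ≤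
      120 * K * L * √(M / l) := by
  classical
  have hK' : (1 : ℝ) ≤ K := by exact_mod_cast hK
  have hM0 : 0 < M := by linarith
  set S : Finset ℕ := {m ∈ Icc 1 q | ((m * n1 : ℕ) : ℝ) ∈ J ∧ ((m * n2 : ℕ) : ℝ) ∈ J} with hS
  have e1 : ∑ m ∈ Icc 1 q, cutExp J f (m * n2) * (starRingEnd ℂ) (cutExp J f (m * n1)) =
      ∑ m ∈ S, expi (f ((m * n2 : ℕ) : ℝ) - f ((m * n1 : ℕ) : ℝ)) := by
    rw [hS, sum_filter]
    refine sum_congr rfl fun m _ => ?_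
    unfold cutExp
    by_cases c1 : ((m * n1 : ℕ) : ℝ) ∈ J <;> by_cases c2 : ((m * n2 : ℕ) : ℝ) ∈ J <;>
      simp only [c1, c2, if_true, if_false, map_zero, mul_zero, zero_mul, and_true, and_false, and_self]
    rw [sub_eq_add_neg, expi_add, expi_neg]
  have hmem : ∀ m, m ∈ S → (m : ℝ) * n1 ∈ J ∧ (m : ℝ) * n2 ∈ J := by
    intro m hm
    have := (mem_filter.1 hm).2
    exact_mod_cast this
  have hn' : (n1 : ℝ) + 1 ≤ n2 := by exact_mod_cast hn
  have hnK' : (n2 : ℝ) - n1 ≤ K := by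
    have : (n2 : ℝ) ≤ n1 + K := by exact_mod_cast hnK
    linarith
  have hn10 : (0 : ℝ) < n1 := by
    rcases Nat.eq_zero_or_pos n1 with h0 | h0
    · rw [h0] at h1M; simp at h1M; linarith
    · exact_mod_cast h0
  have hn20 : (0 : ℝ) < n2 := by linarith
  have hOC : (S : Set ℕ).OrdConnected := by
    refine ⟨fun a ha b hb c hc => ?_⟩
    have ha' := hmem a ha
    have hb' := hmem b hb
    rw [mem_coe, hS, mem_filter, mem_Icc] at ha hb ⊢
    have := hc.1
    have := hc.2
    refine ⟨by omega, ?_⟩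
    push_cast
    exact ⟨h.ordConnected.out ha'.1 hb'.1 ⟨by gcongr, by gcongr⟩,
      h.ordConnected.out ha'.2 hb'.2 ⟨by gcongr, by gcongr⟩⟩
  have hrange : ∀ x : ℝ, x * n1 ∈ J → x * n2 ∈ J → M / 4 ≤ x ∧ x ≤ M := by
    intro x hx1 hx2
    have a1 := (h.subset hx1).2
    have a2 := (h.subset hx2).1
    constructor
    · have : M * n2 ≤ (4 * x) * n2 := by linarith
      linarith [le_of_mul_le_mul_right this hn20]
    · exact le_of_mul_le_mul_right (by linarith) hn10
  have hcard : (#S : ℝ) ≤ M := by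
    have : S ⊆ Icc 1 ⌊M⌋₊ := fun m hm => by
      rw [mem_Icc]
      refine ⟨(mem_Icc.1 (mem_filter.1 hm).1).1, Nat.le_floor ?_⟩
      exact (hrange m (hmem m hm).1 (hmem m hm).2).2
    have h2 := card_le_card this
    rw [Nat.card_Icc, Nat.add_sub_cancel] at h2
    calc (#S : ℝ) ≤ ⌊M⌋₊ := by exact_mod_cast h2
      _ ≤ M := Nat.floor_le hM0.le
  have hdiff : ∀ m, m ∈ S → m + 2 ∈ S → ∃ y ∈ J, ∃ x, M / 4 ≤ x ∧ x ≤ M ∧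
      (f (((m + 2) * n2 : ℕ) : ℝ) - f (((m + 2) * n1 : ℕ) : ℝ)) -
      2 * (f (((m + 1) * n2 : ℕ) : ℝ) - f (((m + 1) * n1 : ℕ) : ℝ)) +
      (f ((m * n2 : ℕ) : ℝ) - f ((m * n1 : ℕ) : ℝ)) = (n2 - n1) * g1 y / x := by
    intro m hm hm2
    have hJ1 : ∀ x ∈ Set.Icc (m : ℝ) (m + 2), x * n1 ∈ J := fun x hx =>
      h.ordConnected.out (hmem m hm).1 (hmem _ hm2).1
        ⟨by gcongr; exact hx.1, by push_cast; gcongr; exact hx.2⟩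
    have hJ2 : ∀ x ∈ Set.Icc (m : ℝ) (m + 2), x * n2 ∈ J := fun x hx =>
      h.ordConnected.out (hmem m hm).2 (hmem _ hm2).2
        ⟨by gcongr; exact hx.1, by push_cast; gcongr; exact hx.2⟩
    obtain ⟨ξ, hξ, e⟩ := exists_second_diff_eq (fun x => f (x * n2) - f (x * n1))
      (fun x => n2 * f1 (x * n2) - n1 * f1 (x * n1))
      (fun x => n2 ^ 2 * f2 (x * n2) - n1 ^ 2 * f2 (x * n1)) m
      (fun x hx => by
        have a1 := (h.deriv1 _ (hJ1 x hx)).comp x ((hasDerivAt_id x).mul_const (n1 : ℝ))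
        have a2 := (h.deriv1 _ (hJ2 x hx)).comp x ((hasDerivAt_id x).mul_const (n2 : ℝ))
        exact (a2.sub a1).congr_deriv (by ring))
      (fun x hx => by
        have a1 := ((h.deriv2 _ (hJ1 x hx)).comp x ((hasDerivAt_id x).mul_const (n1 : ℝ))).const_mul (n1 : ℝ)
        have a2 := ((h.deriv2 _ (hJ2 x hx)).comp x ((hasDerivAt_id x).mul_const (n2 : ℝ))).const_mul (n2 : ℝ)
        exact (a2.sub a1).congr_deriv (by ring))
    have hr := hrange ξ (hJ1 ξ hξ) (hJ2 ξ hξ)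
    have hξ0 : 0 < ξ := by linarith [hr.1]
    have hlt : ξ * n1 < ξ * n2 := by gcongr
    have hseg : ∀ y ∈ Set.Icc (ξ * n1) (ξ * n2), y ∈ J := fun y hy =>
      h.ordConnected.out (hJ1 ξ hξ) (hJ2 ξ hξ) hy
    obtain ⟨y, hy, ey⟩ := exists_hasDerivAt_eq_slope (fun x => x ^ 2 * f2 x) g1 hlt
      (fun t ht => (h.deriv3 t (hseg t ht)).continuousAt.continuousWithinAt)
      (fun t ht => h.deriv3 t (hseg t ⟨ht.1.le, ht.2.le⟩))
    refine ⟨y, hseg y ⟨hy.1.le, hy.2.le⟩, ξ, hr.1, hr.2, ?_⟩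
    push_cast
    rw [e, ey]
    have : (n2 : ℝ) - n1 ≠ 0 := by linarith
    field_simp
  have hb : ∀ x, M / 4 ≤ x → x ≤ M → ∀ v, l ≤ v → v ≤ L →
      l / M ≤ (n2 - n1) * v / x ∧ (n2 - n1) * v / x ≤ 4 * K * L / M := by
    intro x hx1 hx2 v hv1 hv2
    have hx0 : 0 < x := by linarith
    constructor
    · calc l / M ≤ l / x := by gcongr
        _ ≤ (n2 - n1) * v / x := by
          gcongr
          nlinarith
    · calc (n2 - n1) * v / x ≤ K * L / x := by
            gcongr
            linarith
        _ ≤ K * L / (M / 4) := by gcongr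
        _ = _ := by field_simp
  have main := second_diff_test_ordConnected
    (fun m => f ((m * n2 : ℕ) : ℝ) - f ((m * n1 : ℕ) : ℝ)) S hOC
    (l := l / M) (L := 4 * K * L / M) (by positivity) (by
      gcongr
      nlinarith) (by
      rcases h.bound3 with hb2 | hb2
      · left
        intro n hn hn2
        obtain ⟨y, hy, x, hx1, hx2, e⟩ := hdiff n hn hn2
        rw [e]
        exact hb x hx1 hx2 _ (hb2 y hy).1 (hb2 y hy).2
      · right
        intro n hn hn2
        obtain ⟨y, hy, x, hx1, hx2, e⟩ := hdiff n hn hn2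
        rw [e, ← neg_div, ← mul_neg]
        exact hb x hx1 hx2 _ (hb2 y hy).1 (hb2 y hy).2)
  rw [e1]
  refine main.trans ?_
  have hKL : 1 ≤ K * L := by nlinarith
  have hR : 1 ≤ √(M / l) := by
    rw [Real.one_le_sqrt, le_div_iff₀ hl]; linarith
  have hs : 1 / √(l / M) = √(M / l) := by
    rw [one_div, ← Real.sqrt_inv, inv_div]
  rw [hs]
  calc _ ≤ 12 * (M * (4 * K * L / M) + 1) * (√(M / l) + √(M / l)) := by gcongr
    _ = 12 * (4 * (K * L) + 1) * (2 * √(M / l)) := by field_simp; norm_num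
    _ ≤ 12 * (5 * (K * L)) * (2 * √(M / l)) := by gcongr; linarith
    _ = _ := by ring

end

theorem exists_card_divisors_le_rpow {ε : ℝ} (hε : 0 < ε) (hε1 : ε ≤ 1) :
    ∃ C : ℝ, 1 ≤ C ∧ ∀ n : ℕ, n ≠ 0 → (#n.divisors : ℝ) ≤ C * (n : ℝ) ^ ε := by
  set B : ℕ := ⌈(2 : ℝ) ^ (1 / ε)⌉₊ with hB
  set c0 : ℝ := ε * Real.log 2 with hc0
  have hlog : 0 < Real.log 2 := Real.log_pos (by norm_num)
  have hlog1 : Real.log 2 ≤ 1 := by linarith [Real.log_two_lt_d9]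
  have hc0p : 0 < c0 := by positivity
  have hc01 : c0 ≤ 1 := by nlinarith
  set C0 : ℝ := 1 / c0 with hC0
  have hC01 : 1 ≤ C0 := by rw [hC0, le_div_iff₀ hc0p]; linarith
  refine ⟨C0 ^ B, one_le_pow₀ hC01, fun n hn => ?_⟩
  have hfac : ∀ p ∈ n.primeFactors, ((n.factorization p + 1 : ℕ) : ℝ) ≤
      (if p < B then C0 else 1) * (((p : ℝ) ^ n.factorization p) ^ ε) := by
    intro p hp
    have hp2 : (2 : ℝ) ≤ p := by exact_mod_cast (Nat.prime_of_mem_primeFactors hp).two_le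
    set a := n.factorization p
    have hcomm : ((p : ℝ) ^ a) ^ ε = ((p : ℝ) ^ ε) ^ a := by
      rw [← Real.rpow_natCast, ← Real.rpow_natCast, ← Real.rpow_mul (by linarith),
        ← Real.rpow_mul (by linarith), mul_comm]
    rw [hcomm]
    push_cast
    split_ifs with h
    · have h1 : 1 + c0 ≤ (p : ℝ) ^ ε := by
        calc 1 + c0 ≤ Real.exp c0 := by linarith [Real.add_one_le_exp c0]
          _ = (2 : ℝ) ^ ε := by rw [Real.rpow_def_of_pos (by norm_num), hc0, mul_comm]
          _ ≤ _ := by gcongr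
      have h2 : 1 + (a : ℝ) * c0 ≤ ((p : ℝ) ^ ε) ^ a :=
        (one_add_mul_le_pow (by linarith) a).trans (by gcongr)
      rw [hC0, div_mul_eq_mul_div, one_mul, le_div_iff₀ hc0p]
      nlinarith
    · have h1 : (2 : ℝ) ≤ (p : ℝ) ^ ε := by
        have hpB : (2 : ℝ) ^ (1 / ε) ≤ p :=
          (Nat.le_ceil _).trans (by exact_mod_cast not_lt.1 h)
        calc (2 : ℝ) = ((2 : ℝ) ^ (1 / ε)) ^ ε := by
              rw [← Real.rpow_mul (by norm_num), one_div_mul_cancel hε.ne', Real.rpow_one]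
          _ ≤ _ := by gcongr
      have h2 : 1 + (a : ℝ) * 1 ≤ (1 + 1) ^ a := one_add_mul_le_pow (by norm_num) a
      have h3 : (1 + 1 : ℝ) ^ a ≤ ((p : ℝ) ^ ε) ^ a := by
        gcongr; linarith
      linarith
  have hprod : ∏ p ∈ n.primeFactors, (if p < B then C0 else 1) ≤ C0 ^ B := by
    rw [prod_ite, prod_const, prod_const_one, mul_one]
    apply pow_le_pow_right₀ hC01
    calc _ ≤ #(range B) := card_le_card fun p hp => by
          simpa using (mem_filter.1 hp).2
      _ = B := card_range B
  calc (#n.divisors : ℝ) = ∏ p ∈ n.primeFactors, ((n.factorization p + 1 : ℕ) : ℝ) := by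
        rw [Nat.card_divisors hn]; push_cast; rfl
    _ ≤ ∏ p ∈ n.primeFactors, (if p < B then C0 else 1) * (((p : ℝ) ^ n.factorization p) ^ ε) :=
        prod_le_prod (fun _ _ => by positivity) hfac
    _ = (∏ p ∈ n.primeFactors, (if p < B then C0 else 1)) * (n : ℝ) ^ ε := by
        rw [prod_mul_distrib, Real.finsetProd_rpow _ _ (fun _ _ => by positivity)]
        congr 2
        exact_mod_cast Nat.prod_factorization_pow_eq_self hn
    _ ≤ _ := by gcongr

/-- Partial summation against the logarithm. -/
theorem norm_sum_log_mul_le (z : ℕ → ℂ) {T : ℝ} (Q : ℕ)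
    (h : ∀ j, ‖∑ i ∈ Icc 1 j, z i‖ ≤ T) :
    ‖∑ i ∈ Icc 1 Q, (Real.log i : ℂ) * z i‖ ≤ 2 * Real.log Q * T := by
  have hT : 0 ≤ T := (norm_nonneg _).trans (h 0)
  have key : ∀ j : ℕ, ‖(Real.log j : ℂ) * ∑ i ∈ Icc 1 j, z i - ∑ i ∈ Icc 1 j, (Real.log i : ℂ) * z i‖
      ≤ Real.log j * T := by
    intro j
    induction j with
    | zero => simp
    | succ j ih =>
      rw [sum_Icc_succ_top (by omega), sum_Icc_succ_top (by omega)]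
      rcases Nat.eq_zero_or_pos j with rfl | hj
      · simp
      have hl : 0 ≤ Real.log (j + 1 : ℕ) - Real.log j := by
        rw [sub_nonneg]
        apply Real.log_le_log (by exact_mod_cast hj)
        push_cast; linarith
      have e : (Real.log (j + 1 : ℕ) : ℂ) * (∑ i ∈ Icc 1 j, z i + z (j + 1)) -
          (∑ i ∈ Icc 1 j, (Real.log i : ℂ) * z i + (Real.log (j + 1 : ℕ) : ℂ) * z (j + 1)) =
          ((Real.log (j + 1 : ℕ) - Real.log j : ℝ) : ℂ) * ∑ i ∈ Icc 1 j, z i +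
          ((Real.log j : ℂ) * ∑ i ∈ Icc 1 j, z i - ∑ i ∈ Icc 1 j, (Real.log i : ℂ) * z i) := by
        push_cast; ring
      rw [e]
      refine (norm_add_le _ _).trans ?_
      rw [norm_mul, Complex.norm_real, Real.norm_of_nonneg hl]
      calc _ ≤ (Real.log (j + 1 : ℕ) - Real.log j) * T + Real.log j * T := by
            gcongr; exact h j
        _ = _ := by ring
  have h1 := key Q
  have h2 : ‖(Real.log Q : ℂ) * ∑ i ∈ Icc 1 Q, z i‖ ≤ Real.log Q * T := by
    rw [norm_mul, Complex.norm_real, Real.norm_of_nonneg (Real.log_natCast_nonneg Q)]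
    gcongr
    exact h Q
  have e : ∑ i ∈ Icc 1 Q, (Real.log i : ℂ) * z i = (Real.log Q : ℂ) * ∑ i ∈ Icc 1 Q, z i -
      ((Real.log Q : ℂ) * ∑ i ∈ Icc 1 Q, z i - ∑ i ∈ Icc 1 Q, (Real.log i : ℂ) * z i) := by ring
  rw [e]
  refine (norm_sub_le _ _).trans ?_
  linarith

theorem bilinear_sq_le (F a b : ℕ → ℂ) {A E : ℝ} (hA : 0 ≤ A) (hE : 0 ≤ E) (q : ℕ) (I : Finset ℕ)
    (hF : ∀ n, ‖F n‖ ≤ 1) (ha : ∀ m ∈ Icc 1 q, ‖a m‖ ≤ A) (hb : ∀ n ∈ I, ‖b n‖ ≤ A)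
    (h : ∀ n1 ∈ I, ∀ n2 ∈ I, n1 < n2 →
      ‖∑ m ∈ Icc 1 q, F (m * n2) * (starRingEnd ℂ) (F (m * n1))‖ ≤ E) :
    ‖∑ m ∈ Icc 1 q, ∑ n ∈ I, a m * b n * F (m * n)‖ ^ 2 ≤
      A ^ 4 * q * (#I * q + (#I : ℝ) ^ 2 * E) := by
  set z : ℕ → ℂ := fun m => ∑ n ∈ I, b n * F (m * n) with hz
  have h1 : ‖∑ m ∈ Icc 1 q, ∑ n ∈ I, a m * b n * F (m * n)‖ ≤ ∑ m ∈ Icc 1 q, ‖a m‖ * ‖z m‖ := by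
    refine (norm_sum_le _ _).trans (le_of_eq (sum_congr rfl fun m _ => ?_))
    rw [← norm_mul, hz, mul_sum]
    simp only [mul_assoc]
  have h2 : (∑ m ∈ Icc 1 q, ‖a m‖ * ‖z m‖) ^ 2 ≤
      (∑ m ∈ Icc 1 q, ‖a m‖ ^ 2) * ∑ m ∈ Icc 1 q, ‖z m‖ ^ 2 := sum_mul_sq_le_sq_mul_sq _ _ _
  have h3 : ∑ m ∈ Icc 1 q, ‖a m‖ ^ 2 ≤ A ^ 2 * q := by
    calc _ ≤ ∑ m ∈ Icc 1 q, A ^ 2 := sum_le_sum fun m hm => by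
          gcongr; exact ha m hm
      _ = _ := by simp [mul_comm]
  have hcor : ∀ n1 ∈ I, ∀ n2 ∈ I,
      ‖∑ m ∈ Icc 1 q, F (m * n1) * (starRingEnd ℂ) (F (m * n2))‖ ≤ (if n1 = n2 then (q : ℝ) else 0) + E := by
    intro n1 h1 n2 h2
    rcases lt_trichotomy n1 n2 with hlt | rfl | hlt
    · rw [if_neg hlt.ne, zero_add, ← Complex.norm_conj, map_sum]
      refine (le_of_eq ?_).trans (h n1 h1 n2 h2 hlt)
      congr 1
      refine sum_congr rfl fun m _ => ?_
      rw [map_mul, Complex.conj_conj, mul_comm]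
    · rw [if_pos rfl]
      refine (norm_sum_le_of_le (n := fun _ => (1 : ℝ)) _ fun m _ => ?_).trans ?_
      · rw [norm_mul, Complex.norm_conj]
        exact mul_le_one₀ (hF _) (norm_nonneg _) (hF _)
      · simpa using hE
    · rw [if_neg hlt.ne', zero_add]
      exact h n2 h2 n1 h1 hlt
  have h4 : ∑ m ∈ Icc 1 q, ‖z m‖ ^ 2 ≤ A ^ 2 * (#I * q + (#I : ℝ) ^ 2 * E) := by
    have e : ((∑ m ∈ Icc 1 q, ‖z m‖ ^ 2 : ℝ) : ℂ) = ∑ n1 ∈ I, ∑ n2 ∈ I,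
        b n1 * (starRingEnd ℂ) (b n2) *
          ∑ m ∈ Icc 1 q, F (m * n1) * (starRingEnd ℂ) (F (m * n2)) := by
      push_cast
      simp only [mul_sum]
      rw [sum_congr rfl fun n1 _ => sum_comm, sum_comm]
      refine sum_congr rfl fun m _ => ?_
      rw [← Complex.mul_conj', hz, map_sum, sum_mul_sum]
      refine sum_congr rfl fun n1 _ => sum_congr rfl fun n2 _ => ?_
      rw [map_mul]; ring
    have e2 : ∑ m ∈ Icc 1 q, ‖z m‖ ^ 2 = ‖((∑ m ∈ Icc 1 q, ‖z m‖ ^ 2 : ℝ) : ℂ)‖ := by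
      rw [Complex.norm_real, Real.norm_of_nonneg (sum_nonneg fun _ _ => by positivity)]
    rw [e2, e]
    calc _ ≤ ∑ n1 ∈ I, ∑ n2 ∈ I, A ^ 2 * ((if n1 = n2 then (q : ℝ) else 0) + E) := by
          refine norm_sum_le_of_le _ fun n1 h1 => norm_sum_le_of_le _ fun n2 h2 => ?_
          rw [norm_mul, norm_mul, Complex.norm_conj, sq]
          gcongr
          · exact hb n1 h1
          · exact hb n2 h2
          · exact hcor n1 h1 n2 h2
      _ = _ := by
          simp only [← mul_sum, sum_add_distrib, sum_ite_eq, sum_const, nsmul_eq_mul]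
          rw [sum_congr rfl fun x hx => if_pos hx, sum_const, nsmul_eq_mul]
          ring
  calc _ ≤ (∑ m ∈ Icc 1 q, ‖a m‖ * ‖z m‖) ^ 2 := by gcongr
    _ ≤ (A ^ 2 * q) * (A ^ 2 * (#I * q + (#I : ℝ) ^ 2 * E)) := h2.trans (by gcongr)
    _ = _ := by ring

section
variable {J : Set ℝ} {f f1 f2 g1 : ℝ → ℝ} {X l L : ℝ}

theorem PhaseOn.block_bound (h : PhaseOn J f f1 f2 g1 X l L) (hX : 0 < X) (hl : 0 < l)
    (hl1 : l ≤ 1) (hL : 1 ≤ L) {K t : ℕ} (hK : 1 ≤ K) (ht : 1 ≤ t) {a b : ℕ → ℂ} {A : ℝ}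
    (hA : 0 ≤ A) (ha : ∀ m : ℕ, (m : ℝ) ≤ 2 * X → ‖a m‖ ≤ A) (hb : ∀ n : ℕ, (n : ℝ) ≤ 2 * X → ‖b n‖ ≤ A)
    (hb0 : ∀ n : ℕ, 2 * X < n → b n = 0)
    (hKL : 14400 * (K : ℝ) ^ 4 * L ^ 2 * (t * K) ≤ l * (2 * X)) (Q : ℕ) (hQ : ⌊2 * X⌋₊ ≤ Q) :
    ‖∑ m ∈ Icc 1 Q, ∑ n ∈ Ico (t * K) (t * K + K), a m * b n * cutExp J f (m * n)‖ ≤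
      4 * A ^ 2 * X / √K * (t : ℝ)⁻¹ := by
  have hK' : (1 : ℝ) ≤ K := by exact_mod_cast hK
  have ht' : (1 : ℝ) ≤ t := by exact_mod_cast ht
  have htK : 1 ≤ (t : ℝ) * K := by nlinarith
  set M : ℝ := 2 * X / (t * K) with hM
  have hM0 : 0 < M := by positivity
  have hlM : 14400 * (K : ℝ) ^ 4 * L ^ 2 ≤ l * M := by
    rw [hM, ← mul_div_assoc, le_div_iff₀ (by positivity)]; exact hKL
  have hM1 : 1 ≤ M := by
    have h1 : (1 : ℝ) ≤ K ^ 4 := one_le_pow₀ hK'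
    have h2 : (1 : ℝ) ≤ L ^ 2 := one_le_pow₀ hL
    nlinarith
  have hMX : M ≤ 2 * X := by
    rw [hM]; exact div_le_self (by positivity) htK
  set I := Ico (t * K) (t * K + K)
  have hIK : (#I : ℝ) = K := by simp [I]
  have hcut : ∑ m ∈ Icc 1 Q, ∑ n ∈ I, a m * b n * cutExp J f (m * n) =
      ∑ m ∈ Icc 1 ⌊M⌋₊, ∑ n ∈ I, a m * b n * cutExp J f (m * n) := by
    symm
    refine sum_subset (Icc_subset_Icc_right ((Nat.floor_mono hMX).trans hQ)) fun m hm hm2 => ?_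
    refine sum_eq_zero fun n hn => ?_
    rw [cutExp_eq_zero, mul_zero]
    intro hJ
    apply hm2
    rw [mem_Icc] at hm ⊢
    refine ⟨hm.1, Nat.le_floor ?_⟩
    have h1 := (h.subset hJ).2
    push_cast at h1
    have h2 : (t : ℝ) * K ≤ n := by exact_mod_cast (mem_Ico.1 hn).1
    rw [hM, le_div_iff₀ (by positivity)]
    refine le_trans ?_ h1
    gcongr
  set I' := I.filter fun n : ℕ => (n : ℝ) ≤ 2 * X with hI'
  have hcut2 : ∑ m ∈ Icc 1 ⌊M⌋₊, ∑ n ∈ I, a m * b n * cutExp J f (m * n) =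
      ∑ m ∈ Icc 1 ⌊M⌋₊, ∑ n ∈ I', a m * b n * cutExp J f (m * n) := by
    refine sum_congr rfl fun m _ => ?_
    symm
    refine sum_subset (filter_subset _ _) fun n hn hn2 => ?_
    rw [hb0 n, mul_zero, zero_mul]
    by_contra hc
    exact hn2 (mem_filter.2 ⟨hn, not_lt.1 hc⟩)
  have hE : 0 ≤ 120 * K * L * √(M / l) := by positivity
  have hfl : (⌊M⌋₊ : ℝ) ≤ M := Nat.floor_le hM0.le
  have key := bilinear_sq_le (cutExp J f) a b hA hE ⌊M⌋₊ I' (norm_cutExp_le J f)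
    (fun m hm => ha m (((Nat.cast_le.2 (mem_Icc.1 hm).2).trans hfl).trans hMX))
    (fun n hn => hb n (mem_filter.1 hn).2) (fun n1 h1 n2 h2 hlt => by
      have h1' := mem_Ico.1 (mem_filter.1 h1).1
      have h2' := mem_Ico.1 (mem_filter.1 h2).1
      refine h.typeII_inner hX hl hl1 hL hK hM1 hlt (by omega) ?_ ?_ _
      · have : (t : ℝ) * K ≤ n1 := by exact_mod_cast h1'.1
        rw [hM, div_mul_eq_mul_div, le_div_iff₀ (by positivity)]
        gcongr
      · have h3 : n2 ≤ 2 * (t * K) := by nlinarith [h2'.2]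
        have : (n2 : ℝ) ≤ 2 * (t * K) := by exact_mod_cast h3
        rw [hM, div_mul_eq_mul_div, div_le_iff₀ (by positivity)]
        nlinarith)
  have hI'K : (#I' : ℝ) ≤ K := by
    rw [← hIK]; exact_mod_cast card_filter_le _ _
  have hs : 120 * K ^ 2 * L * √(M / l) ≤ M := by
    have h1 : √(M / l) ≤ M / (120 * K ^ 2 * L) := by
      rw [Real.sqrt_le_left (by positivity), div_pow, div_le_div_iff₀ hl (by positivity)]
      nlinarith
    rw [le_div_iff₀ (by positivity)] at h1
    linarith
  have hsq : ‖∑ m ∈ Icc 1 Q, ∑ n ∈ I, a m * b n * cutExp J f (m * n)‖ ^ 2 ≤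
      (2 * A ^ 2 * M * √K) ^ 2 := by
    rw [hcut, hcut2]
    refine key.trans ?_
    calc _ ≤ A ^ 4 * M * (K * M + (K : ℝ) ^ 2 * (120 * K * L * √(M / l))) := by gcongr
      _ = A ^ 4 * M * (K * M + K * (120 * K ^ 2 * L * √(M / l))) := by ring
      _ ≤ A ^ 4 * M * (K * M + K * M) := by gcongr
      _ = 2 * (A ^ 4 * M ^ 2 * K) := by ring
      _ ≤ 4 * (A ^ 4 * M ^ 2 * K) := by gcongr; norm_num
      _ = _ := by rw [mul_pow, Real.sq_sqrt (by positivity)]; ring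
  refine (abs_le_of_sq_le_sq' hsq (by positivity)).2.trans (le_of_eq ?_)
  have : √(K : ℝ) * √K = K := Real.mul_self_sqrt (by positivity)
  have hsK : 0 < √(K : ℝ) := by positivity
  rw [hM]
  field_simp
  nlinarith

theorem PhaseOn.typeII (h : PhaseOn J f f1 f2 g1 X l L) (hX : 0 < X) (hl : 0 < l)
    (hl1 : l ≤ 1) (hL : 1 ≤ L) {K Y : ℕ} (hK : 1 ≤ K) {a b : ℕ → ℂ} {A : ℝ}
    (hA : 0 ≤ A) (ha : ∀ m : ℕ, (m : ℝ) ≤ 2 * X → ‖a m‖ ≤ A) (hb : ∀ n : ℕ, (n : ℝ) ≤ 2 * X → ‖b n‖ ≤ A)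
    (hb0 : ∀ n, b n ≠ 0 → K ≤ n ∧ n ≤ Y)
    (hKL : 14400 * (K : ℝ) ^ 4 * L ^ 2 * Y ≤ l * (2 * X)) (Q : ℕ) (hQ : Q = ⌊2 * X⌋₊) :
    ‖∑ m ∈ Icc 1 Q, ∑ n ∈ Icc 1 Q, a m * b n * cutExp J f (m * n)‖ ≤
      4 * A ^ 2 * X / √K * (1 + Real.log Y) := by
  have hK' : (1 : ℝ) ≤ K := by exact_mod_cast hK
  have hYX : (Y : ℝ) ≤ 2 * X := by
    have h1 : (1 : ℝ) ≤ K ^ 4 := one_le_pow₀ hK'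
    have h2 : (1 : ℝ) ≤ L ^ 2 := one_le_pow₀ hL
    have h3 : (1 : ℝ) ≤ K ^ 4 * L ^ 2 := by nlinarith
    have : (Y : ℝ) ≤ 14400 * (K : ℝ) ^ 4 * L ^ 2 * Y := by
      have : (0 : ℝ) ≤ Y := by positivity
      nlinarith
    nlinarith
  have hYQ : Y ≤ Q := by rw [hQ]; exact Nat.le_floor hYX
  have hsplit : ∀ m, ∑ n ∈ Icc 1 Q, a m * b n * cutExp J f (m * n) =
      ∑ t ∈ Icc 1 (Y / K), ∑ n ∈ Ico (t * K) (t * K + K), a m * b n * cutExp J f (m * n) := by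
    intro m
    rw [sum_sigma']
    symm
    refine sum_bij_ne_zero (fun x _ _ => x.2) ?_ ?_ ?_ ?_
    · rintro ⟨t, n⟩ h1 h2
      have hbn : b n ≠ 0 := fun h0 => h2 (by simp [h0])
      have := hb0 n hbn
      exact mem_Icc.2 ⟨hK.trans this.1, this.2.trans hYQ⟩
    · rintro ⟨t, n⟩ h1 _ ⟨t', n'⟩ h1' _ (rfl : n = n')
      simp only [mem_sigma, mem_Ico] at h1 h1'
      have e1 : n / K = t := Nat.div_eq_of_lt_le h1.2.1 (by rw [add_mul, one_mul]; exact h1.2.2)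
      have e2 : n / K = t' := Nat.div_eq_of_lt_le h1'.2.1 (by rw [add_mul, one_mul]; exact h1'.2.2)
      rw [← e1, ← e2]
    · intro n hn h2
      have hbn : b n ≠ 0 := fun h0 => h2 (by simp [h0])
      have := hb0 n hbn
      refine ⟨⟨n / K, n⟩, ?_, h2, rfl⟩
      simp only [mem_sigma, mem_Icc, mem_Ico]
      refine ⟨⟨Nat.div_pos this.1 (by omega), Nat.div_le_div_right this.2⟩,
        Nat.div_mul_le_self n K, ?_⟩
      have := Nat.lt_div_mul_add (a := n) (b := K) (by omega)
      exact this
    · intros; rfl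
  rw [sum_congr rfl fun m _ => hsplit m, sum_comm]
  calc _ ≤ ∑ t ∈ Icc 1 (Y / K), 4 * A ^ 2 * X / √K * (t : ℝ)⁻¹ := by
        refine norm_sum_le_of_le _ fun t ht => ?_
        rw [mem_Icc] at ht
        refine h.block_bound hX hl hl1 hL hK ht.1 hA ha hb ?_ ?_ Q hQ.ge
        · intro n hn
          by_contra hne
          have : (n : ℝ) ≤ Y := by exact_mod_cast (hb0 n hne).2
          linarith
        · have : t * K ≤ Y := (Nat.mul_le_mul_right K ht.2).trans (Nat.div_mul_le_self Y K)
          have : (t : ℝ) * K ≤ Y := by exact_mod_cast this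
          refine le_trans ?_ hKL
          gcongr
    _ = 4 * A ^ 2 * X / √K * ∑ t ∈ Icc 1 (Y / K), (t : ℝ)⁻¹ := by rw [mul_sum]
    _ ≤ _ := by
        gcongr
        have h1 := harmonic_le_one_add_log (Y / K)
        rw [harmonic_eq_sum_Icc] at h1
        push_cast at h1
        refine h1.trans ?_
        gcongr 1 + ?_
        rcases Nat.eq_zero_or_pos (Y / K) with h0 | h0
        · rw [h0]; simp; exact Real.log_natCast_nonneg Y
        · apply Real.log_le_log (by exact_mod_cast h0)
          exact_mod_cast Nat.div_le_self Y K

end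

section Vaughan
open ArithmeticFunction
open scoped ArithmeticFunction.Moebius ArithmeticFunction.zeta

theorem sum_mul_apply_mul_eq (u v : ArithmeticFunction ℝ) (F : ℕ → ℂ) (Q : ℕ)
    (hF : ∀ n, Q < n → F n = 0) :
    ∑ n ∈ Icc 1 Q, ((u * v) n : ℂ) * F n =
      ∑ k ∈ Icc 1 Q, ∑ m ∈ Icc 1 Q, (u k : ℂ) * (v m : ℂ) * F (k * m) := by
  have hI : Icc 1 Q = Ioc 0 Q := by ext; simp; omega
  rw [hI, ← sum_product']
  trans ∑ n ∈ Ioc 0 Q, ∑ x ∈ Ioc 0 Q ×ˢ Ioc 0 Q with x.1 * x.2 = n,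
    (u x.1 : ℂ) * (v x.2 : ℂ) * F (x.1 * x.2)
  · refine sum_congr rfl fun n hn => ?_
    rw [mem_Ioc] at hn
    rw [ArithmeticFunction.mul_apply, Nat.divisorsAntidiagonal_eq_prod_filter_of_le hn.1.ne' hn.2]
    push_cast
    rw [sum_mul]
    refine sum_congr rfl fun x hx => ?_
    rw [(mem_filter.1 hx).2]
  · simp_rw [sum_filter]
    rw [sum_comm]
    refine sum_congr rfl fun x hx => ?_
    simp only [mem_product, mem_Ioc] at hx
    rw [sum_ite_eq]
    split_ifs with h
    · rfl
    · rw [hF, mul_zero]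
      simp only [mem_Ioc, not_and, not_le] at h
      exact h (Nat.mul_pos hx.1.1 hx.2.1)

theorem arithmeticFunction_sub_apply (f g : ArithmeticFunction ℝ) (n : ℕ) :
    (f - g) n = f n - g n := by
  rw [sub_eq_add_neg, ArithmeticFunction.add_apply, ArithmeticFunction.neg_apply, sub_eq_add_neg]

/-- The truncation of an arithmetic function to `n ≤ U`. -/
def truncLE (U : ℕ) (g : ArithmeticFunction ℝ) : ArithmeticFunction ℝ :=
  ⟨fun n => if n ≤ U then g n else 0, by simp⟩

theorem truncLE_apply (U : ℕ) (g : ArithmeticFunction ℝ) (n : ℕ) :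
    truncLE U g n = if n ≤ U then g n else 0 := rfl

theorem vaughan_identity (U : ℕ) :
    Λ = truncLE U Λ + truncLE U (μ : ArithmeticFunction ℝ) * log
      - truncLE U Λ * truncLE U (μ : ArithmeticFunction ℝ) * ζ
      + (Λ - truncLE U Λ) * (((μ : ArithmeticFunction ℝ) - truncLE U (μ : ArithmeticFunction ℝ)) * ζ) := by
  have h1 : (Λ : ArithmeticFunction ℝ) * ζ = log := vonMangoldt_mul_zeta
  have h2 : (μ : ArithmeticFunction ℝ) * ζ = 1 := coe_moebius_mul_coe_zeta
  generalize (μ : ArithmeticFunction ℝ) = m at *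
  rw [← h1]
  linear_combination (truncLE U Λ - Λ) * h2

theorem abs_moebius_real_le (n : ℕ) : |((μ n : ℤ) : ℝ)| ≤ 1 := by
  exact_mod_cast abs_moebius_le_one (n := n)

theorem abs_truncLE_mul_truncLE_le (U k : ℕ) :
    |(truncLE U Λ * truncLE U (μ : ArithmeticFunction ℝ)) k| ≤ Real.log k := by
  rw [ArithmeticFunction.mul_apply, ← vonMangoldt_sum]
  refine (abs_sum_le_sum_abs _ _).trans ?_
  rw [← Nat.sum_divisorsAntidiagonal (fun i _ => Λ i)]
  refine sum_le_sum fun x _ => ?_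
  rw [abs_mul, truncLE_apply, truncLE_apply]
  have h0 : 0 ≤ Λ x.1 := vonMangoldt_nonneg
  have h1 : |if x.1 ≤ U then Λ x.1 else 0| ≤ Λ x.1 := by
    split_ifs
    · rw [abs_of_nonneg h0]
    · simp [h0]
  have h2 : |if x.2 ≤ U then (μ : ArithmeticFunction ℝ) x.2 else 0| ≤ 1 := by
    split_ifs
    · exact abs_moebius_real_le x.2
    · simp
  calc _ ≤ Λ x.1 * 1 := by gcongr
    _ = _ := mul_one _

theorem truncLE_mul_truncLE_eq_zero {U k : ℕ} (h : U * U < k) :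
    (truncLE U Λ * truncLE U (μ : ArithmeticFunction ℝ)) k = 0 := by
  rw [ArithmeticFunction.mul_apply]
  refine sum_eq_zero fun x hx => ?_
  rw [Nat.mem_divisorsAntidiagonal] at hx
  rw [truncLE_apply, truncLE_apply]
  by_cases h1 : x.1 ≤ U
  · by_cases h2 : x.2 ≤ U
    · have := Nat.mul_le_mul h1 h2
      omega
    · rw [if_neg h2, mul_zero]
  · rw [if_neg h1, zero_mul]

theorem abs_moebius_tail_mul_zeta_le (U k : ℕ) :
    |(((μ : ArithmeticFunction ℝ) - truncLE U (μ : ArithmeticFunction ℝ)) * ζ) k| ≤ #k.divisors := by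
  rw [coe_mul_zeta_apply]
  refine (abs_sum_le_sum_abs _ _).trans ?_
  rw [card_eq_sum_ones]
  push_cast
  refine sum_le_sum fun i _ => ?_
  rw [arithmeticFunction_sub_apply, truncLE_apply, intCoe_apply]
  split_ifs
  · simp
  · simpa using abs_moebius_real_le i

theorem moebius_tail_mul_zeta_eq_zero {U k : ℕ} (h : k ≤ U) :
    (((μ : ArithmeticFunction ℝ) - truncLE U (μ : ArithmeticFunction ℝ)) * ζ) k = 0 := by
  rw [coe_mul_zeta_apply]
  refine sum_eq_zero fun i hi => ?_
  have : i ≤ U := (Nat.divisor_le hi).trans h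
  rw [arithmeticFunction_sub_apply, truncLE_apply, if_pos this, sub_self]

variable {J : Set ℝ} {f f1 f2 g1 : ℝ → ℝ} {X l L : ℝ}

theorem PhaseOn.vaughan_bound (h : PhaseOn J f f1 f2 g1 X l L) (hX : 1 ≤ X) (hl : 0 < l)
    (hl1 : l ≤ 1) (hL : 1 ≤ L) {K Y : ℕ} (hK : 1 ≤ K) (hKX : (K : ℝ) ^ 4 ≤ X) (hKX' : (K : ℝ) < X)
    (hY : 2 * X ≤ (Y : ℝ) ^ 2) {A : ℝ} (hA : ∀ m : ℕ, m ≠ 0 → (m : ℝ) ≤ 2 * X → (#m.divisors : ℝ) ≤ A)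
    (hA' : Real.log (2 * X) ≤ A)
    (hKL : 14400 * (K : ℝ) ^ 4 * L ^ 2 * Y ≤ l * (2 * X)) :
    ‖∑ n ∈ Icc 1 ⌊2 * X⌋₊, (Λ n : ℂ) * cutExp J f n‖ ≤
      3 * K ^ 2 * A * (108 * L * √(X / l)) + 8 * A ^ 2 * X / √K * (1 + Real.log Y) := by
  set Q := ⌊2 * X⌋₊ with hQ
  set F := cutExp J f with hFdef
  have hX0 : 0 < X := by linarith
  have hF : ∀ n, Q < n → F n = 0 := by
    intro n hn
    refine cutExp_eq_zero fun hJ => ?_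
    have := (h.subset hJ).2
    exact absurd (Nat.le_floor this) (not_le.2 hn)
  have hF' : ∀ n : ℕ, n ≤ K → F n = 0 := by
    intro n hn
    refine cutExp_eq_zero fun hJ => ?_
    have h1 := (h.subset hJ).1
    have : (n : ℝ) ≤ K := by exact_mod_cast hn
    linarith
  have hA0 : 0 ≤ A := (Real.log_nonneg (by linarith)).trans hA'
  have hQX : (Q : ℝ) ≤ 2 * X := Nat.floor_le (by linarith)
  have hlogQ : ∀ m : ℕ, (m : ℝ) ≤ 2 * X → Real.log m ≤ A := by
    intro m hm
    rcases Nat.eq_zero_or_pos m with rfl | hm0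
    · simpa using hA0
    · exact (Real.log_le_log (by exact_mod_cast hm0) hm).trans hA'
  set T := 108 * L * √(X / l) with hT
  have hT0 : 0 ≤ T := by positivity
  have hinner : ∀ k : ℕ, 1 ≤ k → k ≤ K * K → ∀ i, ‖∑ n ∈ Icc 1 i, F (k * n)‖ ≤ T := by
    intro k hk hkK i
    refine h.typeI_inner hX hl hl1 hL hk ?_ i
    have : (k : ℝ) ≤ K * K := by exact_mod_cast hkK
    calc (k : ℝ) ^ 2 ≤ ((K : ℝ) * K) ^ 2 := by gcongr
      _ = (K : ℝ) ^ 4 := by ring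
      _ ≤ X := hKX
  have hK' : (1 : ℝ) ≤ K := by exact_mod_cast hK
  have hKK : K ≤ K * K := Nat.le_mul_self K
  have hKKQ : K * K ≤ Q := by
    apply Nat.le_floor
    push_cast
    nlinarith [one_le_pow₀ hK' (n := 2)]
  -- the four pieces
  have t1 : ∑ n ∈ Icc 1 Q, (truncLE K Λ n : ℂ) * F n = 0 := by
    refine sum_eq_zero fun n _ => ?_
    by_cases hn : n ≤ K
    · rw [hF' n hn, mul_zero]
    · rw [truncLE_apply, if_neg hn]; simp
  have t2 : ‖∑ n ∈ Icc 1 Q, ((truncLE K (μ : ArithmeticFunction ℝ) * log) n : ℂ) * F n‖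
      ≤ K ^ 2 * (2 * A * T) := by
    rw [sum_mul_apply_mul_eq _ _ F Q hF]
    have : ∑ k ∈ Icc 1 Q, ∑ m ∈ Icc 1 Q, (truncLE K (μ : ArithmeticFunction ℝ) k : ℂ) * (log m : ℂ) * F (k * m)
        = ∑ k ∈ Icc 1 (K * K), (truncLE K (μ : ArithmeticFunction ℝ) k : ℂ) *
          ∑ m ∈ Icc 1 Q, (Real.log m : ℂ) * F (k * m) := by
      rw [← sum_subset (Icc_subset_Icc_right hKKQ)]
      · refine sum_congr rfl fun k _ => ?_
        rw [mul_sum]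
        simp only [mul_assoc, log_apply]
      · intro k hk hk2
        rw [truncLE_apply, if_neg (fun hle => hk2 (mem_Icc.2 ⟨(mem_Icc.1 hk).1, hle.trans hKK⟩))]
        simp
    rw [this]
    calc _ ≤ ∑ k ∈ Icc 1 (K * K), 2 * A * T := by
          refine norm_sum_le_of_le _ fun k hk => ?_
          rw [mem_Icc] at hk
          rw [norm_mul, Complex.norm_real, Real.norm_eq_abs]
          have h1 : |truncLE K (μ : ArithmeticFunction ℝ) k| ≤ 1 := by
            rw [truncLE_apply]
            split_ifs
            · exact abs_moebius_real_le k
            · simp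
          have h2 := norm_sum_log_mul_le (fun m => F (k * m)) Q (hinner k hk.1 hk.2)
          calc _ ≤ 1 * (2 * Real.log Q * T) := by gcongr
            _ ≤ _ := by rw [one_mul]; gcongr; exact hlogQ Q hQX
      _ = _ := by
          rw [sum_const, Nat.card_Icc, Nat.add_sub_cancel, nsmul_eq_mul]
          push_cast
          ring
  have t3 : ‖∑ n ∈ Icc 1 Q, ((truncLE K Λ * truncLE K (μ : ArithmeticFunction ℝ) * ζ : ArithmeticFunction ℝ) n : ℂ) * F n‖
      ≤ K ^ 2 * (A * T) := by
    rw [sum_mul_apply_mul_eq _ _ F Q hF]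
    set w := truncLE K Λ * truncLE K (μ : ArithmeticFunction ℝ) with hw
    have : ∑ k ∈ Icc 1 Q, ∑ m ∈ Icc 1 Q, (w k : ℂ) * (((ζ : ArithmeticFunction ℝ) m : ℝ) : ℂ) * F (k * m)
        = ∑ k ∈ Icc 1 (K * K), (w k : ℂ) * ∑ m ∈ Icc 1 Q, F (k * m) := by
      rw [← sum_subset (Icc_subset_Icc_right hKKQ)]
      · refine sum_congr rfl fun k _ => ?_
        rw [mul_sum]
        refine sum_congr rfl fun m hm => ?_
        have hm0 : m ≠ 0 := by have := (mem_Icc.1 hm).1; omega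
        rw [natCoe_apply, zeta_apply, if_neg hm0]
        simp
      · intro k hk hk2
        rw [hw, truncLE_mul_truncLE_eq_zero (by simp only [mem_Icc, not_and, not_le] at hk hk2; exact hk2 hk.1)]
        simp
    rw [this]
    calc _ ≤ ∑ k ∈ Icc 1 (K * K), A * T := by
          refine norm_sum_le_of_le _ fun k hk => ?_
          rw [mem_Icc] at hk
          rw [norm_mul, Complex.norm_real, Real.norm_eq_abs]
          gcongr
          · refine (abs_truncLE_mul_truncLE_le K k).trans (hlogQ k ?_)
            exact le_trans (by exact_mod_cast hk.2.trans hKKQ) hQX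
          · exact hinner k hk.1 hk.2 Q
      _ = _ := by
          rw [sum_const, Nat.card_Icc, Nat.add_sub_cancel, nsmul_eq_mul]
          push_cast
          ring
  set a := Λ - truncLE K Λ with ha
  set b := ((μ : ArithmeticFunction ℝ) - truncLE K (μ : ArithmeticFunction ℝ)) * ζ with hb
  have ha1 : ∀ m : ℕ, (m : ℝ) ≤ 2 * X → |a m| ≤ A := by
    intro m hm
    rw [ha, arithmeticFunction_sub_apply, truncLE_apply]
    split_ifs
    · simpa using hA0
    · rw [sub_zero, abs_of_nonneg vonMangoldt_nonneg]
      exact vonMangoldt_le_log.trans (hlogQ m hm)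
  have hb1 : ∀ m : ℕ, (m : ℝ) ≤ 2 * X → |b m| ≤ A := by
    intro m hm
    rcases Nat.eq_zero_or_pos m with rfl | hm0
    · simpa using hA0
    · exact (abs_moebius_tail_mul_zeta_le K m).trans (hA m hm0.ne' hm)
  have ha2 : ∀ m : ℕ, a m ≠ 0 → K ≤ m := by
    intro m hm
    by_contra hc
    apply hm
    rw [ha, arithmeticFunction_sub_apply, truncLE_apply, if_pos (by omega), sub_self]
  have hb2 : ∀ m : ℕ, b m ≠ 0 → K ≤ m := by
    intro m hm
    by_contra hc
    exact hm (moebius_tail_mul_zeta_eq_zero (by omega))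
  have htr : ∀ g : ArithmeticFunction ℝ, (∀ m : ℕ, (m : ℝ) ≤ 2 * X → |g m| ≤ A) →
      ∀ m : ℕ, (m : ℝ) ≤ 2 * X → ‖((truncLE Y g m : ℝ) : ℂ)‖ ≤ A := by
    intro g hg m hm
    rw [Complex.norm_real, Real.norm_eq_abs, truncLE_apply]
    split_ifs
    · exact hg m hm
    · simpa using hA0
  have htr2 : ∀ g : ArithmeticFunction ℝ, (∀ m : ℕ, g m ≠ 0 → K ≤ m) →
      ∀ m : ℕ, ((truncLE Y g m : ℝ) : ℂ) ≠ 0 → K ≤ m ∧ m ≤ Y := by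
    intro g hg m hm
    rw [truncLE_apply] at hm
    split_ifs at hm with hle
    · exact ⟨hg m (by exact_mod_cast hm), hle⟩
    · simp at hm
  have t4 : ‖∑ n ∈ Icc 1 Q, ((a * b) n : ℂ) * F n‖ ≤
      8 * A ^ 2 * X / √K * (1 + Real.log Y) := by
    rw [sum_mul_apply_mul_eq _ _ F Q hF]
    have hsplit : ∑ k ∈ Icc 1 Q, ∑ m ∈ Icc 1 Q, (a k : ℂ) * (b m : ℂ) * F (k * m) =
        ∑ k ∈ Icc 1 Q, ∑ m ∈ Icc 1 Q, (a k : ℂ) * ((truncLE Y b m : ℝ) : ℂ) * F (k * m) +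
        ∑ m ∈ Icc 1 Q, ∑ k ∈ Icc 1 Q, ((b - truncLE Y b) m : ℂ) * ((truncLE Y a k : ℝ) : ℂ) * F (m * k) := by
      rw [sum_comm (f := fun m k => ((b - truncLE Y b) m : ℂ) * ((truncLE Y a k : ℝ) : ℂ) * F (m * k)),
        ← sum_add_distrib]
      refine sum_congr rfl fun k _ => ?_
      rw [← sum_add_distrib]
      refine sum_congr rfl fun m _ => ?_
      rw [arithmeticFunction_sub_apply b, truncLE_apply Y b, truncLE_apply Y a, mul_comm m k]
      by_cases hm : m ≤ Y
      · simp [hm]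
      · by_cases hk : k ≤ Y
        · simp only [hm, hk, if_true, if_false]; push_cast; ring
        · have : F (k * m) = 0 := by
            apply hF
            rw [hQ, Nat.floor_lt (by linarith)]
            have h1 : Y + 1 ≤ k := by omega
            have h2 : Y + 1 ≤ m := by omega
            have h1' : (Y : ℝ) + 1 ≤ k := by exact_mod_cast h1
            have h2' : (Y : ℝ) + 1 ≤ m := by exact_mod_cast h2
            have : (0 : ℝ) ≤ Y := by positivity
            push_cast
            nlinarith
          simp [this]
    rw [hsplit]
    have s1 := h.typeII hX0 hl hl1 hL hK (a := fun m => (a m : ℂ))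
      (b := fun m => ((truncLE Y b m : ℝ) : ℂ)) hA0
      (fun m hm => by simpa using ha1 m hm) (htr b hb1) (htr2 b hb2) hKL Q hQ
    have s2 := h.typeII hX0 hl hl1 hL hK (a := fun m => ((b - truncLE Y b) m : ℂ))
      (b := fun m => ((truncLE Y a m : ℝ) : ℂ)) hA0
      (fun m hm => by
        rw [Complex.norm_real, Real.norm_eq_abs, arithmeticFunction_sub_apply b, truncLE_apply Y b]
        split_ifs
        · simpa using hA0
        · simpa using hb1 m hm) (htr a ha1) (htr2 a ha2) hKL Q hQ
    refine (norm_add_le _ _).trans ((add_le_add s1 s2).trans (le_of_eq ?_))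
    ring
  have hdec : ∑ n ∈ Icc 1 Q, (Λ n : ℂ) * F n =
      ∑ n ∈ Icc 1 Q, (truncLE K Λ n : ℂ) * F n
      + ∑ n ∈ Icc 1 Q, ((truncLE K (μ : ArithmeticFunction ℝ) * log) n : ℂ) * F n
      - ∑ n ∈ Icc 1 Q, ((truncLE K Λ * truncLE K (μ : ArithmeticFunction ℝ) * ζ : ArithmeticFunction ℝ) n : ℂ) * F n
      + ∑ n ∈ Icc 1 Q, ((a * b) n : ℂ) * F n := by
    rw [← sum_add_distrib, ← sum_sub_distrib, ← sum_add_distrib]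
    refine sum_congr rfl fun n _ => ?_
    have e : Λ n = truncLE K Λ n + (truncLE K (μ : ArithmeticFunction ℝ) * log) n
        - (truncLE K Λ * truncLE K (μ : ArithmeticFunction ℝ) * ζ : ArithmeticFunction ℝ) n + (a * b) n := by
      conv_lhs => rw [vaughan_identity K]
      rfl
    rw [e]
    push_cast
    ring
  rw [hdec, t1, zero_add]
  calc _ ≤ K ^ 2 * (2 * A * T) + K ^ 2 * (A * T) + 8 * A ^ 2 * X / √K * (1 + Real.log Y) :=
        (norm_add_le _ _).trans (add_le_add ((norm_sub_le _ _).trans (add_le_add t2 t3)) t4)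
    _ = _ := by ring

end Vaughan

theorem eventually_le_rpow (C : ℝ) {a : ℝ} (ha : 0 < a) : ∀ᶠ X : ℝ in Filter.atTop, C ≤ X ^ a :=
  (tendsto_rpow_atTop ha).eventually_ge_atTop C

theorem eventually_add_mul_log_le_rpow (B C : ℝ) {a : ℝ} (ha : 0 < a) :
    ∀ᶠ X : ℝ in Filter.atTop, B + C * Real.log X ≤ X ^ a := by
  have h1 := ((isLittleO_log_rpow_atTop ha).const_mul_left C).def (by norm_num : (0 : ℝ) < 1 / 2)
  filter_upwards [h1, eventually_le_rpow (2 * B) ha, Filter.eventually_gt_atTop 0] with X h1 h2 h3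
  have h4 : 0 ≤ X ^ a := by positivity
  rw [Real.norm_of_nonneg h4] at h1
  have := (le_abs_self _).trans h1
  linarith

section
open ArithmeticFunction

/-- Cancellation in exponential sums over primes with a well-behaved phase. -/
theorem exists_prime_sum_bound : ∃ X0 : ℝ, ∀ X ≥ X0, ∀ (J : Set ℝ) (f f1 f2 g1 : ℝ → ℝ),
    PhaseOn J f f1 f2 g1 X (X ^ (-(1 / 26) : ℝ)) (X ^ (1 / 26 : ℝ)) →
    ‖∑ n ∈ Icc 1 ⌊2 * X⌋₊, (vonMangoldt n : ℂ) * cutExp J f n‖ ≤ X ^ (1 - 3 / 79 : ℝ) := by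
  obtain ⟨C, hC, hdiv⟩ := exists_card_divisors_le_rpow (by norm_num : (0 : ℝ) < 1 / 2000) (by norm_num)
  have hev := (eventually_le_rpow (2 * C) (by norm_num : (0 : ℝ) < 1 / 2000)).and
    ((eventually_le_rpow 14400 (by norm_num : (0 : ℝ) < 1 / 2000)).and
    (((eventually_add_mul_log_le_rpow 2 1 (by norm_num : (0 : ℝ) < 1 / 1000))).and
    (Filter.eventually_ge_atTop (100 : ℝ))))
  obtain ⟨X0, hX0⟩ := Filter.eventually_atTop.1 hev
  refine ⟨X0, fun X hX J f f1 f2 g1 h => ?_⟩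
  obtain ⟨e1, e2, e3, e4⟩ := hX0 X hX
  rw [one_mul] at e3
  have hXp : 0 < X := by linarith
  have hX1 : 1 ≤ X := by linarith
  have mono : ∀ {a b : ℝ}, a ≤ b → X ^ a ≤ X ^ b := fun hab => Real.rpow_le_rpow_of_exponent_le hX1 hab
  have mul : ∀ a b : ℝ, X ^ a * X ^ b = X ^ (a + b) := fun a b => (Real.rpow_add hXp a b).symm
  have pw : ∀ (a : ℝ) (n : ℕ), (X ^ a) ^ n = X ^ (a * n) := fun a n => by
    rw [Real.rpow_mul hXp.le, Real.rpow_natCast]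
  have sq : ∀ a : ℝ, √(X ^ a) = X ^ (a / 2) := fun a => by
    rw [Real.sqrt_eq_rpow, ← Real.rpow_mul hXp.le]; ring_nf
  have pos : ∀ a : ℝ, 0 < X ^ a := fun a => Real.rpow_pos_of_pos hXp a
  have one : ∀ {a : ℝ}, 0 ≤ a → 1 ≤ X ^ a := fun ha => Real.one_le_rpow hX1 ha
  have X1 : X = X ^ (1 : ℝ) := (Real.rpow_one X).symm
  set K := ⌊X ^ (9 / 100 : ℝ)⌋₊ with hK
  set Y := ⌈√(2 * X)⌉₊ with hY
  have hK1 : 1 ≤ K := Nat.le_floor (by simpa using one (by norm_num))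
  have hKle : (K : ℝ) ≤ X ^ (9 / 100 : ℝ) := Nat.floor_le (pos _).le
  have hKge : X ^ (9 / 100 : ℝ) / 2 ≤ K := by
    have h1 := Nat.lt_floor_add_one (X ^ (9 / 100 : ℝ))
    have h2 : (1 : ℝ) ≤ K := by exact_mod_cast hK1
    rw [← hK] at h1
    linarith
  have hYle : (Y : ℝ) ≤ 2 * X ^ (1 / 2 : ℝ) := by
    have h1 := (Nat.ceil_lt_add_one (Real.sqrt_nonneg (2 * X))).le
    rw [← hY] at h1
    have h2 : √(2 * X) ≤ 3 / 2 * X ^ (1 / 2 : ℝ) := by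
      rw [← Real.sqrt_eq_rpow, Real.sqrt_mul (by norm_num)]
      gcongr
      rw [Real.sqrt_le_left (by norm_num)]; norm_num
    have h3 : (2 : ℝ) ≤ X ^ (1 / 2 : ℝ) := by
      linarith [e2, mono (by norm_num : (1 / 2000 : ℝ) ≤ 1 / 2)]
    linarith
  have hA : ∀ m : ℕ, m ≠ 0 → (m : ℝ) ≤ 2 * X → (#m.divisors : ℝ) ≤ X ^ (1 / 1000 : ℝ) := by
    intro m hm hmX
    refine (hdiv m hm).trans ?_
    calc C * (m : ℝ) ^ (1 / 2000 : ℝ) ≤ C * (2 * X) ^ (1 / 2000 : ℝ) := by gcongr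
      _ = C * (2 ^ (1 / 2000 : ℝ) * X ^ (1 / 2000 : ℝ)) := by
          rw [Real.mul_rpow (by norm_num) hXp.le]
      _ ≤ C * (2 * X ^ (1 / 2000 : ℝ)) := by
          gcongr
          calc (2 : ℝ) ^ (1 / 2000 : ℝ) ≤ 2 ^ (1 : ℝ) :=
                Real.rpow_le_rpow_of_exponent_le (by norm_num) (by norm_num)
            _ = 2 := Real.rpow_one 2
      _ = (2 * C) * X ^ (1 / 2000 : ℝ) := by ring
      _ ≤ X ^ (1 / 2000 : ℝ) * X ^ (1 / 2000 : ℝ) := by gcongr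
      _ = _ := by rw [mul]; norm_num
  have hlog2 : Real.log 2 ≤ 1 := by linarith [Real.log_two_lt_d9]
  have hA' : Real.log (2 * X) ≤ X ^ (1 / 1000 : ℝ) := by
    rw [Real.log_mul (by norm_num) hXp.ne']
    linarith
  have hlogY : 1 + Real.log Y ≤ X ^ (1 / 1000 : ℝ) := by
    have h0 : (0 : ℝ) < Y := by
      have : 0 < Y := Nat.ceil_pos.2 (by positivity)
      exact_mod_cast this
    have h1 := Real.log_le_log h0 hYle
    rw [Real.log_mul (by norm_num) (pos _).ne', Real.log_rpow hXp] at h1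
    have : 0 ≤ Real.log X := Real.log_nonneg hX1
    linarith
  have key := h.vaughan_bound hX1 (pos _) (Real.rpow_le_one_of_one_le_of_nonpos hX1 (by norm_num))
    (one (by norm_num)) (K := K) (Y := Y) hK1
    (by
      calc (K : ℝ) ^ 4 ≤ (X ^ (9 / 100 : ℝ)) ^ 4 := by gcongr
        _ = X ^ ((9 / 100 : ℝ) * (4 : ℕ)) := pw _ _
        _ ≤ X ^ (1 : ℝ) := mono (by norm_num)
        _ = X := X1.symm)
    (by
      have h1 : X ^ (9 / 100 : ℝ) * 2 ≤ X := by
        calc _ ≤ X ^ (9 / 100 : ℝ) * X ^ (1 / 2000 : ℝ) := by gcongr; linarith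
          _ = X ^ (9 / 100 + 1 / 2000 : ℝ) := mul _ _
          _ ≤ X ^ (1 : ℝ) := mono (by norm_num)
          _ = X := X1.symm
      linarith [pos (9 / 100 : ℝ)])
    (by
      have h1 := Nat.le_ceil (√(2 * X))
      rw [← hY] at h1
      calc 2 * X = √(2 * X) ^ 2 := (Real.sq_sqrt (by positivity)).symm
        _ ≤ _ := by gcongr)
    hA hA'
    (by
      calc 14400 * (K : ℝ) ^ 4 * (X ^ (1 / 26 : ℝ)) ^ 2 * Y
          ≤ X ^ (1 / 2000 : ℝ) * (X ^ (9 / 100 : ℝ)) ^ 4 * (X ^ (1 / 26 : ℝ)) ^ 2 * (2 * X ^ (1 / 2 : ℝ)) := by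
            gcongr
        _ = 2 * X ^ (1 / 2000 + (9 / 100) * (4 : ℕ) + (1 / 26) * (2 : ℕ) + 1 / 2 : ℝ) := by
            rw [pw, pw, ← mul, ← mul, ← mul]; ring
        _ ≤ 2 * X ^ (-(1 / 26) + 1 : ℝ) := by
            gcongr 2 * ?_
            exact mono (by norm_num)
        _ = _ := by rw [← mul, Real.rpow_one]; ring)
  refine key.trans ?_
  have t1 : 3 * (K : ℝ) ^ 2 * X ^ (1 / 1000 : ℝ) * (108 * X ^ (1 / 26 : ℝ) * √(X / X ^ (-(1 / 26) : ℝ)))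
      ≤ X ^ (1 - 3 / 79 : ℝ) / 2 := by
    have hs : X / X ^ (-(1 / 26) : ℝ) = X ^ (1 + 1 / 26 : ℝ) := by
      rw [div_eq_mul_inv, ← Real.rpow_neg hXp.le, neg_neg, ← mul, Real.rpow_one]
    rw [hs, sq]
    calc _ ≤ 3 * (X ^ (9 / 100 : ℝ)) ^ 2 * X ^ (1 / 1000 : ℝ) *
          (108 * X ^ (1 / 26 : ℝ) * X ^ ((1 + 1 / 26) / 2 : ℝ)) := by gcongr
      _ = 648 * X ^ ((9 / 100) * (2 : ℕ) + 1 / 1000 + 1 / 26 + (1 + 1 / 26) / 2 : ℝ) / 2 := by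
          rw [pw, ← mul, ← mul, ← mul]; ring
      _ ≤ X ^ (1 / 2000 : ℝ) * X ^ ((9 / 100) * (2 : ℕ) + 1 / 1000 + 1 / 26 + (1 + 1 / 26) / 2 : ℝ) / 2 := by
          gcongr; linarith
      _ ≤ _ := by
          rw [mul]
          gcongr
          norm_num
  have t2 : 8 * (X ^ (1 / 1000 : ℝ)) ^ 2 * X / √K * (1 + Real.log Y) ≤ X ^ (1 - 3 / 79 : ℝ) / 2 := by
    have hsK : X ^ (9 / 200 : ℝ) / 2 ≤ √K := by
      apply Real.le_sqrt_of_sq_le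
      rw [div_pow, pw]
      have : X ^ ((9 / 200 : ℝ) * (2 : ℕ)) = X ^ (9 / 100 : ℝ) := by norm_num
      rw [this]
      linarith [pos (9 / 100 : ℝ)]
    have hp := pos (9 / 200 : ℝ)
    calc _ ≤ 8 * (X ^ (1 / 1000 : ℝ)) ^ 2 * X / (X ^ (9 / 200 : ℝ) / 2) * X ^ (1 / 1000 : ℝ) := by
          gcongr
      _ = 32 * (X ^ ((1 / 1000) * (2 : ℕ) + 1 + -(9 / 200) + 1 / 1000 : ℝ)) / 2 := by
          rw [pw, ← mul, ← mul, ← mul, Real.rpow_one, Real.rpow_neg hXp.le]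
          field_simp
          norm_num
      _ ≤ X ^ (1 / 2000 : ℝ) * (X ^ ((1 / 1000) * (2 : ℕ) + 1 + -(9 / 200) + 1 / 1000 : ℝ)) / 2 := by
          gcongr; linarith
      _ ≤ _ := by
          rw [mul]
          gcongr
          norm_num
  linarith

end

theorem sub_le_rpow_neg_sub_rpow_neg {p v v' : ℝ} (hp : 1 ≤ p) (hv' : 0 < v') (hvv : v' ≤ v)
    (hv : v ≤ 1) : v - v' ≤ v' ^ (-p) - v ^ (-p) := by
  have hv0 : 0 < v := by linarith
  have h1 : 1 + p * (v / v' - 1) ≤ (1 + (v / v' - 1)) ^ p := by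
    apply one_add_mul_self_le_rpow_one_add _ hp
    have : 0 ≤ v / v' := by positivity
    linarith
  have e : v' ^ (-p) = v ^ (-p) * (1 + (v / v' - 1)) ^ p := by
    rw [add_sub_cancel, Real.div_rpow hv0.le hv'.le, Real.rpow_neg hv'.le, Real.rpow_neg hv0.le]
    have := Real.rpow_pos_of_pos hv0 p
    field_simp
  have h2 : 1 ≤ v ^ (-p) := Real.one_le_rpow_of_pos_of_le_one_of_nonpos hv0 hv (by linarith)
  have h3 : v - v' ≤ v / v' - 1 := by
    rw [div_sub_one hv'.ne', le_div_iff₀ hv']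
    nlinarith
  rw [e]
  have h4 : 0 ≤ v / v' - 1 := by linarith
  have h5 := mul_le_mul_of_nonneg_left h1 (by linarith : (0 : ℝ) ≤ v ^ (-p))
  have h6 : 1 * 1 ≤ v ^ (-p) * p := by gcongr
  have h7 := mul_le_mul_of_nonneg_right h6 h4
  linarith

/-- The weight governing `x² f''`. -/
noncomputable def wA (γ y : ℝ) : ℝ := (1 - y) ^ (-(2 - γ))

/-- The weight governing the derivative of `x² f''`. -/
noncomputable def wB (γ y : ℝ) : ℝ := (1 - y) ^ (-(3 - γ)) * (1 + (1 - γ) * y)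

theorem sub_le_wA_sub {γ y y' : ℝ} (hγ1 : γ ≤ 1) (hy : 0 ≤ y) (hyy : y ≤ y') (hy' : y' < 1) :
    y' - y ≤ wA γ y' - wA γ y := by
  have := sub_le_rpow_neg_sub_rpow_neg (p := 2 - γ) (v := 1 - y) (v' := 1 - y') (by linarith)
    (by linarith) (by linarith) (by linarith)
  unfold wA
  linarith

theorem sub_le_wB_sub {γ y y' : ℝ} (hγ1 : γ ≤ 1) (hy : 0 ≤ y) (hyy : y ≤ y') (hy' : y' < 1) :
    y' - y ≤ wB γ y' - wB γ y := by
  have h1 := sub_le_rpow_neg_sub_rpow_neg (p := 3 - γ) (v := 1 - y) (v' := 1 - y') (by linarith)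
    (by linarith) (by linarith) (by linarith)
  have h2 : 0 < (1 - y) ^ (-(3 - γ)) := Real.rpow_pos_of_pos (by linarith) _
  have h3 : 0 ≤ (1 - γ) * (y' - y) := mul_nonneg (by linarith) (by linarith)
  have h4 : 0 ≤ (1 - γ) * y' := mul_nonneg (by linarith) (by linarith)
  unfold wB
  nlinarith [mul_nonneg h2.le h3, mul_nonneg (by linarith : 0 ≤ (1 - y') ^ (-(3 - γ)) - (1 - y) ^ (-(3 - γ))) h4]

theorem wA_le_two {γ y : ℝ} (hγ0 : 0 ≤ γ) (hy : 0 ≤ y) (hy' : y ≤ 1 / 10) :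
    0 ≤ wA γ y ∧ wA γ y ≤ 2 := by
  have h1 : 0 < 1 - y := by linarith
  refine ⟨(Real.rpow_pos_of_pos h1 _).le, ?_⟩
  calc wA γ y ≤ (1 - y) ^ (-2 : ℝ) :=
        Real.rpow_le_rpow_of_exponent_ge h1 (by linarith) (by linarith)
    _ = ((1 - y) ^ 2)⁻¹ := by rw [Real.rpow_neg h1.le]; norm_cast
    _ ≤ ((9 / 10 : ℝ) ^ 2)⁻¹ := by gcongr; linarith
    _ ≤ 2 := by norm_num

theorem wB_le_two {γ y : ℝ} (hγ0 : 0 ≤ γ) (hγ1 : γ ≤ 1) (hy : 0 ≤ y) (hy' : y ≤ 1 / 10) :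
    0 ≤ wB γ y ∧ wB γ y ≤ 2 := by
  have h1 : 0 < 1 - y := by linarith
  have h2 : 0 ≤ (1 - γ) * y := mul_nonneg (by linarith) hy
  have h3 : (1 - γ) * y ≤ 1 / 10 := by nlinarith
  have h4 := (Real.rpow_pos_of_pos h1 (-(3 - γ))).le
  refine ⟨mul_nonneg h4 (by linarith), ?_⟩
  have h5 : (1 - y) ^ (-(3 - γ)) ≤ 3 / 2 := by
    calc (1 - y) ^ (-(3 - γ)) ≤ (1 - y) ^ (-3 : ℝ) :=
          Real.rpow_le_rpow_of_exponent_ge h1 (by linarith) (by linarith)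
      _ = ((1 - y) ^ 3)⁻¹ := by rw [Real.rpow_neg h1.le]; norm_cast
      _ ≤ ((9 / 10 : ℝ) ^ 3)⁻¹ := by gcongr; linarith
      _ ≤ 3 / 2 := by norm_num
  unfold wB
  nlinarith

section
variable {c T A B : ℝ}

/-- The phase `A(1-u)^(1/c) + B u` with `u = x^c / T`. -/
noncomputable def phase (c T A B x : ℝ) : ℝ := A * (1 - x ^ c / T) ^ (1 / c) + B * (x ^ c / T)

noncomputable def phase1 (c T A B x : ℝ) : ℝ :=
  x ^ c / T / x * (c * B - A * (1 - x ^ c / T) ^ (1 / c - 1))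

noncomputable def phase2 (c T A B x : ℝ) : ℝ :=
  (c - 1) * (x ^ c / T) * (c * B - A * wA (1 / c) (x ^ c / T)) / x ^ 2

noncomputable def phase3 (c T A B x : ℝ) : ℝ :=
  (c - 1) * (c * (x ^ c / T) / x) * (c * B - A * wB (1 / c) (x ^ c / T))

theorem hasDerivAt_rpow_div (c T : ℝ) {x : ℝ} (hx : 0 < x) :
    HasDerivAt (fun x => x ^ c / T) (c * (x ^ c / T) / x) x := by
  refine ((Real.hasDerivAt_rpow_const (Or.inl hx.ne')).div_const T).congr_deriv ?_
  rw [Real.rpow_sub_one hx.ne']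
  ring

theorem hasDerivAt_one_sub_rpow (p : ℝ) {x : ℝ} (hx : 0 < x) (hu : x ^ c / T < 1) :
    HasDerivAt (fun x => (1 - x ^ c / T) ^ p)
      (-(c * (x ^ c / T) / x) * p * (1 - x ^ c / T) ^ (p - 1)) x :=
  ((hasDerivAt_rpow_div c T hx).const_sub 1).rpow_const (Or.inl (by linarith))

theorem hasDerivAt_phase (hc : c ≠ 0) {x : ℝ} (hx : 0 < x) (hu : x ^ c / T < 1) :
    HasDerivAt (phase c T A B) (phase1 c T A B x) x := by
  refine (((hasDerivAt_one_sub_rpow (1 / c) hx hu).const_mul A).add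
    ((hasDerivAt_rpow_div c T hx).const_mul B)).congr_deriv ?_
  unfold phase1
  field_simp
  ring

theorem hasDerivAt_phase1 (hc : c ≠ 0) {x : ℝ} (hx : 0 < x) (hu : x ^ c / T < 1) :
    HasDerivAt (phase1 c T A B) (phase2 c T A B x) x := by
  have h1 : 0 < 1 - x ^ c / T := by linarith
  have h := ((hasDerivAt_rpow_div c T hx).div (hasDerivAt_id x) hx.ne').mul
    (((hasDerivAt_one_sub_rpow (1 / c - 1) hx hu).const_mul A).const_sub (c * B))
  refine h.congr_deriv ?_
  have e1 : (1 - x ^ c / T) ^ (1 / c - 1) = (1 - x ^ c / T) ^ (1 / c - 1 - 1) * (1 - x ^ c / T) := by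
    rw [← Real.rpow_add_one h1.ne']; ring_nf
  have e2 : wA (1 / c) (x ^ c / T) = (1 - x ^ c / T) ^ (1 / c - 1 - 1) := by
    unfold wA; ring_nf
  unfold phase2
  simp only [id, Pi.div_apply]
  rw [e1, e2]
  generalize (1 - x ^ c / T) ^ (1 / c - 1 - 1) = w
  generalize x ^ c / T = u
  field_simp
  ring

theorem hasDerivAt_phase2 (hc : c ≠ 0) {x : ℝ} (hx : 0 < x) (hu : x ^ c / T < 1) :
    HasDerivAt (fun x => x ^ 2 * phase2 c T A B x) (phase3 c T A B x) x := by
  have h1 : 0 < 1 - x ^ c / T := by linarith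
  have h := ((hasDerivAt_rpow_div c T hx).const_mul (c - 1)).mul
    (((hasDerivAt_one_sub_rpow (-(2 - 1 / c)) hx hu).const_mul A).const_sub (c * B))
  have h2 := h.congr_of_eventuallyEq (f₁ := fun x => x ^ 2 * phase2 c T A B x) (by
    filter_upwards [lt_mem_nhds hx] with y hy
    unfold phase2 wA
    simp only [Pi.mul_apply]
    field_simp)
  refine h2.congr_deriv ?_
  have e1 : (1 - x ^ c / T) ^ (-(2 - 1 / c)) = (1 - x ^ c / T) ^ (-(3 - 1 / c)) * (1 - x ^ c / T) := by
    rw [← Real.rpow_add_one h1.ne']; ring_nf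
  have e2 : -(2 - 1 / c) - 1 = -(3 - 1 / c) := by ring
  unfold phase3 wB
  rw [e1, e2]
  generalize (1 - x ^ c / T) ^ (-(3 - 1 / c)) = w
  generalize x ^ c / T = u
  field_simp
  ring

end

theorem mul_sub_le_rpow_div_sub {c T X κ x x' : ℝ} (hc : 1 ≤ c) (hX : 0 < X)
    (hT : ∀ x ∈ Set.Icc X (2 * X), κ ≤ x ^ c / T) (hκ : 0 ≤ κ) (hx : X ≤ x) (hxx : x ≤ x')
    (hx' : x' ≤ 2 * X) : κ / (2 * X) * (x' - x) ≤ x' ^ c / T - x ^ c / T := by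
  have hx0 : 0 < x := by linarith
  have h1 : 1 + c * (x' / x - 1) ≤ (1 + (x' / x - 1)) ^ c := by
    apply one_add_mul_self_le_rpow_one_add _ hc
    have : 0 ≤ x' / x := div_nonneg (by linarith) hx0.le
    linarith
  have h2 : 0 ≤ x' / x - 1 := by
    rw [sub_nonneg, le_div_iff₀ hx0]; linarith
  have e : x' ^ c / T = x ^ c / T * (1 + (x' / x - 1)) ^ c := by
    rw [add_sub_cancel, Real.div_rpow (by linarith) hx0.le]
    have := Real.rpow_pos_of_pos hx0 c
    field_simp
  have h3 : κ ≤ x ^ c / T := hT x ⟨hx, by linarith⟩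
  have h4 : x' / x - 1 ≤ (1 + (x' / x - 1)) ^ c - 1 := by
    nlinarith
  have h5 : (x' - x) / (2 * X) ≤ x' / x - 1 := by
    rw [div_sub_one hx0.ne']
    gcongr
    linarith
  calc κ / (2 * X) * (x' - x) = κ * ((x' - x) / (2 * X)) := by ring
    _ ≤ x ^ c / T * ((1 + (x' / x - 1)) ^ c - 1) := by
        apply mul_le_mul h3 (h5.trans h4) _ (hκ.trans h3)
        exact div_nonneg (by linarith) (by linarith)
    _ = _ := by rw [e]; ring

theorem card_le_of_abs_sub_mul_lt {S : Finset ℕ} {W : ℕ → ℝ} {A b τ κ : ℝ} (hA : A ≠ 0)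
    (hκ : 0 < κ) (hτ : 0 ≤ τ) (hW : ∀ m ∈ S, ∀ n ∈ S, m ≤ n → κ * ((n : ℝ) - m) ≤ W n - W m)
    (hS : ∀ n ∈ S, |b - A * W n| < τ) : (#S : ℝ) ≤ 2 * τ / (κ * |A|) + 1 := by
  have hA' : 0 < |A| := abs_pos.2 hA
  rcases S.eq_empty_or_nonempty with rfl | hne
  · simp; positivity
  · have hmin := S.min'_mem hne
    have := card_le_of_Icc_bound S (A := (S.min' hne : ℝ)) (B := S.min' hne + 2 * τ / (κ * |A|))
      (by have : 0 ≤ 2 * τ / (κ * |A|) := by positivity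
          linarith) (by
        intro n hn
        have hle := S.min'_le n hn
        refine ⟨by exact_mod_cast hle, ?_⟩
        have h1 := hW _ hmin n hn hle
        have h2 := hS n hn
        have h3 := hS _ hmin
        have h4 : |A * (W n - W (S.min' hne))| ≤ 2 * τ := by
          rw [abs_le]
          rw [abs_lt] at h2 h3
          constructor <;> linarith
        rw [abs_mul] at h4
        have h5 : κ * ((n : ℝ) - (S.min' hne : ℕ)) * |A| ≤ 2 * τ := by
          refine le_trans ?_ h4
          rw [mul_comm]
          gcongr
          exact h1.trans (le_abs_self _)
        rw [← sub_le_iff_le_add', le_div_iff₀ (by positivity)]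
        linarith)
    linarith

theorem le_sub_mul_of_between {W1 W W2 r b τ : ℝ} (h1 : W1 ≤ W) (h2 : W ≤ W2)
    (hb1 : τ ≤ b - r * W1) (hb2 : τ ≤ b - r * W2) : τ ≤ b - r * W := by
  rcases le_total 0 r with hr | hr
  · nlinarith
  · nlinarith

section
variable {c T A B X : ℝ}

/-- The part of `(X, 2X]` where both derivative weights have prescribed signs `s, s'` and are at
least `τ` in size. -/
def goodSet (c T A B X τ s s' : ℝ) : Set ℝ :=
  {x | X < x ∧ x ≤ 2 * X ∧ τ ≤ s * (c * B) - s * A * wA (1 / c) (x ^ c / T) ∧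
    τ ≤ s' * (c * B) - s' * A * wB (1 / c) (x ^ c / T)}

theorem goodSet_ordConnected {τ s s' : ℝ} (hc : 1 < c) (hX : 0 < X)
    (hT : ∀ x ∈ Set.Icc X (2 * X), (10 ^ 20 : ℝ)⁻¹ ≤ x ^ c / T ∧ x ^ c / T ≤ (10 ^ 8 : ℝ)⁻¹) :
    (goodSet c T A B X τ s s').OrdConnected := by
  have hγ : 1 / c ≤ 1 := by rw [div_le_one (by linarith)]; linarith
  have mono : ∀ x y, X < x → x ≤ y → y ≤ 2 * X → wA (1 / c) (x ^ c / T) ≤ wA (1 / c) (y ^ c / T) ∧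
      wB (1 / c) (x ^ c / T) ≤ wB (1 / c) (y ^ c / T) := by
    intro x y hx hxy hy
    have hu := mul_sub_le_rpow_div_sub hc.le hX (fun x hx => (hT x hx).1) (by positivity) hx.le hxy hy
    have hu' : 0 ≤ y ^ c / T - x ^ c / T := by
      refine le_trans (mul_nonneg (by positivity) (by linarith)) hu
    have hx0 : 0 ≤ x ^ c / T := le_trans (by positivity) (hT x ⟨hx.le, by linarith⟩).1
    have hy0 : y ^ c / T < 1 := lt_of_le_of_lt (hT y ⟨by linarith, by linarith⟩).2 (by norm_num)
    have h1 := sub_le_wA_sub hγ hx0 (by linarith) hy0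
    have h2 := sub_le_wB_sub hγ hx0 (by linarith) hy0
    constructor <;> linarith
  refine ⟨fun x hx y hy z hz => ?_⟩
  obtain ⟨x1, x2, x3, x4⟩ := hx
  obtain ⟨y1, y2, y3, y4⟩ := hy
  obtain ⟨z1, z2⟩ := hz
  have hxz := mono x z x1 z1 (by linarith)
  have hzy := mono z y (by linarith) z2 y2
  exact ⟨by linarith, by linarith, le_sub_mul_of_between hxz.1 hzy.1 x3 y3,
    le_sub_mul_of_between hxz.2 hzy.2 x4 y4⟩

theorem phaseOn_goodSet {τ s s' l L : ℝ} (hc : 1 < c) (hc2 : c < 82 / 79) (hX : 0 < X)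
    (hT : ∀ x ∈ Set.Icc X (2 * X), (10 ^ 20 : ℝ)⁻¹ ≤ x ^ c / T ∧ x ^ c / T ≤ (10 ^ 8 : ℝ)⁻¹)
    (hs : s = 1 ∨ s = -1) (hs' : s' = 1 ∨ s' = -1) (hτ : 0 ≤ τ)
    (hl : l * X ≤ (c - 1) * (10 ^ 20 : ℝ)⁻¹ / 2 * τ) (hL : |A| + |B| ≤ L * X) :
    PhaseOn (goodSet c T A B X τ s s') (phase c T A B) (phase1 c T A B) (phase2 c T A B)
      (phase3 c T A B) X l L := by
  have hγ : 1 / c ≤ 1 := by rw [div_le_one (by linarith)]; linarith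
  have hγ0 : 0 ≤ 1 / c := by positivity
  have hmem : ∀ x ∈ goodSet c T A B X τ s s', x ∈ Set.Icc X (2 * X) :=
    fun x hx => ⟨hx.1.le, hx.2.1⟩
  have hlt : ∀ x ∈ goodSet c T A B X τ s s', x ^ c / T < 1 := fun x hx =>
    lt_of_le_of_lt (hT x (hmem x hx)).2 (by norm_num)
  have hpos : ∀ x ∈ goodSet c T A B X τ s s', 0 < x := fun x hx => by linarith [hx.1]
  have upper : ∀ (σ w : ℝ), (σ = 1 ∨ σ = -1) → 0 ≤ w → w ≤ 2 →
      σ * (c * B) - σ * A * w ≤ 2 * (L * X) := by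
    intro σ w hσ h0 h2
    have e1 : σ * (c * B) ≤ 2 * |B| := by
      have : σ * B ≤ |B| := by
        rcases hσ with rfl | rfl
        · rw [one_mul]; exact le_abs_self B
        · rw [neg_one_mul]; exact neg_le_abs B
      nlinarith [abs_nonneg B]
    have e2 : -(σ * A * w) ≤ 2 * |A| := by
      have : -(σ * A) ≤ |A| := by
        rcases hσ with rfl | rfl
        · rw [one_mul]; exact neg_le_abs A
        · rw [neg_one_mul, neg_neg]; exact le_abs_self A
      nlinarith [abs_nonneg A]
    linarith
  have hLX : 0 ≤ L * X := le_trans (by positivity) hL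
  have key : ∀ σ v w : ℝ, (σ = 1 ∨ σ = -1) → 0 ≤ w → w ≤ 2 → τ ≤ σ * (c * B) - σ * A * w →
      (10 ^ 20 : ℝ)⁻¹ ≤ v → v ≤ (10 ^ 8 : ℝ)⁻¹ →
      2 * (l * X) ≤ (c - 1) * v * (σ * (c * B) - σ * A * w) ∧
        (c - 1) * v * (σ * (c * B) - σ * A * w) ≤ L * X / 2 := by
    intro σ v w hσ h0 h2 ht hv hv'
    have hu := upper σ w hσ h0 h2
    constructor
    · calc 2 * (l * X) ≤ (c - 1) * (10 ^ 20 : ℝ)⁻¹ * τ := by linarith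
        _ ≤ (c - 1) * v * (σ * (c * B) - σ * A * w) := by
          have : 0 ≤ c - 1 := by linarith
          gcongr
    · have h3 : (c - 1) * v ≤ 1 / 4 := by
        calc (c - 1) * v ≤ 1 * (10 ^ 8 : ℝ)⁻¹ := by
              have : 0 ≤ v := le_trans (by positivity) hv
              gcongr; linarith
          _ ≤ 1 / 4 := by norm_num
      have h4 : 0 ≤ (c - 1) * v := mul_nonneg (by linarith) (le_trans (by positivity) hv)
      have h5 : 0 ≤ σ * (c * B) - σ * A * w := hτ.trans ht
      calc _ ≤ 1 / 4 * (2 * (L * X)) := by gcongr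
        _ = _ := by ring
  have b2 : ∀ x ∈ goodSet c T A B X τ s s', l * X ≤ s * (x ^ 2 * phase2 c T A B x) ∧
      s * (x ^ 2 * phase2 c T A B x) ≤ L * X := by
    intro x hx
    have hw := wA_le_two (γ := 1 / c) hγ0 (y := x ^ c / T)
      (le_trans (by positivity) (hT x (hmem x hx)).1) ((hT x (hmem x hx)).2.trans (by norm_num))
    have := key s (x ^ c / T) _ hs hw.1 hw.2 hx.2.2.1 (hT x (hmem x hx)).1 (hT x (hmem x hx)).2
    have hx0 := hpos x hx
    have e : s * (x ^ 2 * phase2 c T A B x) = (c - 1) * (x ^ c / T) *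
        (s * (c * B) - s * A * wA (1 / c) (x ^ c / T)) := by
      unfold phase2
      generalize x ^ c / T = u
      field_simp
    rw [e]
    rcases le_total 0 (l * X) with h | h
    · exact ⟨by linarith, by linarith⟩
    · refine ⟨h.trans ?_, by linarith⟩
      have : 0 ≤ x ^ c / T := le_trans (by positivity) (hT x (hmem x hx)).1
      exact mul_nonneg (mul_nonneg (by linarith) this) (hτ.trans hx.2.2.1)
  have b3 : ∀ x ∈ goodSet c T A B X τ s s', l ≤ s' * phase3 c T A B x ∧
      s' * phase3 c T A B x ≤ L := by
    intro x hx
    have hw := wB_le_two (γ := 1 / c) hγ0 hγ (y := x ^ c / T)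
      (le_trans (by positivity) (hT x (hmem x hx)).1) ((hT x (hmem x hx)).2.trans (by norm_num))
    obtain ⟨k1, k2⟩ := key s' (x ^ c / T) _ hs' hw.1 hw.2 hx.2.2.2 (hT x (hmem x hx)).1
      (hT x (hmem x hx)).2
    have hx0 := hpos x hx
    have e : s' * phase3 c T A B x = c * ((c - 1) * (x ^ c / T) *
        (s' * (c * B) - s' * A * wB (1 / c) (x ^ c / T))) / x := by
      unfold phase3
      generalize x ^ c / T = u
      field_simp
    have hnn : 0 ≤ (c - 1) * (x ^ c / T) * (s' * (c * B) - s' * A * wB (1 / c) (x ^ c / T)) := by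
      have : 0 ≤ x ^ c / T := le_trans (by positivity) (hT x (hmem x hx)).1
      exact mul_nonneg (mul_nonneg (by linarith) this) (hτ.trans hx.2.2.2)
    rw [e]
    generalize (c - 1) * (x ^ c / T) * (s' * (c * B) - s' * A * wB (1 / c) (x ^ c / T)) = V at *
    have hL0 : 0 ≤ L := nonneg_of_mul_nonneg_left hLX hX
    constructor
    · rw [le_div_iff₀ hx0]
      rcases le_total 0 l with h | h
      · calc l * x ≤ l * (2 * X) := by gcongr; exact hx.2.1
          _ ≤ V := by linarith
          _ ≤ c * V := by nlinarith
      · exact (mul_nonpos_of_nonpos_of_nonneg h hx0.le).trans (by positivity)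
    · rw [div_le_iff₀ hx0]
      calc c * V ≤ 2 * (L * X / 2) := by gcongr; linarith
        _ = L * X := by ring
        _ ≤ L * x := by gcongr; exact hx.1.le
  refine ⟨goodSet_ordConnected hc hX hT, hmem,
    fun x hx => hasDerivAt_phase (by positivity) (hpos x hx) (hlt x hx),
    fun x hx => hasDerivAt_phase1 (by positivity) (hpos x hx) (hlt x hx),
    fun x hx => hasDerivAt_phase2 (by positivity) (hpos x hx) (hlt x hx), ?_, ?_⟩
  · rcases hs with rfl | rfl
    · left; simpa only [one_mul] using b2
    · right; simpa only [neg_one_mul] using b2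
  · rcases hs' with rfl | rfl
    · left; simpa only [one_mul] using b3
    · right; simpa only [neg_one_mul] using b3

end

section
open ArithmeticFunction
variable {c T A B X : ℝ}

open Classical in
theorem expi_phase_eq {τ : ℝ} (hτ : 0 < τ) {n : ℕ} (h1 : X < n) (h2 : (n : ℝ) ≤ 2 * X) :
    expi (phase c T A B n) =
      cutExp (goodSet c T A B X τ 1 1) (phase c T A B) n +
      cutExp (goodSet c T A B X τ 1 (-1)) (phase c T A B) n +
      cutExp (goodSet c T A B X τ (-1) 1) (phase c T A B) n +
      cutExp (goodSet c T A B X τ (-1) (-1)) (phase c T A B) n +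
      if |c * B - A * wA (1 / c) ((n : ℝ) ^ c / T)| < τ ∨
        |c * B - A * wB (1 / c) ((n : ℝ) ^ c / T)| < τ then expi (phase c T A B n) else 0 := by
  have e : ∀ s s' : ℝ, cutExp (goodSet c T A B X τ s s') (phase c T A B) n =
      if τ ≤ s * (c * B - A * wA (1 / c) ((n : ℝ) ^ c / T)) ∧
        τ ≤ s' * (c * B - A * wB (1 / c) ((n : ℝ) ^ c / T)) then expi (phase c T A B n) else 0 := by
    intro s s'
    unfold cutExp goodSet
    simp only [Set.mem_ofPred_eq, h1, h2, true_and, mul_sub, mul_assoc]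
  simp only [e]
  generalize c * B - A * wA (1 / c) ((n : ℝ) ^ c / T) = V
  generalize c * B - A * wB (1 / c) ((n : ℝ) ^ c / T) = W
  have tri : ∀ V : ℝ, (τ ≤ V ∧ ¬ τ ≤ -V ∧ ¬ |V| < τ) ∨ (¬ τ ≤ V ∧ τ ≤ -V ∧ ¬ |V| < τ) ∨
      (¬ τ ≤ V ∧ ¬ τ ≤ -V ∧ |V| < τ) := by
    intro V
    rcases le_or_gt τ V with h | h
    · exact Or.inl ⟨h, by linarith, by rw [not_lt]; exact h.trans (le_abs_self V)⟩
    · rcases le_or_gt τ (-V) with h' | h'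
      · exact Or.inr (Or.inl ⟨by linarith, h', by rw [not_lt]; exact h'.trans (neg_le_abs V)⟩)
      · exact Or.inr (Or.inr ⟨by linarith, by linarith, abs_lt.2 ⟨by linarith, h⟩⟩)
  simp only [one_mul, neg_one_mul]
  rcases tri V with ⟨a1, a2, a3⟩ | ⟨a1, a2, a3⟩ | ⟨a1, a2, a3⟩ <;>
  rcases tri W with ⟨b1, b2, b3⟩ | ⟨b1, b2, b3⟩ | ⟨b1, b2, b3⟩ <;>
  simp only [a1, a2, a3, b1, b2, b3] <;> simp

theorem card_filter_weight_le {W : ℝ → ℝ} {τ M : ℝ} (hc : 1 < c) (hX : 0 < X)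
    (hT : ∀ x ∈ Set.Icc X (2 * X), (10 ^ 20 : ℝ)⁻¹ ≤ x ^ c / T ∧ x ^ c / T ≤ (10 ^ 8 : ℝ)⁻¹)
    (hW : ∀ y y', 0 ≤ y → y ≤ y' → y' < 1 → y' - y ≤ W y' - W y) (hτ : 0 < τ) (hτX : τ ≤ X)
    (hM : X ≤ M * |A| ∨ A = 0 ∧ X ≤ |B|) (hM1 : 0 ≤ M) :
    (#((Ioc ⌊X⌋₊ ⌊2 * X⌋₊).filter
      fun n : ℕ => |c * B - A * W ((n : ℝ) ^ c / T)| < τ) : ℝ) ≤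
      4 * 10 ^ 20 * M * τ + 1 := by
  have hmem : ∀ n ∈ Ioc ⌊X⌋₊ ⌊2 * X⌋₊, X ≤ n ∧ (n : ℝ) ≤ 2 * X := by
    intro n hn
    rw [mem_Ioc, Nat.floor_lt hX.le, Nat.le_floor_iff (by positivity)] at hn
    exact ⟨hn.1.le, hn.2⟩
  by_cases hA : A = 0
  · have hB : X ≤ |B| := by
      rcases hM with h | h
      · rw [hA, abs_zero, mul_zero] at h; linarith
      · exact h.2
    rw [filter_false_of_mem]
    · simp; positivity
    · intro n _
      rw [hA, zero_mul, sub_zero, abs_mul, abs_of_pos (by linarith : 0 < c), not_lt]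
      nlinarith
  · have hM' : X ≤ M * |A| := by
      rcases hM with h | h
      · exact h
      · exact absurd h.1 hA
    refine (card_le_of_abs_sub_mul_lt (W := fun n : ℕ => W ((n : ℝ) ^ c / T)) hA
      (by positivity : 0 < (10 ^ 20 : ℝ)⁻¹ / (2 * X)) hτ.le ?_
      (fun n hn => (mem_filter.1 hn).2)).trans ?_
    · intro m hm n hn hmn
      have hm' := hmem m (mem_filter.1 hm).1
      have hn' := hmem n (mem_filter.1 hn).1
      have hmn' : (m : ℝ) ≤ n := by exact_mod_cast hmn
      have hu := mul_sub_le_rpow_div_sub hc.le hX (fun x hx => (hT x hx).1) (by positivity)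
        hm'.1 hmn' hn'.2
      have hu' : 0 ≤ (n : ℝ) ^ c / T - (m : ℝ) ^ c / T :=
        le_trans (mul_nonneg (by positivity) (by linarith)) hu
      exact hu.trans (hW _ _ (le_trans (by positivity) (hT m hm').1) (by linarith)
        (lt_of_le_of_lt (hT n hn').2 (by norm_num)))
    · have hA' : 0 < |A| := abs_pos.2 hA
      gcongr
      rw [div_le_iff₀ (by positivity)]
      have : 0 < X := hX
      calc 2 * τ = 4 * τ * (1 / (2 * X)) * X := by field_simp; norm_num
        _ ≤ 4 * τ * (1 / (2 * X)) * (M * |A|) := by gcongr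
        _ = _ := by field_simp

/-- Cancellation in `∑ Λ(n) e(A(1-u)^(1/c) + B u)`, `u = n^c/T`. -/
theorem exists_phase_sum_bound (hc : 1 < c) (hc2 : c < 82 / 79) : ∃ X0 : ℝ, ∀ X ≥ X0,
    ∀ T A B M : ℝ,
    (∀ x ∈ Set.Icc X (2 * X), (10 ^ 20 : ℝ)⁻¹ ≤ x ^ c / T ∧ x ^ c / T ≤ (10 ^ 8 : ℝ)⁻¹) →
    |A| + |B| ≤ X ^ (27 / 26 : ℝ) → 1 ≤ M → (X ≤ M * |A| ∨ A = 0 ∧ X ≤ |B|) →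
    ‖∑ n ∈ Ioc ⌊X⌋₊ ⌊2 * X⌋₊, (vonMangoldt n : ℂ) * expi (phase c T A B n)‖ ≤
      10 ^ 22 * M * Real.log (2 * X) * X ^ (1 - 3 / 79 : ℝ) := by
  obtain ⟨X0, hX0⟩ := exists_prime_sum_bound
  obtain ⟨X1, hX1⟩ := Filter.eventually_atTop.1
    (eventually_le_rpow (((c - 1) * (10 ^ 20 : ℝ)⁻¹ / 2)⁻¹) (by norm_num : (0 : ℝ) < 1 / 2054))
  refine ⟨max (max X0 X1) 2, fun X hX T A B M hT hAB hM1 hM => ?_⟩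
  have hXX0 : X0 ≤ X := le_trans (le_trans (le_max_left _ _) (le_max_left _ _)) hX
  have hXX1 := hX1 X (le_trans (le_trans (le_max_right _ _) (le_max_left _ _)) hX)
  have hX2 : 2 ≤ X := (le_max_right _ _).trans hX
  have hXp : 0 < X := by linarith
  set τ := X ^ (1 - 3 / 79 : ℝ) with hτ
  have hτ1 : 1 ≤ τ := Real.one_le_rpow (by linarith) (by norm_num)
  have hτ0 : 0 < τ := by linarith
  have hτX : τ ≤ X := by
    calc τ ≤ X ^ (1 : ℝ) := Real.rpow_le_rpow_of_exponent_le (by linarith) (by norm_num)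
      _ = X := Real.rpow_one X
  have hlog : 1 ≤ Real.log (2 * X) := by
    rw [Real.le_log_iff_exp_le (by positivity)]
    linarith [Real.exp_one_lt_d9]
  have hγ : 1 / c ≤ 1 := by rw [div_le_one (by linarith)]; linarith
  have hl : X ^ (-(1 / 26) : ℝ) * X ≤ (c - 1) * (10 ^ 20 : ℝ)⁻¹ / 2 * τ := by
    have hcp : 0 < (c - 1) * (10 ^ 20 : ℝ)⁻¹ / 2 := by
      have : 0 < c - 1 := by linarith
      positivity
    rw [inv_le_iff_one_le_mul₀ hcp] at hXX1
    have e1 : τ = X ^ (1 / 2054 : ℝ) * (X ^ (-(1 / 26) : ℝ) * X) := by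
      conv_rhs => rw [← Real.rpow_add_one hXp.ne', ← Real.rpow_add hXp]
      rw [hτ]; norm_num
    have e2 : 0 ≤ X ^ (-(1 / 26) : ℝ) * X := by positivity
    rw [e1]
    nlinarith
  have hL : |A| + |B| ≤ X ^ (1 / 26 : ℝ) * X := by
    rw [← Real.rpow_add_one hXp.ne']
    convert hAB using 2
    norm_num
  have hgood : ∀ s s' : ℝ, (s = 1 ∨ s = -1) → (s' = 1 ∨ s' = -1) →
      ‖∑ n ∈ Ioc ⌊X⌋₊ ⌊2 * X⌋₊, (vonMangoldt n : ℂ) *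
        cutExp (goodSet c T A B X τ s s') (phase c T A B) n‖ ≤ τ := by
    intro s s' hs hs'
    have h := hX0 X hXX0 _ _ _ _ _ (phaseOn_goodSet (A := A) (B := B) hc hc2 hXp hT hs hs' hτ0.le hl hL)
    convert h using 2
    apply sum_subset
    · intro n hn
      rw [mem_Ioc] at hn
      exact mem_Icc.2 ⟨by lia, hn.2⟩
    · intro n hn hn'
      rw [mem_Icc] at hn
      rw [mem_Ioc, not_and, Nat.floor_lt hXp.le] at hn'
      unfold cutExp
      rw [if_neg, mul_zero]
      intro h
      exact hn' h.1 hn.2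
  classical
  have hsplit : ∑ n ∈ Ioc ⌊X⌋₊ ⌊2 * X⌋₊, (vonMangoldt n : ℂ) * expi (phase c T A B n) =
      ∑ n ∈ Ioc ⌊X⌋₊ ⌊2 * X⌋₊, (vonMangoldt n : ℂ) *
        cutExp (goodSet c T A B X τ 1 1) (phase c T A B) n +
      ∑ n ∈ Ioc ⌊X⌋₊ ⌊2 * X⌋₊, (vonMangoldt n : ℂ) *
        cutExp (goodSet c T A B X τ 1 (-1)) (phase c T A B) n +
      ∑ n ∈ Ioc ⌊X⌋₊ ⌊2 * X⌋₊, (vonMangoldt n : ℂ) *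
        cutExp (goodSet c T A B X τ (-1) 1) (phase c T A B) n +
      ∑ n ∈ Ioc ⌊X⌋₊ ⌊2 * X⌋₊, (vonMangoldt n : ℂ) *
        cutExp (goodSet c T A B X τ (-1) (-1)) (phase c T A B) n +
      ∑ n ∈ Ioc ⌊X⌋₊ ⌊2 * X⌋₊, (vonMangoldt n : ℂ) *
        (if |c * B - A * wA (1 / c) ((n : ℝ) ^ c / T)| < τ ∨
          |c * B - A * wB (1 / c) ((n : ℝ) ^ c / T)| < τ then expi (phase c T A B n) else 0) := by
    simp only [← sum_add_distrib, ← mul_add]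
    refine sum_congr rfl fun n hn => ?_
    rw [mem_Ioc, Nat.floor_lt hXp.le, Nat.le_floor_iff (by positivity)] at hn
    exact congrArg _ (expi_phase_eq hτ0 hn.1 hn.2)
  have hbad : ‖∑ n ∈ Ioc ⌊X⌋₊ ⌊2 * X⌋₊, (vonMangoldt n : ℂ) *
        (if |c * B - A * wA (1 / c) ((n : ℝ) ^ c / T)| < τ ∨
          |c * B - A * wB (1 / c) ((n : ℝ) ^ c / T)| < τ then expi (phase c T A B n) else 0)‖ ≤
      Real.log (2 * X) * (2 * (4 * 10 ^ 20 * M * τ + 1)) := by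
    simp only [mul_ite, mul_zero]
    rw [← sum_filter]
    refine (norm_sum_le_of_le (f := fun n : ℕ => (vonMangoldt n : ℂ) * expi (phase c T A B n)) _
      (n := fun _ => Real.log (2 * X)) ?_).trans ?_
    · intro n hn
      have hn := (mem_filter.1 hn).1
      rw [mem_Ioc, Nat.floor_lt hXp.le, Nat.le_floor_iff (by positivity)] at hn
      rw [norm_mul, norm_expi, mul_one, Complex.norm_real,
        Real.norm_of_nonneg vonMangoldt_nonneg]
      exact vonMangoldt_le_log.trans (Real.log_le_log (by linarith) hn.2)
    · rw [sum_const, nsmul_eq_mul, mul_comm]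
      gcongr
      have h1 := card_filter_weight_le (W := wA (1 / c)) (B := B) hc hXp hT
        (fun y y' => sub_le_wA_sub hγ) hτ0 hτX hM (by linarith)
      have h2 := card_filter_weight_le (W := wB (1 / c)) (B := B) hc hXp hT
        (fun y y' => sub_le_wB_sub hγ) hτ0 hτX hM (by linarith)
      rw [filter_or]
      have h3 : ∀ S S' : Finset ℕ, ((#(S ∪ S') : ℕ) : ℝ) ≤ #S + #S' := fun S S' => by
        exact_mod_cast card_union_le S S'
      refine (h3 _ _).trans ?_
      linarith
  rw [hsplit]
  refine (norm_add_le_of_le (norm_add_le_of_le (norm_add_le_of_le (norm_add_le_of_le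
    (hgood 1 1 (Or.inl rfl) (Or.inl rfl)) (hgood 1 (-1) (Or.inl rfl) (Or.inr rfl)))
    (hgood (-1) 1 (Or.inr rfl) (Or.inl rfl))) (hgood (-1) (-1) (Or.inr rfl) (Or.inr rfl)))
    hbad).trans ?_
  have hMτ : 1 ≤ M * τ := one_le_mul_of_one_le_of_one_le hM1 hτ1
  have h5 : τ ≤ M * τ := by nlinarith
  calc τ + τ + τ + τ + Real.log (2 * X) * (2 * (4 * 10 ^ 20 * M * τ + 1))
      ≤ 1 * (4 * (M * τ)) + Real.log (2 * X) * (2 * (4 * 10 ^ 20 * (M * τ) + M * τ)) := by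
        have : 0 ≤ Real.log (2 * X) := by linarith
        rw [mul_assoc (4 * 10 ^ 20) M τ]
        have : Real.log (2 * X) * (2 * (4 * 10 ^ 20 * (M * τ) + 1)) ≤
          Real.log (2 * X) * (2 * (4 * 10 ^ 20 * (M * τ) + M * τ)) := by gcongr
        linarith
    _ ≤ Real.log (2 * X) * (4 * (M * τ)) + Real.log (2 * X) * (2 * (4 * 10 ^ 20 * (M * τ) + M * τ)) := by
        gcongr
    _ = (8 * 10 ^ 20 + 6) * (M * Real.log (2 * X) * τ) := by ring
    _ ≤ 10 ^ 22 * (M * Real.log (2 * X) * τ) := by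
        have : 0 ≤ Real.log (2 * X) := by linarith
        gcongr
        norm_num
    _ = _ := by ring

end

theorem expi_natCast_mul (r : ℕ) (θ : ℝ) : expi (r * θ) = expi θ ^ r := by
  unfold expi
  rw [← Complex.exp_nat_mul]
  congr 1
  push_cast
  ring

theorem expi_sub_int (x : ℝ) (m : ℤ) : expi (x - m) = expi x := by
  rw [sub_eq_add_neg, expi_add, ← Int.cast_neg, expi_int, mul_one]

theorem norm_expi_sub_one (y : ℝ) : ‖expi y - 1‖ = 2 * |Real.sin (Real.pi * y)| := by
  have h : ‖expi y - 1‖ ^ 2 = (2 * |Real.sin (Real.pi * y)|) ^ 2 := by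
    rw [Complex.sq_norm, Complex.normSq_apply, expi_eq, mul_pow, sq_abs]
    simp only [Complex.sub_re, Complex.add_re, Complex.ofReal_re, Complex.mul_re, Complex.I_re,
      Complex.ofReal_im, Complex.I_im, Complex.one_re, Complex.sub_im, Complex.add_im,
      Complex.mul_im, Complex.one_im]
    rw [show 2 * Real.pi * y = 2 * (Real.pi * y) by ring, Real.cos_two_mul, Real.sin_two_mul]
    nlinarith [Real.sin_sq_add_cos_sq (Real.pi * y)]
  exact (sq_eq_sq₀ (norm_nonneg _) (by positivity)).1 h

theorem four_mul_le_norm_expi_sub_one {θ l : ℝ} (hl : 0 < l) (h1 : l ≤ Int.fract θ)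
    (h2 : Int.fract θ ≤ 1 - l) : 4 * l ≤ ‖expi θ - 1‖ := by
  have e : expi θ = expi (Int.fract θ) := by rw [Int.fract, expi_sub_int]
  rw [e, norm_expi_sub_one]
  have := two_mul_le_sin_pi_mul hl h1 h2
  linarith [le_abs_self (Real.sin (Real.pi * Int.fract θ))]

theorem norm_sum_range_expi_le (L : ℕ) {θ l : ℝ} (hl : 0 < l) (h1 : l ≤ Int.fract θ)
    (h2 : Int.fract θ ≤ 1 - l) : ‖∑ i ∈ range L, expi θ ^ i‖ ≤ 1 / (2 * l) := by
  have h3 := four_mul_le_norm_expi_sub_one hl h1 h2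
  have h4 := geom_sum_mul (expi θ) L
  have h5 : ‖expi θ ^ L - 1‖ ≤ 2 := by
    refine (norm_sub_le _ _).trans ?_
    rw [norm_pow, norm_expi]
    norm_num
  rw [← h4, norm_mul] at h5
  rw [le_div_iff₀ (by positivity)]
  nlinarith [norm_nonneg (∑ i ∈ range L, expi θ ^ i)]

/-- A power of a geometric sum, as a well-localised trigonometric polynomial. -/
theorem exists_localized_kernel (L q : ℕ) (hL : 1 ≤ L) (hq : 1 ≤ q) : ∃ p : ℕ → ℝ,
    (∀ r, 0 ≤ p r) ∧ ∑ r ∈ range (q * L), p r ^ 2 = 1 ∧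
    ∀ θ l : ℝ, 0 < l → l ≤ Int.fract θ → Int.fract θ ≤ 1 - l →
      ‖∑ r ∈ range (q * L), (p r : ℂ) * expi (r * θ)‖ ^ 2 ≤ (q * L) / (2 * l * L) ^ (2 * q) := by
  set P : Polynomial ℕ := (∑ i ∈ range L, Polynomial.X ^ i) ^ q with hP
  have hdeg : P.natDegree < q * L := by
    have h1 : (∑ i ∈ range L, (Polynomial.X : Polynomial ℕ) ^ i).natDegree ≤ L - 1 := by
      apply Polynomial.natDegree_sum_le_of_forall_le
      intro i hi
      rw [Polynomial.natDegree_X_pow]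
      have := mem_range.1 hi
      lia
    calc P.natDegree ≤ q * (L - 1) :=
          Polynomial.natDegree_pow_le.trans (Nat.mul_le_mul_left q h1)
      _ < q * L := Nat.mul_lt_mul_of_pos_left (by lia) (by lia)
  have heval : ∀ z : ℂ, ∑ r ∈ range (q * L), (P.coeff r : ℂ) * z ^ r = (∑ i ∈ range L, z ^ i) ^ q := by
    intro z
    have h1 := Polynomial.aeval_eq_sum_range' hdeg z
    rw [hP, map_pow, map_sum] at h1
    simp only [map_pow, Polynomial.aeval_X, nsmul_eq_mul, ← hP] at h1
    exact h1.symm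
  set S : ℝ := ∑ r ∈ range (q * L), (P.coeff r : ℝ) ^ 2 with hS
  have hLp : (0 : ℝ) < L := by exact_mod_cast hL
  have hqp : (0 : ℝ) < q := by exact_mod_cast hq
  have hsum : ∑ r ∈ range (q * L), (P.coeff r : ℝ) = (L : ℝ) ^ q := by
    have h1 := heval 1
    simp only [one_pow, mul_one, sum_const, card_range, nsmul_eq_mul] at h1
    exact_mod_cast h1
  have hCS : (L : ℝ) ^ (2 * q) ≤ q * L * S := by
    have h1 := sq_sum_le_card_mul_sum_sq (s := range (q * L)) (f := fun r => (P.coeff r : ℝ))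
    rw [hsum, card_range, ← pow_mul, mul_comm q 2, Nat.cast_mul] at h1
    exact h1
  have hSpos : 0 < S := by
    by_contra h
    have : 0 < (L : ℝ) ^ (2 * q) := by positivity
    nlinarith [mul_pos hqp hLp]
  refine ⟨fun r => (P.coeff r : ℝ) / √S, fun r => by positivity, ?_, ?_⟩
  · simp only [div_pow, Real.sq_sqrt hSpos.le]
    rw [← sum_div, ← hS, div_self hSpos.ne']
  · intro θ l hl h1 h2
    have e : ∑ r ∈ range (q * L), (((P.coeff r : ℝ) / √S : ℝ) : ℂ) * expi (r * θ) =
        (∑ i ∈ range L, expi θ ^ i) ^ q / (√S : ℂ) := by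
      rw [← heval, sum_div]
      refine sum_congr rfl fun r _ => ?_
      rw [expi_natCast_mul]
      push_cast
      ring
    rw [e, norm_div, Complex.norm_real, Real.norm_of_nonneg (Real.sqrt_nonneg S), div_pow,
      Real.sq_sqrt hSpos.le, norm_pow, ← pow_mul, mul_comm q 2]
    rw [div_le_div_iff₀ hSpos (by positivity)]
    calc ‖∑ i ∈ range L, expi θ ^ i‖ ^ (2 * q) * (2 * l * L) ^ (2 * q)
        ≤ (1 / (2 * l)) ^ (2 * q) * (2 * l * L) ^ (2 * q) := by
          gcongr
          exact norm_sum_range_expi_le L hl h1 h2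
      _ = (L : ℝ) ^ (2 * q) := by
          rw [← mul_pow]
          congr 1
          field_simp
      _ ≤ _ := hCS

/-- The nonnegative kernel attached to the coefficients `p`, normalised for `Q` translates. -/
noncomputable def kern (p : ℕ → ℝ) (D Q : ℕ) (θ : ℝ) : ℝ :=
  ‖∑ r ∈ range D, (p r : ℂ) * expi (r * θ)‖ ^ 2 / Q

theorem kern_nonneg (p : ℕ → ℝ) (D Q : ℕ) (θ : ℝ) : 0 ≤ kern p D Q θ := by
  unfold kern; positivity

theorem kern_eq (p : ℕ → ℝ) (D Q : ℕ) (θ : ℝ) : (kern p D Q θ : ℂ) =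
    (∑ r ∈ range D, ∑ s ∈ range D, ((p r * p s : ℝ) : ℂ) * expi (((r : ℝ) - s) * θ)) / Q := by
  unfold kern
  rw [Complex.ofReal_div, Complex.ofReal_pow, ← Complex.mul_conj']
  congr 1
  rw [map_sum, sum_mul_sum]
  refine sum_congr rfl fun r _ => sum_congr rfl fun s _ => ?_
  rw [map_mul, Complex.conj_ofReal, ← expi_neg, sub_mul, sub_eq_add_neg, expi_add]
  push_cast
  ring

theorem sum_expi_div_eq_zero {Q : ℕ} {m : ℤ} (hm : m ≠ 0) (hmQ : |m| < Q) :
    ∑ k ∈ range Q, expi (m * ((k : ℝ) / Q)) = 0 := by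
  have hQ : 0 < (Q : ℤ) := lt_of_le_of_lt (abs_nonneg m) hmQ
  have hQr : (0 : ℝ) < Q := by exact_mod_cast hQ
  have e : ∀ k : ℕ, expi (m * ((k : ℝ) / Q)) = expi ((m : ℝ) / Q) ^ k := by
    intro k
    rw [← expi_natCast_mul]
    congr 1
    ring
  simp only [e]
  have h1 := geom_sum_mul (expi ((m : ℝ) / Q)) Q
  have h2 : expi ((m : ℝ) / Q) ^ Q = 1 := by
    rw [← expi_natCast_mul, mul_div_cancel₀ _ hQr.ne', expi_int]
  rw [h2, sub_self, mul_eq_zero] at h1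
  refine h1.resolve_right fun h => ?_
  unfold expi at h
  rw [sub_eq_zero, Complex.exp_eq_one_iff] at h
  obtain ⟨n, hn⟩ := h
  have h3 : ((m : ℝ) / Q : ℝ) = n := by
    have h4 : (2 * Real.pi * Complex.I : ℂ) ≠ 0 := Complex.two_pi_I_ne_zero
    have h5 : (((m : ℝ) / Q : ℝ) : ℂ) * (2 * Real.pi * Complex.I) = n * (2 * Real.pi * Complex.I) := by
      rw [← hn]; push_cast; ring
    exact_mod_cast mul_right_cancel₀ h4 h5
  rw [div_eq_iff hQr.ne'] at h3
  have h6 : m = n * Q := by exact_mod_cast h3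
  have h7 : n ≠ 0 := by rintro rfl; simp at h6; exact hm h6
  rw [h6, abs_mul, abs_of_pos hQ] at hmQ
  have := Int.one_le_abs h7
  nlinarith

theorem sum_kern {p : ℕ → ℝ} {D Q : ℕ} (hp : ∑ r ∈ range D, p r ^ 2 = 1) (hDQ : D ≤ Q)
    (hQ : 0 < Q) (θ : ℝ) : ∑ k ∈ range Q, kern p D Q (θ - k / Q) = 1 := by
  have hQc : (Q : ℂ) ≠ 0 := by exact_mod_cast hQ.ne'
  have h : (∑ k ∈ range Q, kern p D Q (θ - k / Q) : ℂ) = 1 := by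
    simp only [kern_eq]
    rw [← sum_div, div_eq_one_iff_eq hQc, sum_comm]
    calc ∑ r ∈ range D, ∑ k ∈ range Q, ∑ s ∈ range D,
          ((p r * p s : ℝ) : ℂ) * expi (((r : ℝ) - s) * (θ - k / Q))
        = ∑ r ∈ range D, ((p r ^ 2 : ℝ) : ℂ) * Q := by
          refine sum_congr rfl fun r hr => ?_
          rw [sum_comm, sum_eq_single r]
          · simp [expi_zero, mul_comm, sq]
          · intro s hs hsr
            have hz := sum_expi_div_eq_zero (Q := Q) (m := (s : ℤ) - r) (by lia) (by
              rw [mem_range] at hr hs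
              rw [abs_lt]; constructor <;> lia)
            have : ∀ k : ℕ, ((p r * p s : ℝ) : ℂ) * expi (((r : ℝ) - s) * (θ - k / Q)) =
                ((p r * p s : ℝ) : ℂ) * expi (((r : ℝ) - s) * θ) *
                  expi ((((s : ℤ) - r : ℤ) : ℝ) * ((k : ℝ) / Q)) := by
              intro k
              rw [mul_assoc, ← expi_add]
              congr 2
              push_cast
              ring
            simp only [this]
            rw [← mul_sum, hz, mul_zero]
          · intro h; exact absurd hr h
      _ = Q := by
          rw [← sum_mul]
          have : ∑ r ∈ range D, ((p r ^ 2 : ℝ) : ℂ) = 1 := by exact_mod_cast congrArg (fun x : ℝ => (x : ℂ)) hp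
          rw [this, one_mul]
  exact_mod_cast h

theorem psi_le_psi_add_fract (t u : ℝ) : psi t ≤ psi u + Int.fract (t - u) := by
  have := Int.fract_add_le u (t - u)
  rw [add_sub_cancel] at this
  unfold psi
  linarith

theorem psi_natCast_div {l Q : ℕ} (h : l < Q) : psi ((l : ℝ) / Q) = (l : ℝ) / Q - 1 / 2 := by
  have hQ : (0 : ℝ) < Q := by exact_mod_cast (Nat.zero_le l).trans_lt h
  unfold psi
  rw [Int.fract_eq_self.2 ⟨by positivity, by rw [div_lt_one hQ]; exact_mod_cast h⟩]

theorem sub_one_mul_sum_range_mul_pow (z : ℂ) (n : ℕ) :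
    (z - 1) * ∑ l ∈ range n, (l : ℂ) * z ^ l = n * z ^ n - z * ∑ l ∈ range n, z ^ l := by
  induction n with
  | zero => simp
  | succ n ih =>
    rw [sum_range_succ, sum_range_succ, mul_add, ih]
    push_cast
    ring

theorem norm_sum_psi_mul_expi_le {Q : ℕ} {m : ℤ} (hm : m ≠ 0) (hmQ : 2 * |m| ≤ Q) :
    ‖∑ l ∈ range Q, (psi ((l : ℝ) / Q) : ℂ) * expi (m * ((l : ℝ) / Q))‖ ≤ Q / (4 * |(m : ℝ)|) := by
  have hm1 := Int.one_le_abs hm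
  have hQr : (0 : ℝ) < Q := by
    have : (0 : ℤ) < Q := by lia
    exact_mod_cast this
  have hmr : 0 < |(m : ℝ)| := abs_pos.2 (by exact_mod_cast hm)
  have hmQr : 2 * |(m : ℝ)| ≤ Q := by exact_mod_cast hmQ
  set z := expi ((m : ℝ) / Q) with hz
  have e : ∀ k : ℕ, expi (m * ((k : ℝ) / Q)) = z ^ k := by
    intro k
    rw [hz, ← expi_natCast_mul]
    congr 1
    ring
  have hsum : ∑ l ∈ range Q, z ^ l = 0 := by
    simp only [← e]
    exact sum_expi_div_eq_zero hm (by lia)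
  have hzQ : z ^ Q = 1 := by
    rw [hz, ← expi_natCast_mul, mul_div_cancel₀ _ hQr.ne', expi_int]
  have h1 := sub_one_mul_sum_range_mul_pow z Q
  rw [hzQ, hsum, mul_zero, sub_zero, mul_one] at h1
  have h2 : ∑ l ∈ range Q, (psi ((l : ℝ) / Q) : ℂ) * expi (m * ((l : ℝ) / Q)) =
      (∑ l ∈ range Q, (l : ℂ) * z ^ l) / Q := by
    rw [sum_div, ← sub_zero (∑ l ∈ range Q, (l : ℂ) * z ^ l / Q), ← mul_zero (1 / 2 : ℂ), ← hsum,
      mul_sum, ← sum_sub_distrib]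
    refine sum_congr rfl fun l hl => ?_
    rw [psi_natCast_div (mem_range.1 hl), e]
    push_cast
    ring
  have h3 : 4 * (|(m : ℝ)| / Q) ≤ ‖z - 1‖ := by
    rw [hz, norm_expi_sub_one]
    have h4 := two_mul_le_sin_pi_mul (y := |(m : ℝ)| / Q) (l := |(m : ℝ)| / Q) (by positivity) le_rfl
      (by
        have : |(m : ℝ)| / Q ≤ 1 / 2 := by
          rw [div_le_iff₀ hQr]; linarith
        linarith)
    have h5 : |Real.sin (Real.pi * ((m : ℝ) / Q))| = |Real.sin (Real.pi * (|(m : ℝ)| / Q))| := by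
      rcases abs_choice (m : ℝ) with h | h
      · rw [h]
      · rw [h, neg_div, mul_neg, Real.sin_neg, abs_neg]
    rw [h5]
    linarith [le_abs_self (Real.sin (Real.pi * (|(m : ℝ)| / Q)))]
  rw [h2, norm_div, Complex.norm_natCast, div_le_div_iff₀ hQr (by positivity)]
  have h6 := congrArg norm h1
  rw [norm_mul, Complex.norm_natCast] at h6
  have h7 : 4 * (|(m : ℝ)| / Q) * ‖∑ l ∈ range Q, (l : ℂ) * z ^ l‖ ≤ Q :=
    le_trans (by gcongr) h6.le
  calc ‖∑ l ∈ range Q, (l : ℂ) * z ^ l‖ * (4 * |(m : ℝ)|)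
      = 4 * (|(m : ℝ)| / Q) * ‖∑ l ∈ range Q, (l : ℂ) * z ^ l‖ * Q := by field_simp
    _ ≤ Q * Q := by gcongr

theorem sum_range_psi_div {Q : ℕ} (hQ : 0 < Q) : ∑ l ∈ range Q, psi ((l : ℝ) / Q) = -(1 / 2) := by
  have h1 : ∑ l ∈ range Q, psi ((l : ℝ) / Q) = ∑ l ∈ range Q, ((l : ℝ) / Q - 1 / 2) :=
    sum_congr rfl fun l hl => psi_natCast_div (mem_range.1 hl)
  have h2 : ∑ l ∈ range Q, (l : ℝ) = Q * (Q - 1) / 2 := by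
    clear h1 hQ
    induction Q with
    | zero => simp
    | succ n ih => rw [sum_range_succ, ih]; push_cast; ring
  have hQr : (0 : ℝ) < Q := by exact_mod_cast hQ
  rw [h1, sum_sub_distrib, ← sum_div, h2, sum_const, card_range, nsmul_eq_mul]
  field_simp
  ring

theorem sum_range_inv_abs_sub_le (D r : ℕ) (hr : r < D) :
    ∑ s ∈ range D, |(r : ℝ) - s|⁻¹ ≤ 2 * (1 + Real.log D) := by
  have hh : ∀ n ≤ D, ∑ i ∈ range n, ((i : ℝ) + 1)⁻¹ ≤ 1 + Real.log D := by
    intro n hn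
    calc ∑ i ∈ range n, ((i : ℝ) + 1)⁻¹ ≤ ∑ i ∈ range D, ((i : ℝ) + 1)⁻¹ := by
          apply sum_le_sum_of_subset_of_nonneg (range_subset_range.2 hn)
          intros; positivity
      _ = (harmonic D : ℝ) := by unfold harmonic; push_cast; rfl
      _ ≤ _ := harmonic_le_one_add_log D
  rw [← sum_range_add_sum_Ico _ hr.le, sum_Ico_eq_sum_range, two_mul]
  apply add_le_add
  · refine le_trans (le_of_eq ?_) (hh r hr.le)
    rw [← sum_range_reflect]
    refine sum_congr rfl fun j hj => ?_
    have hj := mem_range.1 hj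
    have : ((r - 1 - j : ℕ) : ℝ) = r - 1 - j := by
      rw [Nat.cast_sub (by lia), Nat.cast_sub (by lia)]; simp
    rw [this, show (r : ℝ) - (r - 1 - j) = j + 1 by ring, abs_of_pos (by positivity)]
  · obtain ⟨k, hk⟩ : ∃ k, D - r = k + 1 := ⟨D - r - 1, by lia⟩
    rw [hk, sum_range_succ']
    refine le_trans (le_of_eq ?_) (hh k (by lia))
    simp only [Nat.cast_add, add_zero, sub_self, abs_zero, inv_zero]
    refine sum_congr rfl fun j _ => ?_
    rw [show (r : ℝ) - (r + (j + (1 : ℕ))) = -(j + 1) by push_cast; ring, abs_neg,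
      abs_of_pos (by positivity)]

theorem sum_sum_mul_inv_abs_sub_le {p : ℕ → ℝ} {D : ℕ} (hp : ∑ r ∈ range D, p r ^ 2 = 1) :
    ∑ r ∈ range D, ∑ s ∈ range D, p r * p s * |(r : ℝ) - s|⁻¹ ≤ 2 * (1 + Real.log D) := by
  have h1 : ∑ r ∈ range D, ∑ s ∈ range D, p r ^ 2 * |(r : ℝ) - s|⁻¹ ≤ 2 * (1 + Real.log D) := by
    calc ∑ r ∈ range D, ∑ s ∈ range D, p r ^ 2 * |(r : ℝ) - s|⁻¹
        ≤ ∑ r ∈ range D, p r ^ 2 * (2 * (1 + Real.log D)) := by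
          refine sum_le_sum fun r hr => ?_
          rw [← mul_sum]
          gcongr
          exact sum_range_inv_abs_sub_le D r (mem_range.1 hr)
      _ = _ := by rw [← sum_mul, hp, one_mul]
  have h2 : ∑ r ∈ range D, ∑ s ∈ range D, p s ^ 2 * |(r : ℝ) - s|⁻¹ ≤ 2 * (1 + Real.log D) := by
    rw [sum_comm]
    simpa only [abs_sub_comm] using h1
  have h3 : ∑ r ∈ range D, ∑ s ∈ range D, p r * p s * |(r : ℝ) - s|⁻¹ ≤
      ∑ r ∈ range D, ∑ s ∈ range D, (p r ^ 2 * |(r : ℝ) - s|⁻¹ + p s ^ 2 * |(r : ℝ) - s|⁻¹) / 2 := by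
    refine sum_le_sum fun r _ => sum_le_sum fun s _ => ?_
    rw [← add_mul, mul_div_right_comm]
    gcongr
    nlinarith [sq_nonneg (p r - p s)]
  simp only [← sum_div, sum_add_distrib] at h3
  linarith

/-- The sawtooth smoothed by the kernel. -/
noncomputable def smoothPsi (p : ℕ → ℝ) (D Q : ℕ) (v : ℝ) : ℝ :=
  ∑ l ∈ range Q, kern p D Q (v - l / Q) * psi ((l : ℝ) / Q)

theorem psi_le_smoothPsi {p : ℕ → ℝ} {D Q : ℕ} {s τ : ℝ} (hp : ∑ r ∈ range D, p r ^ 2 = 1)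
    (hDQ : D ≤ Q) (hQ : 0 < Q) (hs : 0 < s)
    (htail : ∀ θ : ℝ, s ≤ Int.fract θ → Int.fract θ ≤ 1 - s → kern p D Q θ ≤ τ / Q) (t : ℝ)
    (hτ : 0 ≤ τ) : psi t ≤ smoothPsi p D Q (t - s) + 2 * s + τ := by
  have hQr : (0 : ℝ) < Q := by exact_mod_cast hQ
  have key : ∀ l : ℕ, kern p D Q (t - s - l / Q) * psi t ≤
      kern p D Q (t - s - l / Q) * psi ((l : ℝ) / Q) + kern p D Q (t - s - l / Q) * (2 * s) + τ / Q := by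
    intro l
    have h0 := kern_nonneg p D Q (t - s - l / Q)
    have h1 := mul_le_mul_of_nonneg_left (psi_le_psi_add_fract t (l / Q)) h0
    have hf0 := Int.fract_nonneg (t - (l : ℝ) / Q)
    have hf1 := Int.fract_lt_one (t - (l : ℝ) / Q)
    have hτQ : 0 ≤ τ / Q := by positivity
    rcases le_or_gt (Int.fract (t - (l : ℝ) / Q)) (2 * s) with h | h
    · have := mul_le_mul_of_nonneg_left h h0
      linarith
    · have hfr : Int.fract (t - s - (l : ℝ) / Q) = Int.fract (t - (l : ℝ) / Q) - s := by
        rw [Int.fract_eq_iff]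
        refine ⟨by linarith, by linarith, ⌊t - (l : ℝ) / Q⌋, ?_⟩
        rw [Int.fract]; ring
      have h2 := htail (t - s - (l : ℝ) / Q) (by rw [hfr]; linarith) (by rw [hfr]; linarith)
      have h3 : kern p D Q (t - s - l / Q) * Int.fract (t - (l : ℝ) / Q) ≤
          kern p D Q (t - s - l / Q) := mul_le_of_le_one_right h0 hf1.le
      have := mul_nonneg h0 (by linarith : 0 ≤ 2 * s)
      linarith
  have h := sum_le_sum fun l (_ : l ∈ range Q) => key l
  rw [← sum_mul, sum_kern hp hDQ hQ, sum_add_distrib, sum_add_distrib, ← sum_mul,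
    sum_kern hp hDQ hQ, sum_const, card_range, nsmul_eq_mul, mul_div_cancel₀ _ hQr.ne'] at h
  unfold smoothPsi
  linarith

theorem smoothPsi_le_psi {p : ℕ → ℝ} {D Q : ℕ} {s τ : ℝ} (hp : ∑ r ∈ range D, p r ^ 2 = 1)
    (hDQ : D ≤ Q) (hQ : 0 < Q) (hs : 0 < s)
    (htail : ∀ θ : ℝ, s ≤ Int.fract θ → Int.fract θ ≤ 1 - s → kern p D Q θ ≤ τ / Q) (t : ℝ)
    (hτ : 0 ≤ τ) : smoothPsi p D Q (t + s) - 2 * s - τ ≤ psi t := by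
  have hQr : (0 : ℝ) < Q := by exact_mod_cast hQ
  have key : ∀ l : ℕ, kern p D Q (t + s - l / Q) * psi ((l : ℝ) / Q) ≤
      kern p D Q (t + s - l / Q) * psi t + kern p D Q (t + s - l / Q) * (2 * s) + τ / Q := by
    intro l
    have h0 := kern_nonneg p D Q (t + s - l / Q)
    have h1 := mul_le_mul_of_nonneg_left (psi_le_psi_add_fract (l / Q) t) h0
    have hf0 := Int.fract_nonneg ((l : ℝ) / Q - t)
    have hf1 := Int.fract_lt_one ((l : ℝ) / Q - t)
    have hτQ : 0 ≤ τ / Q := by positivity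
    rcases le_or_gt (Int.fract ((l : ℝ) / Q - t)) (2 * s) with h | h
    · have := mul_le_mul_of_nonneg_left h h0
      linarith
    · have hfr : Int.fract (t + s - (l : ℝ) / Q) = 1 + s - Int.fract ((l : ℝ) / Q - t) := by
        rw [Int.fract_eq_iff]
        refine ⟨by linarith, by linarith, -⌊(l : ℝ) / Q - t⌋ - 1, ?_⟩
        rw [Int.fract]; push_cast; ring
      have h2 := htail (t + s - (l : ℝ) / Q) (by rw [hfr]; linarith) (by rw [hfr]; linarith)
      have h3 : kern p D Q (t + s - l / Q) * Int.fract ((l : ℝ) / Q - t) ≤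
          kern p D Q (t + s - l / Q) := mul_le_of_le_one_right h0 hf1.le
      have := mul_nonneg h0 (by linarith : 0 ≤ 2 * s)
      linarith
  have h := sum_le_sum fun l (_ : l ∈ range Q) => key l
  rw [sum_add_distrib, sum_add_distrib, ← sum_mul, ← sum_mul,
    sum_kern hp hDQ hQ, sum_const, card_range, nsmul_eq_mul, mul_div_cancel₀ _ hQr.ne'] at h
  unfold smoothPsi
  linarith

theorem smoothPsi_eq (p : ℕ → ℝ) (D Q : ℕ) (v : ℝ) : (smoothPsi p D Q v : ℂ) =
    ∑ r ∈ range D, ∑ s ∈ range D, ((p r * p s / Q : ℝ) : ℂ) * expi (((r : ℝ) - s) * v) *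
      ∑ l ∈ range Q, (psi ((l : ℝ) / Q) : ℂ) * expi ((((s : ℤ) - r : ℤ) : ℝ) * ((l : ℝ) / Q)) := by
  unfold smoothPsi
  push_cast
  simp only [kern_eq, mul_sum, sum_mul, sum_div]
  rw [sum_comm]
  refine sum_congr rfl fun r _ => ?_
  rw [sum_comm]
  refine sum_congr rfl fun s _ => sum_congr rfl fun l _ => ?_
  rw [show ((r : ℝ) - s) * (v - l / Q) = ((r : ℝ) - s) * v + ((s : ℝ) - r) * (l / Q) by ring,
    expi_add]
  push_cast
  ring

theorem abs_sum_smoothPsi_le {p : ℕ → ℝ} {D Q : ℕ} {E : ℝ} (hp0 : ∀ r, 0 ≤ p r)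
    (hp : ∑ r ∈ range D, p r ^ 2 = 1) (hDQ : 2 * D ≤ Q) (hQ : 0 < Q) (S : Finset ℕ)
    (b t : ℕ → ℝ) (hb : ∀ n ∈ S, 0 ≤ b n) (hE0 : 0 ≤ E)
    (hE : ∀ h : ℤ, h ≠ 0 → |h| < D → ‖∑ n ∈ S, (b n : ℂ) * expi (h * t n)‖ ≤ E) (v : ℝ) :
    |∑ n ∈ S, b n * smoothPsi p D Q (t n + v)| ≤ (∑ n ∈ S, b n) / (2 * Q) + E * (1 + Real.log D) := by
  have hQr : (0 : ℝ) < Q := by exact_mod_cast hQ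
  have hM : 0 ≤ ∑ n ∈ S, b n := sum_nonneg hb
  have expand : ((∑ n ∈ S, b n * smoothPsi p D Q (t n + v) : ℝ) : ℂ) =
      ∑ r ∈ range D, ∑ s ∈ range D, ((p r * p s / Q : ℝ) : ℂ) * expi (((r : ℝ) - s) * v) *
        (∑ l ∈ range Q, (psi ((l : ℝ) / Q) : ℂ) * expi ((((s : ℤ) - r : ℤ) : ℝ) * ((l : ℝ) / Q))) *
        ∑ n ∈ S, (b n : ℂ) * expi ((((r : ℤ) - s : ℤ) : ℝ) * t n) := by
    rw [Complex.ofReal_sum]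
    simp only [Complex.ofReal_mul _ (smoothPsi _ _ _ _), smoothPsi_eq]
    simp only [mul_sum _ (fun n => (b n : ℂ) * _)]
    simp only [mul_sum (range D)]
    rw [sum_comm]
    refine sum_congr rfl fun r _ => ?_
    rw [sum_comm]
    refine sum_congr rfl fun s _ => sum_congr rfl fun n _ => ?_
    rw [mul_add, expi_add]
    push_cast
    ring
  have term : ∀ r ∈ range D, ∀ s ∈ range D,
      ‖((p r * p s / Q : ℝ) : ℂ) * expi (((r : ℝ) - s) * v) *
        (∑ l ∈ range Q, (psi ((l : ℝ) / Q) : ℂ) * expi ((((s : ℤ) - r : ℤ) : ℝ) * ((l : ℝ) / Q))) *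
        ∑ n ∈ S, (b n : ℂ) * expi ((((r : ℤ) - s : ℤ) : ℝ) * t n)‖ ≤
      (if s = r then p r ^ 2 * ((∑ n ∈ S, b n) / (2 * Q)) else 0) +
        E / 4 * (p r * p s * |(r : ℝ) - s|⁻¹) := by
    intro r hr s hs
    rw [mem_range] at hr hs
    have hc : 0 ≤ p r * p s / Q := div_nonneg (mul_nonneg (hp0 r) (hp0 s)) hQr.le
    rw [norm_mul, norm_mul, norm_mul, norm_expi, mul_one, Complex.norm_real, Real.norm_of_nonneg hc]
    split_ifs with h
    · subst h
      simp only [sub_self, Int.cast_zero, zero_mul, expi_zero, mul_one, abs_zero, inv_zero, mul_zero,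
        add_zero]
      rw [← Complex.ofReal_sum, ← Complex.ofReal_sum, Complex.norm_real, Complex.norm_real,
        sum_range_psi_div hQ, Real.norm_of_nonneg hM]
      apply le_of_eq
      norm_num
      field_simp
    · have h1 := norm_sum_psi_mul_expi_le (Q := Q) (m := (s : ℤ) - r) (by lia) (by
        rcases abs_choice ((s : ℤ) - r) with h | h <;> rw [h] <;> lia)
      have h2 := hE ((r : ℤ) - s) (by lia) (by rw [abs_lt]; constructor <;> lia)
      have h3 : |(((s : ℤ) - r : ℤ) : ℝ)| = |(r : ℝ) - s| := by
        rw [abs_sub_comm]; push_cast; rfl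
      have h4 : 0 < |(r : ℝ) - s| := by
        rw [abs_pos, sub_ne_zero]; exact_mod_cast (Ne.symm h)
      rw [h3] at h1
      rw [zero_add]
      calc _ ≤ p r * p s / Q * (Q / (4 * |(r : ℝ) - s|)) * E := by gcongr
        _ = _ := by field_simp
  have h := norm_sum_le_of_le _ fun r hr => norm_sum_le_of_le _ (term r hr)
  rw [← expand, Complex.norm_real, Real.norm_eq_abs] at h
  refine h.trans ?_
  simp only [sum_add_distrib, ← mul_sum]
  have e1 : ∑ r ∈ range D, ∑ s ∈ range D, (if s = r then p r ^ 2 * ((∑ n ∈ S, b n) / (2 * Q)) else 0) =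
      (∑ n ∈ S, b n) / (2 * Q) := by
    rw [sum_congr rfl fun r hr => by rw [sum_ite_eq_of_mem' _ _ _ hr]]
    rw [← sum_mul, hp, one_mul]
  rw [e1]
  have h2 := mul_le_mul_of_nonneg_left (sum_sum_mul_inv_abs_sub_le hp) (by positivity : 0 ≤ E / 4)
  have h3 : 0 ≤ E * (1 + Real.log D) :=
    mul_nonneg hE0 (by linarith [Real.log_natCast_nonneg D])
  linarith

theorem abs_sum_psi_le {p : ℕ → ℝ} {D Q : ℕ} {E s τ : ℝ} (hp0 : ∀ r, 0 ≤ p r)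
    (hp : ∑ r ∈ range D, p r ^ 2 = 1) (hDQ : 2 * D ≤ Q) (hQ : 0 < Q) (hs : 0 < s) (hτ : 0 ≤ τ)
    (htail : ∀ θ : ℝ, s ≤ Int.fract θ → Int.fract θ ≤ 1 - s → kern p D Q θ ≤ τ / Q)
    (S : Finset ℕ) (b t : ℕ → ℝ) (hb : ∀ n ∈ S, 0 ≤ b n) (hE0 : 0 ≤ E)
    (hE : ∀ h : ℤ, h ≠ 0 → |h| < D → ‖∑ n ∈ S, (b n : ℂ) * expi (h * t n)‖ ≤ E) :
    |∑ n ∈ S, b n * psi (t n)| ≤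
      (∑ n ∈ S, b n) * (2 * s + τ + 1 / (2 * Q)) + E * (1 + Real.log D) := by
  have h1 := abs_sum_smoothPsi_le hp0 hp hDQ hQ S b t hb hE0 hE (-s)
  have h2 := abs_sum_smoothPsi_le hp0 hp hDQ hQ S b t hb hE0 hE s
  have h3 : ∑ n ∈ S, b n * psi (t n) ≤
      ∑ n ∈ S, b n * smoothPsi p D Q (t n + -s) + (∑ n ∈ S, b n) * (2 * s + τ) := by
    rw [sum_mul, ← sum_add_distrib]
    refine sum_le_sum fun n hn => ?_
    rw [← mul_add]
    have := psi_le_smoothPsi hp (by lia) hQ hs htail (t n) hτ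
    exact mul_le_mul_of_nonneg_left (by rw [← sub_eq_add_neg]; linarith) (hb n hn)
  have h4 : ∑ n ∈ S, b n * smoothPsi p D Q (t n + s) - (∑ n ∈ S, b n) * (2 * s + τ) ≤
      ∑ n ∈ S, b n * psi (t n) := by
    rw [sum_mul, ← sum_sub_distrib]
    refine sum_le_sum fun n hn => ?_
    rw [← mul_sub]
    have := smoothPsi_le_psi hp (by lia) hQ hs htail (t n) hτ
    exact mul_le_mul_of_nonneg_left (by linarith) (hb n hn)
  have e : (∑ n ∈ S, b n) * (2 * s + τ + 1 / (2 * Q)) =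
      (∑ n ∈ S, b n) * (2 * s + τ) + (∑ n ∈ S, b n) / (2 * Q) := by ring
  rw [e]
  rw [abs_le] at h1 h2 ⊢
  constructor <;> linarith

theorem psi_le_psi_add_of_abs_sub_le {t u Δ : ℝ} (h : |t - u| ≤ Δ) :
    psi t ≤ psi (u - Δ) + 2 * Δ := by
  rw [abs_le] at h
  have h1 := psi_le_psi_add_fract t (u - Δ)
  have h2 : Int.fract (t - (u - Δ)) ≤ t - (u - Δ) := by
    have : 0 ≤ ⌊t - (u - Δ)⌋ := Int.floor_nonneg.2 (by linarith)
    have : (0 : ℝ) ≤ ⌊t - (u - Δ)⌋ := by exact_mod_cast this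
    rw [Int.fract]; linarith
  linarith

theorem psi_le_psi_add_one (t u : ℝ) : psi t ≤ psi u + 1 := by
  have h1 := psi_le_psi_add_fract t u
  linarith [Int.fract_lt_one (t - u)]

theorem norm_sum_kern_mul_expi_le {p : ℕ → ℝ} {D Q : ℕ} {E M : ℝ} (hp0 : ∀ r, 0 ≤ p r)
    (hp : ∑ r ∈ range D, p r ^ 2 = 1) (hDQ : D ≤ Q) (hQ : 0 < Q) (S : Finset ℕ)
    (a x y : ℕ → ℝ) (u : ℝ) (hE0 : 0 ≤ E) (hM : ‖∑ n ∈ S, (a n : ℂ) * expi (y n)‖ ≤ M)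
    (hE : ∀ m : ℤ, m ≠ 0 → |m| < D → ‖∑ n ∈ S, (a n : ℂ) * expi (y n + m * x n)‖ ≤ E) :
    ‖∑ n ∈ S, ((a n * kern p D Q (x n - u) : ℝ) : ℂ) * expi (y n)‖ ≤ M / Q + E := by
  have hQr : (0 : ℝ) < Q := by exact_mod_cast hQ
  have expand : ∑ n ∈ S, ((a n * kern p D Q (x n - u) : ℝ) : ℂ) * expi (y n) =
      ∑ r ∈ range D, ∑ s ∈ range D, ((p r * p s / Q : ℝ) : ℂ) * expi (-(((r : ℝ) - s) * u)) *
        ∑ n ∈ S, (a n : ℂ) * expi (y n + (((r : ℤ) - s : ℤ) : ℝ) * x n) := by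
    simp only [Complex.ofReal_mul _ (kern _ _ _ _), kern_eq, mul_sum, sum_mul, sum_div]
    rw [sum_comm]
    refine sum_congr rfl fun r _ => ?_
    rw [sum_comm]
    refine sum_congr rfl fun s _ => sum_congr rfl fun n _ => ?_
    rw [show ((r : ℝ) - s) * (x n - u) = -(((r : ℝ) - s) * u) + ((r : ℝ) - s) * x n by ring,
      expi_add, expi_add]
    push_cast
    ring
  have term : ∀ r ∈ range D, ∀ s ∈ range D,
      ‖((p r * p s / Q : ℝ) : ℂ) * expi (-(((r : ℝ) - s) * u)) *
        ∑ n ∈ S, (a n : ℂ) * expi (y n + (((r : ℤ) - s : ℤ) : ℝ) * x n)‖ ≤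
      (if s = r then p r ^ 2 * (M / Q) else 0) + p r * p s * (E / Q) := by
    intro r hr s hs
    rw [mem_range] at hr hs
    have hc : 0 ≤ p r * p s / Q := div_nonneg (mul_nonneg (hp0 r) (hp0 s)) hQr.le
    rw [norm_mul, norm_mul, norm_expi, mul_one, Complex.norm_real, Real.norm_of_nonneg hc]
    split_ifs with h
    · subst h
      simp only [sub_self, Int.cast_zero, zero_mul, add_zero]
      have h1 : 0 ≤ p s * p s * (E / Q) := mul_nonneg (mul_self_nonneg _) (by positivity)
      calc _ ≤ p s * p s / Q * M := by gcongr
        _ = p s ^ 2 * (M / Q) := by ring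
        _ ≤ _ := by linarith
    · rw [zero_add]
      have h2 := hE ((r : ℤ) - s) (by lia) (by rw [abs_lt]; constructor <;> lia)
      calc _ ≤ p r * p s / Q * E := by gcongr
        _ = _ := by ring
  rw [expand]
  refine (norm_sum_le_of_le _ fun r hr => norm_sum_le_of_le _ (term r hr)).trans ?_
  simp only [sum_add_distrib]
  have e1 : ∑ r ∈ range D, ∑ s ∈ range D, (if s = r then p r ^ 2 * (M / Q) else 0) = M / Q := by
    rw [sum_congr rfl fun r hr => by rw [sum_ite_eq_of_mem' _ _ _ hr]]
    rw [← sum_mul, hp, one_mul]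
  have e2 : ∑ r ∈ range D, ∑ s ∈ range D, p r * p s * (E / Q) ≤ E := by
    have h1 : ∑ r ∈ range D, ∑ s ∈ range D, p r * p s * (E / Q) =
        (∑ r ∈ range D, p r) ^ 2 * (E / Q) := by
      rw [sq, sum_mul_sum, sum_mul]
      refine sum_congr rfl fun r _ => ?_
      rw [sum_mul]
    have h2 := sq_sum_le_card_mul_sum_sq (s := range D) (f := p)
    rw [hp, card_range, mul_one] at h2
    have h3 : (D : ℝ) ≤ Q := by exact_mod_cast hDQ
    rw [h1]
    calc (∑ r ∈ range D, p r) ^ 2 * (E / Q) ≤ Q * (E / Q) := by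
          gcongr; exact h2.trans h3
      _ = E := by field_simp
  rw [e1]
  linarith

theorem card_edge_le {Q : ℕ} {ρ : ℝ} (hρ : 0 ≤ ρ) (hQ : 0 < Q) :
    (#((range Q).filter fun k : ℕ => (k : ℝ) / Q < ρ ∨ 1 - ρ < (k : ℝ) / Q) : ℝ) ≤ 2 * ρ * Q + 2 := by
  have hQr : (0 : ℝ) < Q := by exact_mod_cast hQ
  rw [filter_or]
  have h3 : ∀ S S' : Finset ℕ, ((#(S ∪ S') : ℕ) : ℝ) ≤ #S + #S' := fun S S' => by
    exact_mod_cast card_union_le S S'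
  refine (h3 _ _).trans ?_
  have h1 := card_le_of_Icc_bound ((range Q).filter fun k : ℕ => (k : ℝ) / Q < ρ) (A := 0)
    (B := ρ * Q) (by positivity) (by
      intro k hk
      have := (mem_filter.1 hk).2
      rw [div_lt_iff₀ hQr] at this
      exact ⟨by positivity, this.le⟩)
  have h2 := card_le_of_Icc_bound ((range Q).filter fun k : ℕ => 1 - ρ < (k : ℝ) / Q)
    (A := (1 - ρ) * Q) (B := Q) (by nlinarith) (by
      intro k hk
      obtain ⟨hk1, hk2⟩ := mem_filter.1 hk
      rw [lt_div_iff₀ hQr] at hk2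
      exact ⟨hk2.le, by exact_mod_cast (mem_range.1 hk1).le⟩)
  linarith

/-- If `x` is far from `k/Q` modulo one and `k/Q` is away from the integers, then the fractional
part of `x - k/Q` is away from the integers. -/
theorem fract_sub_mem_of_far {x β ρ : ℝ} (hρ : 0 ≤ ρ) (h1 : ρ ≤ β) (h2 : β ≤ 1 - ρ)
    (h : ρ < |Int.fract x - β|) : ρ ≤ Int.fract (x - β) ∧ Int.fract (x - β) ≤ 1 - ρ := by
  have hf0 := Int.fract_nonneg x
  have hf1 := Int.fract_lt_one x
  rcases lt_or_ge (Int.fract x) β with h3 | h3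
  · rw [abs_of_neg (by linarith)] at h
    have : Int.fract (x - β) = Int.fract x - β + 1 := by
      rw [Int.fract_eq_iff]
      refine ⟨by linarith, by linarith, ⌊x⌋ - 1, ?_⟩
      rw [Int.fract]; push_cast; ring
    rw [this]
    constructor <;> linarith
  · rw [abs_of_nonneg (by linarith)] at h
    have : Int.fract (x - β) = Int.fract x - β := by
      rw [Int.fract_eq_iff]
      refine ⟨by linarith, by linarith, ⌊x⌋, ?_⟩
      rw [Int.fract]; ring
    rw [this]
    constructor <;> linarith

theorem abs_bin_sum_psi_le {p p' : ℕ → ℝ} {D Q D' Q' : ℕ} {E s τ ρ τ' lam β Δ : ℝ}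
    (hp0 : ∀ r, 0 ≤ p r) (hp : ∑ r ∈ range D, p r ^ 2 = 1) (hDQ : 2 * D ≤ Q) (hQ : 0 < Q)
    (hs : 0 < s) (hτ : 0 ≤ τ)
    (htail : ∀ θ : ℝ, s ≤ Int.fract θ → Int.fract θ ≤ 1 - s → kern p D Q θ ≤ τ / Q)
    (hp0' : ∀ r, 0 ≤ p' r) (hp' : ∑ r ∈ range D', p' r ^ 2 = 1) (hDQ' : D' ≤ Q') (hQ' : 0 < Q')
    (hτ' : 0 ≤ τ') (hρ : 0 ≤ ρ)
    (htail' : ∀ θ : ℝ, ρ ≤ Int.fract θ → Int.fract θ ≤ 1 - ρ → kern p' D' Q' θ ≤ τ' / Q')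
    (S : Finset ℕ) (a x F G : ℕ → ℝ) (ha : ∀ n ∈ S, 0 ≤ a n) (hE0 : 0 ≤ E) (hlam : 0 ≤ lam)
    (hβ0 : 0 ≤ β) (hβ1 : β ≤ 1)
    (hFG : ∀ n ∈ S, |F n - G n| ≤ lam * |Int.fract (x n) - β|)
    (hE : ∀ h m : ℤ, h ≠ 0 → |h| < D → |m| < D' →
      ‖∑ n ∈ S, (a n : ℂ) * expi (h * G n + m * x n)‖ ≤ E)
    (hΔ : lam ≤ Δ ∨ ρ ≤ β ∧ β ≤ 1 - ρ ∧ lam * ρ ≤ Δ) (hΔ0 : 0 ≤ Δ) :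
    |∑ n ∈ S, a n * kern p' D' Q' (x n - β) * psi (-F n)| ≤
      (∑ n ∈ S, a n * kern p' D' Q' (x n - β)) * (2 * s + τ + 1 / (2 * Q) + 2 * Δ) +
        2 * E * (1 + Real.log D) + τ' / Q' * ∑ n ∈ S, a n := by
  have hQr : (1 : ℝ) ≤ Q' := by exact_mod_cast hQ'
  have hb : ∀ n ∈ S, 0 ≤ a n * kern p' D' Q' (x n - β) :=
    fun n hn => mul_nonneg (ha n hn) (kern_nonneg _ _ _ _)
  have shift : ∀ v : ℝ, |∑ n ∈ S, a n * kern p' D' Q' (x n - β) * psi (-G n + v)| ≤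
      (∑ n ∈ S, a n * kern p' D' Q' (x n - β)) * (2 * s + τ + 1 / (2 * Q)) +
        2 * E * (1 + Real.log D) := by
    intro v
    refine abs_sum_psi_le hp0 hp hDQ hQ hs hτ htail S _ _ hb (by positivity) fun h hh hhD => ?_
    have hE' : ∀ m : ℤ, |m| < D' →
        ‖∑ n ∈ S, (a n : ℂ) * expi (h * (-G n + v) + m * x n)‖ ≤ E := by
      intro m hm
      have e : ∑ n ∈ S, (a n : ℂ) * expi (h * (-G n + v) + m * x n) =
          expi (h * v) * ∑ n ∈ S, (a n : ℂ) * expi (((-h : ℤ) : ℝ) * G n + m * x n) := by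
        rw [mul_sum]
        refine sum_congr rfl fun n _ => ?_
        rw [mul_left_comm, ← expi_add]
        congr 2
        push_cast
        ring
      rw [e, norm_mul, norm_expi, one_mul]
      exact hE _ _ (by simpa using hh) (by simpa using hhD) hm
    have hD' : (0 : ℤ) < D' := by
      rcases Nat.eq_zero_or_pos D' with h0 | h0
      · rw [h0] at hp'; simp at hp'
      · exact_mod_cast h0
    have h0 := hE' 0 (by simpa using hD')
    simp only [Int.cast_zero, zero_mul, add_zero] at h0
    have := norm_sum_kern_mul_expi_le hp0' hp' hDQ' hQ' S a x (fun n => h * (-G n + v)) β hE0 h0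
      (fun m _ hm => hE' m hm)
    refine this.trans ?_
    have h1 : E / Q' ≤ E := div_le_self hE0 hQr
    linarith
  have near : ∀ n ∈ S, kern p' D' Q' (x n - β) ≤ τ' / Q' ∨ |F n - G n| ≤ Δ := by
    intro n hn
    rcases hΔ with h | ⟨h1, h2, h3⟩
    · right
      refine (hFG n hn).trans (le_trans ?_ h)
      apply mul_le_of_le_one_right hlam
      rw [abs_le]
      constructor <;> linarith [Int.fract_nonneg (x n), Int.fract_lt_one (x n)]
    · rcases le_or_gt |Int.fract (x n) - β| ρ with h | h
      · right
        exact (hFG n hn).trans (le_trans (by gcongr) h3)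
      · left
        obtain ⟨k1, k2⟩ := fract_sub_mem_of_far hρ h1 h2 h
        exact htail' _ k1 k2
  have pointwise : ∀ n ∈ S, ∀ t u : ℝ, |t - u| ≤ |F n - G n| →
      a n * kern p' D' Q' (x n - β) * psi t ≤ a n * kern p' D' Q' (x n - β) * psi (u - Δ) +
        a n * kern p' D' Q' (x n - β) * (2 * Δ) + τ' / Q' * a n := by
    intro n hn t u htu
    have hb' := hb n hn
    have hτ'' : 0 ≤ τ' / Q' * a n := mul_nonneg (by positivity) (ha n hn)
    rcases near n hn with h | h
    · have h1 := mul_le_mul_of_nonneg_left (psi_le_psi_add_one t (u - Δ)) hb'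
      have h2 := mul_le_mul_of_nonneg_left h (ha n hn)
      have h3 : 0 ≤ a n * kern p' D' Q' (x n - β) * (2 * Δ) := by positivity
      linarith
    · have h1 := mul_le_mul_of_nonneg_left (psi_le_psi_add_of_abs_sub_le (htu.trans h)) hb'
      linarith
  have upper : ∑ n ∈ S, a n * kern p' D' Q' (x n - β) * psi (-F n) ≤
      ∑ n ∈ S, a n * kern p' D' Q' (x n - β) * psi (-G n + -Δ) +
        (∑ n ∈ S, a n * kern p' D' Q' (x n - β)) * (2 * Δ) + τ' / Q' * ∑ n ∈ S, a n := by
    rw [sum_mul, mul_sum, ← sum_add_distrib, ← sum_add_distrib]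
    refine sum_le_sum fun n hn => ?_
    exact pointwise n hn _ _ (by rw [neg_sub_neg, abs_sub_comm])
  have lower : ∑ n ∈ S, a n * kern p' D' Q' (x n - β) * psi (-G n + Δ) ≤
      ∑ n ∈ S, a n * kern p' D' Q' (x n - β) * psi (-F n) +
        (∑ n ∈ S, a n * kern p' D' Q' (x n - β)) * (2 * Δ) + τ' / Q' * ∑ n ∈ S, a n := by
    rw [sum_mul, mul_sum, ← sum_add_distrib, ← sum_add_distrib]
    refine sum_le_sum fun n hn => ?_
    have := pointwise n hn (-G n + Δ) (-F n + Δ) (by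
      rw [show -G n + Δ - (-F n + Δ) = F n - G n by ring])
    rwa [add_sub_cancel_right] at this
  have s1 := shift (-Δ)
  have s2 := shift Δ
  rw [mul_add _ _ (2 * Δ)]
  rw [abs_le] at s1 s2 ⊢
  constructor <;> linarith

theorem abs_sum_psi_le_of_bins {p p' : ℕ → ℝ} {D Q D' Q' : ℕ} {E s τ ρ τ' lam : ℝ}
    (hp0 : ∀ r, 0 ≤ p r) (hp : ∑ r ∈ range D, p r ^ 2 = 1) (hDQ : 2 * D ≤ Q) (hQ : 0 < Q)
    (hs : 0 < s) (hτ : 0 ≤ τ)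
    (htail : ∀ θ : ℝ, s ≤ Int.fract θ → Int.fract θ ≤ 1 - s → kern p D Q θ ≤ τ / Q)
    (hp0' : ∀ r, 0 ≤ p' r) (hp' : ∑ r ∈ range D', p' r ^ 2 = 1) (hDQ' : D' ≤ Q') (hQ' : 0 < Q')
    (hτ' : 0 ≤ τ') (hρ : 0 ≤ ρ)
    (htail' : ∀ θ : ℝ, ρ ≤ Int.fract θ → Int.fract θ ≤ 1 - ρ → kern p' D' Q' θ ≤ τ' / Q')
    (S : Finset ℕ) (a x F : ℕ → ℝ) (G : ℝ → ℕ → ℝ) (ha : ∀ n ∈ S, 0 ≤ a n) (hE0 : 0 ≤ E)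
    (hlam : 0 ≤ lam)
    (hFG : ∀ β, 0 ≤ β → β ≤ 1 → ∀ n ∈ S, |F n - G β n| ≤ lam * |Int.fract (x n) - β|)
    (hE : ∀ β, 0 ≤ β → β ≤ 1 → ∀ h m : ℤ, h ≠ 0 ∨ m ≠ 0 → |h| < D → |m| < D' →
      ‖∑ n ∈ S, (a n : ℂ) * expi (h * G β n + m * x n)‖ ≤ E) (hD : 0 < D) :
    |∑ n ∈ S, a n * psi (-F n)| ≤
      (∑ n ∈ S, a n) * (2 * s + τ + 1 / (2 * Q) + 2 * lam * ρ + τ') + 2 * Q' * E * (1 + Real.log D) +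
        2 * lam * (2 * ρ * Q' + 2) * ((∑ n ∈ S, a n) / Q' + E) := by
  have hQr : (0 : ℝ) < Q' := by exact_mod_cast hQ'
  set A := ∑ n ∈ S, a n with hA
  set μ : ℕ → ℝ := fun k => ∑ n ∈ S, a n * kern p' D' Q' (x n - k / Q') with hμ
  have hμ0 : ∀ k, 0 ≤ μ k :=
    fun k => sum_nonneg fun n hn => mul_nonneg (ha n hn) (kern_nonneg _ _ _ _)
  have hμsum : ∑ k ∈ range Q', μ k = A := by
    simp only [hμ]
    rw [sum_comm]
    refine sum_congr rfl fun n _ => ?_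
    rw [← mul_sum, sum_kern hp' hDQ' hQ', mul_one]
  have hμle : ∀ k, μ k ≤ A / Q' + E := by
    intro k
    have h0 : ‖∑ n ∈ S, (a n : ℂ) * expi ((fun _ => 0 : ℕ → ℝ) n)‖ ≤ A := by
      simp only [expi_zero, mul_one]
      rw [← Complex.ofReal_sum, Complex.norm_real, Real.norm_of_nonneg (sum_nonneg ha)]
    have := norm_sum_kern_mul_expi_le hp0' hp' hDQ' hQ' S a x (fun _ => 0) (k / Q') hE0 h0
      (fun m hm hmD => by
        have := hE 0 le_rfl zero_le_one 0 m (Or.inr hm) (by simpa using hD) hmD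
        simpa using this)
    simp only [expi_zero, mul_one] at this
    rw [← Complex.ofReal_sum, Complex.norm_real] at this
    exact (Real.le_norm_self _).trans this
  classical
  set edge : ℕ → Prop := fun k => (k : ℝ) / Q' < ρ ∨ 1 - ρ < (k : ℝ) / Q' with hedge
  set Δ : ℕ → ℝ := fun k => lam * ρ + if edge k then lam else 0 with hΔ
  have hbin : ∀ k ∈ range Q', |∑ n ∈ S, a n * kern p' D' Q' (x n - k / Q') * psi (-F n)| ≤
      μ k * (2 * s + τ + 1 / (2 * Q) + 2 * Δ k) + 2 * E * (1 + Real.log D) + τ' / Q' * A := by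
    intro k hk
    have hk0 : (0 : ℝ) ≤ (k : ℝ) / Q' := by positivity
    have hk1 : (k : ℝ) / Q' ≤ 1 := by
      rw [div_le_one hQr]; exact_mod_cast (mem_range.1 hk).le
    have hlr : 0 ≤ lam * ρ := by positivity
    refine abs_bin_sum_psi_le hp0 hp hDQ hQ hs hτ htail hp0' hp' hDQ' hQ' hτ' hρ htail' S a x F
      (G (k / Q')) ha hE0 hlam hk0 hk1 (hFG _ hk0 hk1)
      (fun h m hh => hE _ hk0 hk1 h m (Or.inl hh)) ?_ ?_
    · by_cases he : edge k
      · left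
        simp only [hΔ, if_pos he]
        linarith
      · right
        have he' := he
        simp only [hedge, not_or, not_lt] at he'
        refine ⟨he'.1, he'.2, ?_⟩
        simp only [hΔ, if_neg he, add_zero, le_refl]
    · simp only [hΔ]
      split_ifs <;> linarith
  have hsplit : ∑ n ∈ S, a n * psi (-F n) =
      ∑ k ∈ range Q', ∑ n ∈ S, a n * kern p' D' Q' (x n - k / Q') * psi (-F n) := by
    rw [sum_comm]
    refine sum_congr rfl fun n _ => ?_
    rw [← sum_mul, ← mul_sum, sum_kern hp' hDQ' hQ', mul_one]
  have hΔsum : ∑ k ∈ range Q', μ k * Δ k ≤ A * (lam * ρ) + lam * (2 * ρ * Q' + 2) * (A / Q' + E) := by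
    simp only [hΔ, mul_add, sum_add_distrib]
    rw [← sum_mul, hμsum]
    simp only [← mul_add]
    gcongr
    simp only [mul_ite, mul_zero]
    rw [← sum_filter]
    have hAE : 0 ≤ A / Q' + E := (hμ0 0).trans (hμle 0)
    calc ∑ k ∈ (range Q').filter edge, μ k * lam
        ≤ ∑ k ∈ (range Q').filter edge, (A / Q' + E) * lam := by
          gcongr with k _
          exact hμle k
      _ = (#((range Q').filter edge) : ℝ) * lam * (A / Q' + E) := by
          rw [sum_const, nsmul_eq_mul]; ring
      _ ≤ (2 * ρ * Q' + 2) * lam * (A / Q' + E) := by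
          gcongr
          convert card_edge_le hρ hQ'
      _ = _ := by ring
  rw [hsplit]
  refine (abs_sum_le_sum_abs _ _).trans ((sum_le_sum hbin).trans ?_)
  simp only [mul_add (μ _), sum_add_distrib, sum_const, card_range, nsmul_eq_mul]
  have e1 : ∑ k ∈ range Q', μ k * (2 * Δ k) = 2 * ∑ k ∈ range Q', μ k * Δ k := by
    rw [mul_sum]; exact sum_congr rfl fun k _ => by ring
  rw [e1]
  simp only [← sum_mul, hμsum]
  have e2 : (Q' : ℝ) * (τ' / Q' * A) = A * τ' := by field_simp
  rw [e2]
  linarith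

theorem eventually_exists_kernel {a ε : ℝ} (ha : 0 ≤ a) (ha1 : a ≤ 1) (hε : 0 < ε) (hε1 : ε ≤ 1) :
    ∀ᶠ X : ℝ in Filter.atTop, ∃ (D : ℕ) (p : ℕ → ℝ), 0 < D ∧ X ^ (a + ε) ≤ D ∧
      (D : ℝ) ≤ X ^ (a + 2 * ε) ∧ (∀ r, 0 ≤ p r) ∧ ∑ r ∈ range D, p r ^ 2 = 1 ∧
      ∀ Q : ℕ, ∀ θ : ℝ, X ^ (-a) ≤ Int.fract θ → Int.fract θ ≤ 1 - X ^ (-a) →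
        kern p D Q θ ≤ X⁻¹ / Q := by
  obtain ⟨q, hq⟩ := exists_nat_ge (2 / ε)
  have hq0 : (1 : ℝ) ≤ q := le_trans (by rw [le_div_iff₀ hε]; linarith) hq
  have hqε : 2 ≤ q * ε := by rwa [div_le_iff₀ hε] at hq
  have hq1 : 1 ≤ q := by exact_mod_cast hq0
  filter_upwards [eventually_le_rpow (2 * q) hε, Filter.eventually_ge_atTop 1] with X hX hX1
  have hX0 : 0 < X := by linarith
  set L : ℕ := ⌈X ^ (a + ε)⌉₊ with hL
  have hLl : X ^ (a + ε) ≤ L := Nat.le_ceil _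
  have hone : 1 ≤ X ^ (a + ε) := Real.one_le_rpow hX1 (by linarith)
  have hLu : (L : ℝ) ≤ 2 * X ^ (a + ε) := by
    have := Nat.ceil_lt_add_one (a := X ^ (a + ε)) (by positivity)
    linarith
  have hL1 : (1 : ℝ) ≤ L := hone.trans hLl
  have hDu : (q : ℝ) * L ≤ X ^ (a + 2 * ε) := by
    calc (q : ℝ) * L ≤ q * (2 * X ^ (a + ε)) := by gcongr
      _ = 2 * q * X ^ (a + ε) := by ring
      _ ≤ X ^ ε * X ^ (a + ε) := by gcongr
      _ = X ^ (a + 2 * ε) := by rw [← Real.rpow_add hX0]; ring_nf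
  obtain ⟨p, hp0, hp1, hp2⟩ := exists_localized_kernel L q (by exact_mod_cast hL1) hq1
  refine ⟨q * L, p, ?_, ?_, ?_, hp0, hp1, ?_⟩
  · exact Nat.mul_pos hq1 (by exact_mod_cast hL1)
  · push_cast
    exact hLl.trans (le_mul_of_one_le_left (by positivity) hq0)
  · push_cast
    exact hDu
  · intro Q θ h1 h2
    unfold kern
    gcongr
    refine (hp2 θ _ (by positivity) h1 h2).trans ?_
    have h3 : X ^ ε ≤ 2 * X ^ (-a) * L := by
      calc X ^ ε = X ^ (-a) * X ^ (a + ε) := by rw [← Real.rpow_add hX0]; ring_nf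
        _ ≤ X ^ (-a) * L := by gcongr
        _ ≤ _ := by nlinarith [show 0 ≤ X ^ (-a) * L by positivity]
    have h4 : X ^ (4 : ℝ) ≤ (2 * X ^ (-a) * L) ^ (2 * q) := by
      calc X ^ (4 : ℝ) ≤ X ^ (ε * ((2 * q : ℕ) : ℝ)) := by
            apply Real.rpow_le_rpow_of_exponent_le hX1
            push_cast; nlinarith
        _ = (X ^ ε) ^ (2 * q) := by rw [Real.rpow_mul hX0.le, Real.rpow_natCast]
        _ ≤ _ := by gcongr
    calc (q : ℝ) * L / (2 * X ^ (-a) * L) ^ (2 * q) ≤ X ^ (a + 2 * ε) / X ^ (4 : ℝ) := by gcongr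
      _ = X ^ (a + 2 * ε - 4) := by rw [← Real.rpow_sub hX0]
      _ ≤ X ^ (-1 : ℝ) := Real.rpow_le_rpow_of_exponent_le hX1 (by linarith)
      _ = X⁻¹ := Real.rpow_neg_one X

theorem abs_rpow_sub_rpow_le {γ y u v : ℝ} (hγ0 : 0 ≤ γ) (hγ1 : γ ≤ 1) (hy : 0 < y) (hu : y ≤ u)
    (hv : y ≤ v) : |u ^ γ - v ^ γ| ≤ y ^ (γ - 1) * |u - v| := by
  wlog huv : v ≤ u generalizing u v
  · rw [abs_sub_comm, abs_sub_comm u]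
    exact this hv hu (by linarith)
  have hv0 : 0 < v := by linarith
  rw [abs_of_nonneg (sub_nonneg.2 (Real.rpow_le_rpow hv0.le huv hγ0)), abs_of_nonneg (by linarith)]
  have hr : 0 ≤ (u - v) / v := div_nonneg (by linarith) hv0.le
  have h1 := rpow_one_add_le_one_add_mul_self (s := (u - v) / v) (by linarith) hγ0 hγ1
  have h2 : u ^ γ = v ^ γ * (1 + (u - v) / v) ^ γ := by
    rw [← Real.mul_rpow hv0.le (by linarith)]
    congr 1
    field_simp
    ring
  have h3 : v ^ (γ - 1) ≤ y ^ (γ - 1) := Real.rpow_le_rpow_of_nonpos hy hv (by linarith)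
  have h4 : v ^ γ * ((u - v) / v) = v ^ (γ - 1) * (u - v) := by
    rw [Real.rpow_sub_one hv0.ne']; ring
  have h5 : γ * ((u - v) / v) ≤ (u - v) / v := mul_le_of_le_one_left hr hγ1
  have h6 : v ^ γ * (1 + (u - v) / v) ^ γ ≤ v ^ γ * (1 + (u - v) / v) := by
    gcongr; linarith
  have h7 : v ^ (γ - 1) * (u - v) ≤ y ^ (γ - 1) * (u - v) :=
    mul_le_mul_of_nonneg_right h3 (by linarith)
  rw [h2]
  linarith

section
open ArithmeticFunction

theorem exists_vonMangoldt_expi_bound {c : ℝ} (hc1 : 1 < c) (hc2 : c < 82 / 79) :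
    ∃ X0 : ℝ, ∀ X ≥ X0, ∀ T w H H' : ℝ, ∀ h m : ℤ, (10 ^ 9 * X) ^ c ≤ T →
      T ≤ (10 ^ 9 * X) ^ c + 2 → 0 < w → w ≤ 1 → h ≠ 0 ∨ m ≠ 0 → |(h : ℝ)| ≤ H → |(m : ℝ)| ≤ H' →
      H * (2 * (10 ^ 9 * X)) + H' * (2 * (10 ^ 9 * X) ^ c) ≤ X ^ (27 / 26 : ℝ) →
      ‖∑ n ∈ Ioc ⌊X⌋₊ ⌊2 * X⌋₊, ((Λ n : ℝ) : ℂ) *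
        expi (h * (w * (T - (n : ℝ) ^ c) ^ (1 / c)) + m * (n : ℝ) ^ c)‖ ≤
        10 ^ 22 * (1 / w) * Real.log (2 * X) * X ^ (1 - 3 / 79 : ℝ) := by
  obtain ⟨X0, hX0⟩ := exists_phase_sum_bound hc1 hc2
  refine ⟨max X0 2, fun X hX T w H H' h m hT1 hT2 hw0 hw1 hhm hH hH' hHH => ?_⟩
  have hX2 : 2 ≤ X := (le_max_right _ _).trans hX
  have hXpos : 0 < X := by linarith
  have hc0 : 0 < c := by linarith
  have hY1 : 1 ≤ 10 ^ 9 * X := by nlinarith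
  have hYY : 10 ^ 9 * X ≤ (10 ^ 9 * X) ^ c := Real.self_le_rpow_of_one_le hY1 hc1.le
  have hXc : 0 < X ^ c := by positivity
  have hT0 : 0 < T := by linarith
  have hYc : (10 ^ 9 * X) ^ c = (10 ^ 9) ^ c * X ^ c := Real.mul_rpow (by norm_num) hXpos.le
  have hT2' : T ≤ 2 * (10 ^ 9 * X) ^ c := by nlinarith
  have hTroot : 10 ^ 9 * X ≤ T ^ (1 / c) := by
    calc 10 ^ 9 * X = ((10 ^ 9 * X) ^ c) ^ (1 / c) := by
          rw [← Real.rpow_mul (by linarith), mul_one_div_cancel hc0.ne', Real.rpow_one]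
      _ ≤ T ^ (1 / c) := by gcongr
  have hTroot' : T ^ (1 / c) ≤ 2 * (10 ^ 9 * X) := by
    calc T ^ (1 / c) ≤ ((2 * (10 ^ 9 * X)) ^ c) ^ (1 / c) := by
          gcongr
          refine hT2'.trans ?_
          rw [Real.mul_rpow (x := 2) (by norm_num) (by linarith)]
          gcongr
          exact Real.self_le_rpow_of_one_le (by norm_num) hc1.le
      _ = 2 * (10 ^ 9 * X) := by
          rw [← Real.rpow_mul (by linarith), mul_one_div_cancel hc0.ne', Real.rpow_one]
  have hratio : ∀ x ∈ Set.Icc X (2 * X),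
      (10 ^ 20 : ℝ)⁻¹ ≤ x ^ c / T ∧ x ^ c / T ≤ (10 ^ 8 : ℝ)⁻¹ := by
    intro x hx
    have hx0 : 0 < x := by linarith [hx.1]
    have h1 : X ^ c ≤ x ^ c := Real.rpow_le_rpow hXpos.le hx.1 hc0.le
    have h2 : x ^ c ≤ 2 ^ c * X ^ c := by
      rw [← Real.mul_rpow (by norm_num) hXpos.le]
      exact Real.rpow_le_rpow hx0.le hx.2 hc0.le
    constructor
    · rw [le_div_iff₀ hT0]
      have h3 : ((10 : ℝ) ^ 9) ^ c ≤ (10 ^ 9) ^ (2 : ℝ) :=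
        Real.rpow_le_rpow_of_exponent_le (by norm_num) (by linarith)
      rw [Real.rpow_two] at h3
      calc (10 ^ 20 : ℝ)⁻¹ * T ≤ (10 ^ 20 : ℝ)⁻¹ * (2 * ((10 ^ 9) ^ 2 * X ^ c)) := by
            gcongr; rw [hYc] at hT2'; refine hT2'.trans ?_; gcongr
        _ ≤ X ^ c := by nlinarith
        _ ≤ _ := h1
    · rw [div_le_iff₀ hT0]
      have h3 : (10 ^ 8 : ℝ) * 2 ^ c ≤ (10 ^ 9) ^ c := by
        rw [show (10 ^ 9 : ℝ) = (10 ^ 9 / 2) * 2 by norm_num,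
          Real.mul_rpow (by norm_num) (by norm_num)]
        gcongr
        exact le_trans (by norm_num) (Real.self_le_rpow_of_one_le (by norm_num) hc1.le)
      have h4 : (10 ^ 8 : ℝ) * (2 ^ c * X ^ c) ≤ T := by
        rw [hYc] at hT1
        refine le_trans ?_ hT1
        rw [← mul_assoc]; gcongr
      have := h2.trans (show 2 ^ c * X ^ c ≤ (10 ^ 8 : ℝ)⁻¹ * T by
        rw [inv_mul_eq_div, le_div_iff₀ (by norm_num)]; linarith)
      exact this
  have hAB : |h * w * T ^ (1 / c)| + |m * T| ≤ X ^ (27 / 26 : ℝ) := by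
    refine le_trans ?_ hHH
    rw [abs_mul, abs_mul, abs_mul, abs_of_pos hw0, abs_of_pos hT0,
      abs_of_pos (a := T ^ (1 / c)) (by positivity)]
    have hH0 : 0 ≤ H := (abs_nonneg _).trans hH
    have hH0' : 0 ≤ H' := (abs_nonneg _).trans hH'
    gcongr
    exact (mul_le_of_le_one_right (abs_nonneg _) hw1).trans hH
  have one_le : ∀ k : ℤ, k ≠ 0 → 1 ≤ |(k : ℝ)| := fun k hk => by
    exact_mod_cast Int.one_le_abs hk
  have hM : X ≤ 1 / w * |h * w * T ^ (1 / c)| ∨ h * w * T ^ (1 / c) = 0 ∧ X ≤ |m * T| := by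
    rcases eq_or_ne h 0 with h0 | h0
    · right
      refine ⟨by simp [h0], ?_⟩
      have := one_le m (by tauto)
      rw [abs_mul, abs_of_pos hT0]
      nlinarith
    · left
      have := one_le h h0
      rw [abs_mul, abs_mul, abs_of_pos hw0, abs_of_pos (a := T ^ (1 / c)) (by positivity)]
      have e : 1 / w * (|(h : ℝ)| * w * T ^ (1 / c)) = |(h : ℝ)| * T ^ (1 / c) := by field_simp
      rw [e]
      nlinarith
  have key := hX0 X ((le_max_left _ _).trans hX) T (h * w * T ^ (1 / c)) (m * T) (1 / w) hratio hAB
    (by rw [le_div_iff₀ hw0]; linarith) hM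
  have e : ∑ n ∈ Ioc ⌊X⌋₊ ⌊2 * X⌋₊, ((Λ n : ℝ) : ℂ) *
        expi (h * (w * (T - (n : ℝ) ^ c) ^ (1 / c)) + m * (n : ℝ) ^ c) =
      ∑ n ∈ Ioc ⌊X⌋₊ ⌊2 * X⌋₊, ((Λ n : ℝ) : ℂ) * expi (phase c T (h * w * T ^ (1 / c)) (m * T) n) := by
    refine sum_congr rfl fun n hn => ?_
    rw [mem_Ioc] at hn
    have hn1 : X ≤ n := (Nat.lt_of_floor_lt hn.1).le
    have hn2 : (n : ℝ) ≤ 2 * X := (Nat.le_floor_iff (by linarith)).1 hn.2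
    have hr := (hratio n ⟨hn1, hn2⟩).2
    congr 2
    unfold phase
    have h1 : T - (n : ℝ) ^ c = T * (1 - (n : ℝ) ^ c / T) := by field_simp
    rw [h1, Real.mul_rpow hT0.le (by
      have : (10 ^ 8 : ℝ)⁻¹ ≤ 1 := by norm_num
      linarith)]
    field_simp
  rw [e]
  exact key

end

section
open ArithmeticFunction

theorem sum_vonMangoldt_Ioc_le {X : ℝ} (hX : 1 ≤ X) :
    ∑ n ∈ Ioc ⌊X⌋₊ ⌊2 * X⌋₊, Λ n ≤ 2 * X * Real.log (2 * X) := by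
  have h1 : ∑ n ∈ Ioc ⌊X⌋₊ ⌊2 * X⌋₊, Λ n ≤ ∑ n ∈ Ioc ⌊X⌋₊ ⌊2 * X⌋₊, Real.log (2 * X) := by
    refine sum_le_sum fun n hn => ?_
    rw [mem_Ioc] at hn
    have hn1 : 0 < n := by lia
    have hn2 : (n : ℝ) ≤ 2 * X := (Nat.le_floor_iff (by linarith)).1 hn.2
    exact vonMangoldt_le_log.trans (Real.log_le_log (by exact_mod_cast hn1) hn2)
  refine h1.trans ?_
  rw [sum_const, nsmul_eq_mul, Nat.card_Ioc]
  have h2 : ((⌊2 * X⌋₊ - ⌊X⌋₊ : ℕ) : ℝ) ≤ 2 * X :=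
    le_trans (by exact_mod_cast Nat.sub_le _ _) (Nat.floor_le (by linarith))
  have : 0 ≤ Real.log (2 * X) := Real.log_nonneg (by linarith)
  gcongr

theorem abs_sub_rpow_floor_sub_le {c X w V β y : ℝ} (hc1 : 1 < c) (hc2 : c ≤ 2) (hX : 0 < X)
    (hw0 : 0 < w) (hw1 : w ≤ 1) (hV : (10 ^ 9 * X) ^ c ≤ V) (hβ : 0 ≤ β) (hy0 : 0 ≤ y)
    (hy : y ≤ 2 * X) :
    |w * (V - ⌊y ^ c⌋) ^ (1 / c) - w * (V + β - y ^ c) ^ (1 / c)| ≤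
      X ^ (1 - c) * |Int.fract (y ^ c) - β| := by
  have hc0 : 0 < c := by linarith
  have hXc : 0 < X ^ c := by positivity
  have h1 : y ^ c ≤ 4 * X ^ c := by
    calc y ^ c ≤ (2 * X) ^ c := by gcongr
      _ = 2 ^ c * X ^ c := Real.mul_rpow (by norm_num) hX.le
      _ ≤ 2 ^ (2 : ℝ) * X ^ c := by gcongr; norm_num
      _ = 4 * X ^ c := by norm_num
  have h2 : 5 * X ^ c ≤ V := by
    refine le_trans ?_ hV
    rw [Real.mul_rpow (by norm_num) hX.le]
    gcongr
    exact le_trans (by norm_num) (Real.self_le_rpow_of_one_le (by norm_num) hc1.le)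
  have h3 : V - ⌊y ^ c⌋ = V - y ^ c + Int.fract (y ^ c) := by rw [Int.fract]; ring
  have hf := Int.fract_nonneg (y ^ c)
  have h4 := abs_rpow_sub_rpow_le (γ := 1 / c) (y := X ^ c) (u := V - ⌊y ^ c⌋) (v := V + β - y ^ c)
    (by positivity) (by rw [div_le_one hc0]; exact hc1.le) hXc (by linarith) (by linarith)
  rw [← mul_sub, abs_mul, abs_of_pos hw0]
  refine (mul_le_of_le_one_left (abs_nonneg _) hw1).trans (h4.trans (le_of_eq ?_))
  congr 1
  · rw [← Real.rpow_mul hX.le]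
    congr 1
    field_simp
  · rw [h3]; congr 1; ring

theorem exists_sum_vonMangoldt_psi_bound {c : ℝ} (hc1 : 1 < c) (hc2 : c < 82 / 79) :
    ∃ η > 0, η ≤ 1 / 100 ∧ ∃ X0 : ℝ, ∀ X ≥ X0, ∀ w V : ℝ, (10 ^ 9 * X) ^ c ≤ V → V ≤ (10 ^ 9 * X) ^ c + 1 →
      0 < w → w ≤ 1 → 1 / w ≤ X ^ η →
      |∑ n ∈ Ioc ⌊X⌋₊ ⌊2 * X⌋₊, Λ n * psi (-(w * (V - ⌊(n : ℝ) ^ c⌋) ^ (1 / c)))| ≤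
        X ^ (2 - c - 2 * η) := by
  obtain ⟨X1, hX1⟩ := exists_vonMangoldt_expi_bound hc1 hc2
  obtain ⟨η, hη⟩ : ∃ η : ℝ, 100 * η = 82 / 79 - c := ⟨(82 / 79 - c) / 100, by ring⟩
  have hη0 : 0 < η := by linarith
  refine ⟨η, hη0, by linarith, ?_⟩
  have hK := eventually_exists_kernel (a := c - 1 + 10 * η) (ε := 10 * η) (by linarith)
    (by linarith) (by linarith) (by linarith)
  have hK' := eventually_exists_kernel (a := 10 * η) (ε := 10 * η) (by linarith)
    (by linarith) (by linarith) (by linarith)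
  have hlog := eventually_add_mul_log_le_rpow (1 + 10 ^ 22 * Real.log 2) (10 ^ 22) hη0
  have hconst := eventually_le_rpow (2 * 10 ^ 9 + 2 * (10 ^ 9) ^ c)
    (a := 27 / 26 - c - 30 * η) (by linarith)
  have h25 := eventually_le_rpow 25 hη0
  obtain ⟨X2, hX2⟩ := Filter.eventually_atTop.1
    (hK.and (hK'.and (hlog.and (hconst.and (h25.and (Filter.eventually_ge_atTop 2))))))
  refine ⟨max X1 X2, fun X hX w V hV1 hV2 hw0 hw1 hw => ?_⟩
  obtain ⟨⟨D, p, hD0, hDl, hDu, hp0, hp, htail⟩, ⟨D', p', hD0', hDl', hDu', hp0', hp', htail'⟩, hlog,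
    hconst, h25, hX2⟩ := hX2 X ((le_max_right _ _).trans hX)
  have hX1 := hX1 X ((le_max_left _ _).trans hX)
  clear hK hK'
  have hXpos : 0 < X := by linarith
  have hXone : 1 ≤ X := by linarith
  have hc0 : 0 < c := by linarith
  have mono : ∀ {a b : ℝ}, a ≤ b → X ^ a ≤ X ^ b :=
    fun h => Real.rpow_le_rpow_of_exponent_le hXone h
  have mulpow : ∀ a b : ℝ, X ^ a * X ^ b = X ^ (a + b) := fun a b => (Real.rpow_add hXpos a b).symm
  have hlog' : 1 + 10 ^ 22 * Real.log (2 * X) ≤ X ^ η := by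
    rw [Real.log_mul (by norm_num) hXpos.ne']; linarith
  have hlogpos : 0 ≤ Real.log (2 * X) := Real.log_nonneg (by linarith)
  set E : ℝ := X ^ (2 - c - 98 * η) with hE
  set A : ℝ := ∑ n ∈ Ioc ⌊X⌋₊ ⌊2 * X⌋₊, Λ n with hA
  have hA0 : 0 ≤ A := sum_nonneg fun _ _ => vonMangoldt_nonneg
  have hA1 : A ≤ X ^ (1 + η) := by
    calc A ≤ 2 * X * Real.log (2 * X) := sum_vonMangoldt_Ioc_le hXone
      _ = X * (2 * Real.log (2 * X)) := by ring
      _ ≤ X * X ^ η := by gcongr; linarith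
      _ = X ^ (1 + η) := by rw [Real.rpow_add hXpos, Real.rpow_one]
  have hHH : X ^ (c - 1 + 30 * η) * (2 * (10 ^ 9 * X)) + X ^ (30 * η) * (2 * (10 ^ 9 * X) ^ c) ≤
      X ^ (27 / 26 : ℝ) := by
    have e1 : X ^ (c - 1 + 30 * η) * (2 * (10 ^ 9 * X)) = 2 * 10 ^ 9 * X ^ (c + 30 * η) := by
      rw [show c + 30 * η = c - 1 + 30 * η + 1 by ring, Real.rpow_add_one hXpos.ne']; ring
    have e2 : X ^ (30 * η) * (2 * (10 ^ 9 * X) ^ c) = 2 * (10 ^ 9) ^ c * X ^ (c + 30 * η) := by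
      rw [Real.mul_rpow (by norm_num) hXpos.le, Real.rpow_add hXpos]; ring
    rw [e1, e2, ← add_mul]
    calc _ ≤ X ^ (27 / 26 - c - 30 * η) * X ^ (c + 30 * η) := by gcongr
      _ = _ := by rw [mulpow]; ring_nf
  have hS : ∀ n ∈ Ioc ⌊X⌋₊ ⌊2 * X⌋₊, (n : ℝ) ≤ 2 * X := fun n hn =>
    (Nat.le_floor_iff (by linarith)).1 (mem_Ioc.1 hn).2
  have main := abs_sum_psi_le_of_bins (Q := 2 * D) (s := X ^ (-(c - 1 + 10 * η))) (τ := X⁻¹)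
    (ρ := X ^ (-(10 * η))) (τ' := X⁻¹) (E := E) (lam := X ^ (1 - c)) hp0 hp le_rfl (by lia)
    (by positivity) (by positivity) (htail _) hp0' hp' le_rfl hD0' (by positivity) (by positivity)
    (htail' _) (Ioc ⌊X⌋₊ ⌊2 * X⌋₊) (fun n => Λ n) (fun n => (n : ℝ) ^ c)
    (fun n => w * (V - ⌊(n : ℝ) ^ c⌋) ^ (1 / c))
    (fun β n => w * (V + β - (n : ℝ) ^ c) ^ (1 / c)) (fun _ _ => vonMangoldt_nonneg)
    (by positivity) (by positivity)
    (fun β hβ0 _ n hn => abs_sub_rpow_floor_sub_le hc1 (by linarith) hXpos hw0 hw1 hV1 hβ0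
      (by positivity) (hS n hn))
    (fun β hβ0 hβ1 h m hhm hh hm => by
      refine (hX1 (V + β) w (X ^ (c - 1 + 30 * η)) (X ^ (30 * η)) h m (by linarith) (by linarith)
        hw0 hw1 hhm ?_ ?_ hHH).trans ?_
      · have : |(h : ℝ)| ≤ D := by exact_mod_cast hh.le
        exact this.trans (hDu.trans (mono (by linarith)))
      · have : |(m : ℝ)| ≤ D' := by exact_mod_cast hm.le
        exact this.trans (hDu'.trans (mono (by linarith)))
      · calc 10 ^ 22 * (1 / w) * Real.log (2 * X) * X ^ (1 - 3 / 79 : ℝ)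
            = (1 / w) * (10 ^ 22 * Real.log (2 * X)) * X ^ (1 - 3 / 79 : ℝ) := by ring
          _ ≤ X ^ η * X ^ η * X ^ (1 - 3 / 79 : ℝ) := by gcongr; linarith
          _ = E := by rw [mulpow, mulpow, hE]; congr 1; linarith)
    hD0
  refine main.trans ?_
  rw [← hA]
  push_cast
  set s : ℝ := X ^ (-(c - 1 + 10 * η)) with hs
  have hs0 : 0 ≤ s := by positivity
  have hE0 : 0 ≤ E := by positivity
  have hinv : X⁻¹ ≤ s := by
    rw [← Real.rpow_neg_one]; exact mono (by linarith)
  have hDr : (0 : ℝ) < D := by exact_mod_cast hD0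
  have hDr' : (1 : ℝ) ≤ D' := by exact_mod_cast hD0'
  have hQ : 1 / (2 * (2 * (D : ℝ))) ≤ s := by
    have h1 : (1 : ℝ) / D ≤ s := by
      rw [hs, Real.rpow_neg hXpos.le, ← one_div]
      gcongr
      exact (mono (by linarith)).trans hDl
    refine le_trans ?_ h1
    gcongr
    linarith
  have hlr : X ^ (1 - c) * X ^ (-(10 * η)) = s := by rw [mulpow, hs]; ring_nf
  have hlD : X ^ (1 - c) * (1 / (D' : ℝ)) ≤ s := by
    rw [← hlr, Real.rpow_neg hXpos.le (10 * η), ← one_div]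
    gcongr
    exact (mono (by linarith)).trans hDl'
  have hlam1 : X ^ (1 - c) ≤ 1 := Real.rpow_le_one_of_one_le_of_nonpos hXone (by linarith)
  have hDup : (D' : ℝ) ≤ X ^ (30 * η) := hDu'.trans (mono (by linarith))
  have hlogD : 1 + Real.log D ≤ X ^ η := by
    have h1 : (D : ℝ) ≤ 2 * X := by
      have := hDu.trans (mono (b := 1) (by linarith))
      rw [Real.rpow_one] at this
      linarith
    have := Real.log_le_log hDr h1
    linarith
  have hlogD0 : 0 ≤ 1 + Real.log D := by
    have := Real.log_nonneg (x := D) (by exact_mod_cast hD0)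
    linarith
  have hone : 1 ≤ X ^ η := Real.one_le_rpow hXone hη0.le
  set Z : ℝ := X ^ (30 * η) * X ^ η * E with hZ
  have hsA : s * A ≤ X ^ (2 - c - 9 * η) := by
    calc s * A ≤ s * X ^ (1 + η) := by gcongr
      _ = _ := by rw [hs, mulpow]; ring_nf
  have hZl : Z ≤ X ^ (2 - c - 9 * η) := by
    rw [hZ, hE, mulpow, mulpow]; exact mono (by linarith)
  have hDE : D' * E ≤ Z := by
    calc D' * E ≤ X ^ (30 * η) * E := by gcongr
      _ = X ^ (30 * η) * 1 * E := by ring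
      _ ≤ Z := by rw [hZ]; gcongr
  have t1 : A * (2 * s + X⁻¹ + 1 / (2 * (2 * (D : ℝ))) + 2 * X ^ (1 - c) * X ^ (-(10 * η)) + X⁻¹) ≤
      7 * (s * A) := by
    rw [mul_assoc 2 (X ^ (1 - c)), hlr]
    calc _ ≤ A * (2 * s + s + s + 2 * s + s) := by gcongr
      _ = _ := by ring
  have t2 : 2 * D' * E * (1 + Real.log D) ≤ 2 * Z := by
    calc 2 * D' * E * (1 + Real.log D) ≤ 2 * X ^ (30 * η) * E * X ^ η := by gcongr
      _ = 2 * Z := by rw [hZ]; ring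
  have t3 : 2 * X ^ (1 - c) * (2 * X ^ (-(10 * η)) * D' + 2) * (A / D' + E) ≤
      8 * (s * A) + 8 * Z := by
    have hρ1 : X ^ (-(10 * η)) ≤ 1 := Real.rpow_le_one_of_one_le_of_nonpos hXone (by linarith)
    have e : 2 * X ^ (1 - c) * (2 * X ^ (-(10 * η)) * D' + 2) * (A / D' + E) =
        4 * (X ^ (1 - c) * X ^ (-(10 * η))) * A + 4 * (X ^ (1 - c) * (1 / D')) * A +
          X ^ (1 - c) * ((4 * X ^ (-(10 * η)) * D' + 4) * E) := by
      field_simp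
      ring
    rw [e, hlr]
    have h1 : X ^ (1 - c) * ((4 * X ^ (-(10 * η)) * D' + 4) * E) ≤ 8 * (D' * E) := by
      calc _ ≤ 1 * ((4 * 1 * D' + 4 * D') * E) := by gcongr; linarith
        _ = _ := by ring
    have h2 : 4 * (X ^ (1 - c) * (1 / D')) * A ≤ 4 * s * A := by gcongr
    linarith
  calc _ ≤ 7 * (s * A) + 2 * Z + (8 * (s * A) + 8 * Z) := by gcongr
    _ ≤ 25 * X ^ (2 - c - 9 * η) := by linarith
    _ ≤ X ^ η * X ^ (2 - c - 9 * η) := by gcongr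
    _ ≤ _ := by rw [mulpow]; exact mono (by linarith)

end

section
open ArithmeticFunction

theorem abs_psi_le_one (t : ℝ) : |psi t| ≤ 1 := by
  unfold psi
  rw [abs_le]
  constructor <;> linarith [Int.fract_nonneg t, Int.fract_lt_one t]

theorem abs_sum_prime_log_mul_le {X : ℝ} (hX : 1 ≤ X) {f : ℕ → ℝ} (hf : ∀ n, |f n| ≤ 1) :
    |∑ n ∈ (Ioc ⌊X⌋₊ ⌊2 * X⌋₊).filter Nat.Prime, Real.log n * f n| ≤
      |∑ n ∈ Ioc ⌊X⌋₊ ⌊2 * X⌋₊, Λ n * f n| + 2 * √(2 * X) * Real.log (2 * X) := by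
  have h1 := sum_filter_add_sum_filter_not (Ioc ⌊X⌋₊ ⌊2 * X⌋₊) Nat.Prime fun n => Λ n * f n
  have h2 : ∑ n ∈ (Ioc ⌊X⌋₊ ⌊2 * X⌋₊).filter Nat.Prime, Λ n * f n =
      ∑ n ∈ (Ioc ⌊X⌋₊ ⌊2 * X⌋₊).filter Nat.Prime, Real.log n * f n :=
    sum_congr rfl fun n hn => by rw [vonMangoldt_apply_prime (mem_filter.1 hn).2]
  have h3 : |∑ n ∈ (Ioc ⌊X⌋₊ ⌊2 * X⌋₊).filter (fun n => ¬ n.Prime), Λ n * f n| ≤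
      2 * √(2 * X) * Real.log (2 * X) := by
    calc _ ≤ ∑ n ∈ (Ioc ⌊X⌋₊ ⌊2 * X⌋₊).filter (fun n => ¬ n.Prime), Λ n := by
          refine (abs_sum_le_sum_abs _ _).trans (sum_le_sum fun n _ => ?_)
          rw [abs_mul, abs_of_nonneg vonMangoldt_nonneg]
          exact mul_le_of_le_one_right vonMangoldt_nonneg (hf n)
      _ ≤ ∑ n ∈ (Ioc 0 ⌊2 * X⌋₊).filter (fun n => ¬ n.Prime), Λ n :=
          sum_le_sum_of_subset_of_nonneg
            (filter_subset_filter _ (Ioc_subset_Ioc_left (Nat.zero_le _)))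
            fun _ _ _ => vonMangoldt_nonneg
      _ = _ := (Chebyshev.psi_sub_theta_eq_sum_not_prime _).symm
      _ ≤ _ := Chebyshev.psi_sub_theta_le (by linarith)
  have h4 : ∑ n ∈ (Ioc ⌊X⌋₊ ⌊2 * X⌋₊).filter Nat.Prime, Real.log n * f n =
      ∑ n ∈ Ioc ⌊X⌋₊ ⌊2 * X⌋₊, Λ n * f n -
        ∑ n ∈ (Ioc ⌊X⌋₊ ⌊2 * X⌋₊).filter (fun n => ¬ n.Prime), Λ n * f n := by
    rw [← h1, h2]; ring
  rw [h4]
  exact (abs_sub _ _).trans (by linarith)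

theorem primesIn_eq {c : ℝ} (hc : 1 ≤ c) {N : ℕ} (hN : 1 ≤ N) :
    primesIn c N = (Ioc ⌊PP c N⌋₊ ⌊2 * PP c N⌋₊).filter Nat.Prime := by
  have hN1 : (1 : ℝ) ≤ N := by exact_mod_cast hN
  have hP0 : 0 ≤ PP c N := by unfold PP; positivity
  have hPN : 2 * PP c N ≤ N := by
    have h1 : (N : ℝ) ^ (1 / c) ≤ (N : ℝ) ^ (1 : ℝ) :=
      Real.rpow_le_rpow_of_exponent_le hN1 (by rw [div_le_one (by linarith)]; exact hc)
    rw [Real.rpow_one] at h1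
    unfold PP
    rw [inv_mul_eq_div]
    linarith [show 2 * ((N : ℝ) ^ (1 / c) / 10 ^ 9) ≤ (N : ℝ) ^ (1 / c) by
      have : 0 ≤ (N : ℝ) ^ (1 / c) := by positivity
      linarith]
  ext p
  rw [primesIn, mem_filter, mem_filter, mem_range, mem_Ioc, Nat.floor_lt hP0,
    Nat.le_floor_iff (by linarith)]
  constructor
  · tauto
  · rintro ⟨⟨h1, h2⟩, h3⟩
    have h4 : (p : ℝ) ≤ N := h2.trans hPN
    have h5 : p ≤ N := by exact_mod_cast h4
    exact ⟨by lia, h3, h1, h2⟩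

end

theorem tendsto_PP {c : ℝ} (hc : 0 < c) : Filter.Tendsto (PP c) Filter.atTop Filter.atTop :=
  ((tendsto_rpow_atTop (one_div_pos.2 hc)).comp tendsto_natCast_atTop_atTop).const_mul_atTop
    (by norm_num)

/-- Suppose that `1 < c < 82/79` and `γ = 1/c`.  Then for `j = 0, 1` there exists a
constant `C > 0` such that `|Σ_j| ≤ C · N^(2γ-1) / log N` for all sufficiently
large `N`. -/
theorem Sigma_j_upper_bound (c : ℝ) (hc1 : 1 < c) (hc2 : c < 82 / 79)
    (j : ℕ) (hj : j ≤ 1) :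
    ∃ C : ℝ, 0 < C ∧ ∃ N₀ : ℕ, ∀ N : ℕ, N₀ ≤ N →
      |SigmaJ c j N| ≤ C * (N : ℝ) ^ (2 * (1 / c) - 1) / Real.log N := by
  obtain ⟨η, hη0, hη1, X1, hX1⟩ := exists_sum_vonMangoldt_psi_bound hc1 hc2
  have hc0 : 0 < c := by linarith
  refine ⟨2, by norm_num, Filter.eventually_atTop.1 ?_⟩
  have ev1 := eventually_add_mul_log_le_rpow (2 * Real.log (10 ^ 9)) 2 (a := η / 2) (by linarith)
  have ev2 := eventually_add_mul_log_le_rpow (4 * Real.log 2) 4 (a := 1 / 4) (by norm_num)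
  filter_upwards [(tendsto_PP hc0).eventually ev1, (tendsto_PP hc0).eventually ev2,
    (tendsto_PP hc0).eventually (Filter.eventually_ge_atTop (max X1 1)),
    Filter.eventually_ge_atTop 3] with N h1 h2 hX hN
  have hXone : 1 ≤ PP c N := (le_max_right _ _).trans hX
  replace hX : X1 ≤ PP c N := (le_max_left _ _).trans hX
  have hN0 : (3 : ℝ) ≤ N := by exact_mod_cast hN
  have hY : 10 ^ 9 * PP c N = (N : ℝ) ^ (1 / c) := by
    unfold PP; rw [mul_inv_cancel_left₀ (by norm_num)]
  have hYc : (10 ^ 9 * PP c N) ^ c = N := by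
    rw [hY, ← Real.rpow_mul (by linarith), one_div_mul_cancel hc0.ne', Real.rpow_one]
  have hprimes := primesIn_eq hc1.le (N := N) (by lia)
  unfold SigmaJ
  rw [hprimes]
  generalize PP c N = X at *
  have hX0 : 0 < X := by linarith
  have hlogN : Real.log N ≤ X ^ (η / 2) := by
    refine le_trans ?_ h1
    rw [← hYc, Real.log_rpow (by positivity), Real.log_mul (by norm_num) hX0.ne']
    have := Real.log_nonneg hXone
    have : 0 ≤ Real.log (10 ^ 9) := Real.log_nonneg (by norm_num)
    nlinarith
  have hlog1 : 1 ≤ Real.log N := by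
    rw [Real.le_log_iff_exp_le (by linarith)]
    linarith [Real.exp_one_lt_d9]
  have hsq : X ^ (η / 2) * X ^ (η / 2) = X ^ η := by rw [← Real.rpow_add hX0]; ring_nf
  have hsqrt : 2 * √(2 * X) * Real.log (2 * X) ≤ X ^ (2 - c - 2 * η) := by
    have hl : 0 ≤ Real.log (2 * X) := Real.log_nonneg (by linarith)
    have hr : √(2 * X) ≤ 2 * X ^ (1 / 2 : ℝ) := by
      rw [Real.sqrt_mul (by norm_num), Real.sqrt_eq_rpow X]
      gcongr
      rw [Real.sqrt_le_left (by norm_num)]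
      norm_num
    calc 2 * √(2 * X) * Real.log (2 * X) ≤ 2 * (2 * X ^ (1 / 2 : ℝ)) * Real.log (2 * X) := by gcongr
      _ = X ^ (1 / 2 : ℝ) * (4 * Real.log 2 + 4 * Real.log X) := by
          rw [Real.log_mul (by norm_num) hX0.ne']; ring
      _ ≤ X ^ (1 / 2 : ℝ) * X ^ (1 / 4 : ℝ) := by gcongr
      _ = X ^ (3 / 4 : ℝ) := by rw [← Real.rpow_add hX0]; norm_num
      _ ≤ _ := Real.rpow_le_rpow_of_exponent_le hXone (by linarith)
  have hj' : (j : ℝ) ≤ 1 := by exact_mod_cast hj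
  have inner_le : ∀ d ∈ Icc 1 ⌊Real.log N⌋₊, |((ArithmeticFunction.moebius d : ℤ) : ℝ) *
      ∑ p ∈ (Ioc ⌊X⌋₊ ⌊2 * X⌋₊).filter Nat.Prime,
        psi (-(1 / (d : ℝ) ^ 2) * ((N : ℝ) + (j : ℝ) - (⌊(p : ℝ) ^ c⌋ : ℝ)) ^ (1 / c))
          * Real.log p| ≤ 2 * X ^ (2 - c - 2 * η) := by
    intro d hd
    rw [mem_Icc] at hd
    have hd1 : (1 : ℝ) ≤ d := by exact_mod_cast hd.1
    have hd2 : (d : ℝ) ≤ X ^ (η / 2) :=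
      ((Nat.le_floor_iff (by linarith)).1 hd.2).trans hlogN
    have hμ : |((ArithmeticFunction.moebius d : ℤ) : ℝ)| ≤ 1 := by
      exact_mod_cast ArithmeticFunction.abs_moebius_le_one
    rw [abs_mul]
    refine (mul_le_of_le_one_left (abs_nonneg _) hμ).trans ?_
    have key := hX1 X hX (1 / (d : ℝ) ^ 2) (N + j) (by rw [hYc]; simp) (by rw [hYc]; linarith)
      (by positivity) (by rw [div_le_one (by positivity)]; exact one_le_pow₀ hd1)
      (by rw [one_div_one_div, ← hsq, sq]; gcongr)
    have := abs_sum_prime_log_mul_le hXone (f := fun p =>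
      psi (-(1 / (d : ℝ) ^ 2) * ((N : ℝ) + (j : ℝ) - (⌊(p : ℝ) ^ c⌋ : ℝ)) ^ (1 / c)))
      fun _ => abs_psi_le_one _
    simp only [neg_mul, mul_comm (Real.log _)] at this ⊢
    linarith
  rw [le_div_iff₀ (by linarith)]
  calc |∑ d ∈ Icc 1 ⌊Real.log N⌋₊, _| * Real.log N
      ≤ (∑ d ∈ Icc 1 ⌊Real.log N⌋₊, 2 * X ^ (2 - c - 2 * η)) * Real.log N := by
        gcongr
        exact (abs_sum_le_sum_abs _ _).trans (sum_le_sum inner_le)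
    _ = ⌊Real.log N⌋₊ * (2 * X ^ (2 - c - 2 * η)) * Real.log N := by
        rw [sum_const, Nat.card_Icc, nsmul_eq_mul, Nat.add_sub_cancel]
    _ ≤ X ^ (η / 2) * (2 * X ^ (2 - c - 2 * η)) * X ^ (η / 2) := by
        gcongr
        exact (Nat.floor_le (by linarith)).trans hlogN
    _ = 2 * X ^ (2 - c - η) := by
        rw [show 2 - c - η = η + (2 - c - 2 * η) by ring, Real.rpow_add hX0, ← hsq]; ring
    _ ≤ 2 * (10 ^ 9 * X) ^ (2 - c) := by
        gcongr 2 * ?_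
        calc X ^ (2 - c - η) ≤ X ^ (2 - c) := Real.rpow_le_rpow_of_exponent_le hXone (by linarith)
          _ ≤ _ := by
            apply Real.rpow_le_rpow hX0.le _ (by linarith)
            linarith
    _ = 2 * (N : ℝ) ^ (2 * (1 / c) - 1) := by
        rw [hY, ← Real.rpow_mul (by linarith)]
        congr 2
        field_simp
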